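/- (Baik–Deift–Johansson) There exists a unique solution u : ℝ → ℝ of the Painlevé II equation u″(s) = s·u(s) + 2u(s)³ satisfying u(s)/Ai(s) → 1 as s → +∞ (the Hastings–McLeod solution), and for this u and for every x ∈ ℝ, lim_{N→∞} #{π ∈ S_N : ℓ_N(π) ≤ 2√N + x N^{1/6}} / N! = exp( − ∫_x^∞ (s − x) u(s)² ds ). -/

import Mathlib

open MeasureTheory Filter Topology Complex

/-- The Airy function, via the contour-integral formula
`Ai(x) = (1/(2πi)) ∫₀^∞ (e^{2πi/3} e^{x e^{2πi/3} t} - e^{-2πi/3} e^{x e^{-2πi/3} t}) e^{-t³/3} dt`. -/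
noncomputable def Ai (x : ℝ) : ℂ :=
  (2 * (Real.pi : ℂ) * Complex.I)⁻¹ *
    ∫ t in Set.Ioi (0 : ℝ),
      (Complex.exp (2 * (Real.pi : ℂ) * Complex.I / 3) *
          Complex.exp ((x : ℂ) * Complex.exp (2 * (Real.pi : ℂ) * Complex.I / 3) * t) -
        Complex.exp (-(2 * (Real.pi : ℂ) * Complex.I) / 3) *
          Complex.exp ((x : ℂ) * Complex.exp (-(2 * (Real.pi : ℂ) * Complex.I) / 3) * t)) *
        Complex.exp (-(t : ℂ) ^ 3 / 3)

/-- The length of a longest increasing subsequence of a permutation of `{1,…,N}`. -/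
noncomputable def lisLen {N : ℕ} (σ : Equiv.Perm (Fin N)) : ℕ :=
  sSup {k : ℕ | ∃ f : Fin k → Fin N, StrictMono f ∧ StrictMono fun a => σ (f a)}

namespace BDJ

/-- `w` has a weakly increasing subsequence of length `i` with letters at least `y`. -/
def Inc (w : List ℕ) (i y : ℕ) : Prop :=
  ∃ l : List ℕ, l.Sublist w ∧ l.length = i ∧ l.Pairwise (· ≤ ·) ∧ ∀ a ∈ l, y ≤ a

lemma inc_mono_y {w : List ℕ} {i y y' : ℕ} (h : y' ≤ y) (hw : Inc w i y) : Inc w i y' := by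
  obtain ⟨l, h1, h2, h3, h4⟩ := hw
  exact ⟨l, h1, h2, h3, fun a ha => h.trans (h4 a ha)⟩

lemma inc_mono_i {w : List ℕ} {i j y : ℕ} (h : j ≤ i) (hw : Inc w i y) : Inc w j y := by
  obtain ⟨l, h1, h2, h3, h4⟩ := hw
  refine ⟨l.take j, (List.take_sublist j l).trans h1, by simp [h2, h], ?_, ?_⟩
  · exact h3.sublist (List.take_sublist j l)
  · exact fun a ha => h4 a ((List.take_sublist j l).subset ha)

lemma inc_cons {w : List ℕ} {c i y : ℕ} :
    Inc (c :: w) (i + 1) y ↔ Inc w (i + 1) y ∨ (y ≤ c ∧ Inc w i c) := by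
  constructor
  · rintro ⟨l, h1, h2, h3, h4⟩
    rcases List.sublist_cons_iff.1 h1 with h | ⟨r, rfl, hr⟩
    · exact Or.inl ⟨l, h, h2, h3, h4⟩
    · rw [List.pairwise_cons] at h3
      exact Or.inr ⟨h4 c (by simp), r, hr, by simpa using h2, h3.2, h3.1⟩
  · rintro (⟨l, h1, h2, h3, h4⟩ | ⟨hy, l, h1, h2, h3, h4⟩)
    · exact ⟨l, h1.cons c, h2, h3, h4⟩
    · refine ⟨c :: l, h1.cons_cons c, by simp [h2], List.pairwise_cons.2 ⟨h4, h3⟩, ?_⟩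
      intro a ha
      rcases List.mem_cons.1 ha with rfl | ha
      · exact hy
      · exact hy.trans (h4 a ha)

def Good (n : ℕ) (x : ℕ → ℕ) (w : List ℕ) : Prop := ∀ i ≤ n, ¬ Inc w (i + 1) (x i)

lemma not_inc_nil (i y : ℕ) : ¬ Inc [] (i + 1) y := by
  rintro ⟨l, h1, h2, -⟩
  rw [List.sublist_nil] at h1
  simp [h1] at h2

lemma good_cons {n : ℕ} {x : ℕ → ℕ} (hx : Antitone x) {w : List ℕ} {c i0 : ℕ}
    (hi0 : i0 < n) (h1 : x (i0 + 1) ≤ c) (h2 : c < x i0) :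
    Good n x (c :: w) ↔ Good n (Function.update x i0 c) w := by
  constructor
  · intro h i hi
    by_cases hii : i = i0
    · subst hii
      rw [Function.update_self]
      intro hc
      exact h (i + 1) hi0 (inc_cons.2 (Or.inr ⟨h1, hc⟩))
    · rw [Function.update_of_ne hii]
      intro hc
      exact h i hi (inc_cons.2 (Or.inl hc))
  · intro h i hi hc
    rcases inc_cons.1 hc with hc | ⟨hc1, hc2⟩
    · by_cases hii : i = i0
      · subst hii
        refine h i hi ?_
        rw [Function.update_self]
        exact inc_mono_y h2.le hc
      · refine h i hi ?_
        rwa [Function.update_of_ne hii]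
    · have : i0 + 1 ≤ i := by
        by_contra hlt
        have := hx (show i ≤ i0 by omega)
        omega
      refine h i0 hi0.le ?_
      rw [Function.update_self]
      exact inc_mono_i this hc2

lemma not_good_cons {n : ℕ} {x : ℕ → ℕ} {w : List ℕ} {c : ℕ} (h : x 0 ≤ c) :
    ¬ Good n x (c :: w) := fun hg =>
  hg 0 (Nat.zero_le _) (inc_cons.2 (Or.inr ⟨h, [], by simp, by simp, by simp, by simp⟩))

lemma good_nil (n : ℕ) (x : ℕ → ℕ) : Good n x [] := fun i _ => not_inc_nil i _

/-- The number of good words. -/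
def hcount (n : ℕ) : ℕ → (ℕ → ℕ) → ℕ
  | 0, _ => 1
  | N + 1, x => ∑ i ∈ Finset.range n, ∑ y ∈ Finset.Ico (x (i + 1)) (x i),
      hcount n N (Function.update x i y)

lemma sum_range_Ico (f : ℕ → ℕ) (x : ℕ → ℕ) (hx : Antitone x) (n : ℕ) :
    ∑ i ∈ Finset.range n, ∑ y ∈ Finset.Ico (x (i + 1)) (x i), f y =
      ∑ y ∈ Finset.Ico (x n) (x 0), f y := by
  induction n with
  | zero => simp
  | succ k ih =>
    rw [Finset.sum_range_succ, ih, add_comm,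
      Finset.sum_Ico_consecutive _ (hx (Nat.le_succ k)) (hx (Nat.zero_le k))]

lemma antitone_update {x : ℕ → ℕ} (hx : Antitone x) {i y : ℕ} (h1 : x (i + 1) ≤ y)
    (h2 : y ≤ x i) : Antitone (Function.update x i y) := by
  apply antitone_nat_of_succ_le
  intro k
  rcases eq_or_ne k i with rfl | hk
  · simp [h1]
  · rw [Function.update_of_ne hk]
    rcases eq_or_ne (k + 1) i with rfl | hk'
    · simpa using h2.trans (hx (Nat.le_succ k))
    · rw [Function.update_of_ne hk']
      exact hx (Nat.le_succ k)

open Classical in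
lemma card_good (n M : ℕ) (N : ℕ) : ∀ (x : ℕ → ℕ), Antitone x → x n = 0 → x 0 ≤ M →
    (Finset.univ.filter fun w : Fin N → Fin M =>
      Good n x (List.ofFn fun a => (w a : ℕ))).card = hcount n N x := by
  induction N with
  | zero =>
    intro x _ _ _
    rw [Finset.filter_true_of_mem]
    · simp [hcount]
    · intro w _
      simpa using good_nil n x
  | succ N ih =>
    intro x hx hn hM
    have e1 : (Finset.univ.filter fun w : Fin (N + 1) → Fin M =>
        Good n x (List.ofFn fun a => (w a : ℕ))).card =
        ∑ c : Fin M, (Finset.univ.filter fun w : Fin N → Fin M =>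
          Good n x ((c : ℕ) :: List.ofFn fun a => (w a : ℕ))).card := by
      simp only [Finset.card_filter]
      rw [← (Fin.consEquiv fun _ : Fin (N + 1) => Fin M).sum_comp, Fintype.sum_prod_type]
      simp [Fin.consEquiv, List.ofFn_succ]
    have e2 : ∀ i ∈ Finset.range n, ∀ y ∈ Finset.Ico (x (i + 1)) (x i),
        hcount n N (Function.update x i y) =
        (Finset.univ.filter fun w : Fin N → Fin M =>
          Good n x (y :: List.ofFn fun a => (w a : ℕ))).card := by
      intro i hi y hy
      rw [Finset.mem_Ico] at hy
      rw [Finset.mem_range] at hi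
      rw [← ih _ (antitone_update hx hy.1 hy.2.le)]
      · congr 1
        ext w
        simp only [Finset.mem_filter, Finset.mem_univ, true_and]
        rw [good_cons hx hi hy.1 hy.2]
      · rw [Function.update_of_ne hi.ne', hn]
      · rcases eq_or_ne i 0 with rfl | h0
        · simpa using hy.2.le.trans hM
        · rwa [Function.update_of_ne h0.symm]
    rw [e1, hcount, Finset.sum_congr rfl fun i hi => Finset.sum_congr rfl (e2 i hi),
      sum_range_Ico _ _ hx, hn, ← Finset.range_eq_Ico,
      Fin.sum_univ_eq_sum_range (fun y => (Finset.univ.filter fun w : Fin N → Fin M =>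
          Good n x (y :: List.ofFn fun a => (w a : ℕ))).card) M]
    symm
    apply Finset.sum_subset (Finset.range_subset_range.2 hM)
    intro c _ hc
    rw [Finset.mem_range, not_lt] at hc
    rw [Finset.card_eq_zero, Finset.filter_eq_empty_iff]
    exact fun w _ => not_good_cons hc

end BDJ

namespace BDJ

noncomputable def ch (M : ℕ) (m : ℤ) : ℝ := if 0 ≤ m then (M.choose m.toNat : ℝ) else 0

lemma ch_succ (M : ℕ) (m : ℤ) : ch (M + 1) m = ch M m + ch M (m - 1) := by
  unfold ch
  rcases lt_trichotomy m 0 with h | h | h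
  · rw [if_neg (by omega), if_neg (by omega), if_neg (by omega)]; simp
  · subst h; simp
  · obtain ⟨k, rfl⟩ : ∃ k : ℕ, m = k + 1 := ⟨(m - 1).toNat, by omega⟩
    rw [if_pos (by omega), if_pos (by omega), if_pos (by omega)]
    have h1 : ((k : ℤ) + 1).toNat = k + 1 := by omega
    have h2 : ((k : ℤ) + 1 - 1).toNat = k := by omega
    rw [h1, h2, Nat.choose_succ_succ]
    push_cast; ring

lemma ch_eq_zero {M : ℕ} {m : ℤ} (h : (M : ℤ) < m) : ch M m = 0 := by
  unfold ch
  rw [if_pos (by omega), Nat.choose_eq_zero_of_lt (by omega)]; simp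

open Polynomial in
noncomputable def EP (k : ℤ) (M : ℕ) : Polynomial ℝ :=
  ∑ b ∈ Finset.range (M + k.natAbs + 1), Polynomial.monomial b (ch M (b + k) / b.factorial)

lemma EP_coeff (k : ℤ) (M b : ℕ) : (EP k M).coeff b = ch M (b + k) / b.factorial := by
  unfold EP
  simp only [Polynomial.finsetSum_coeff, Polynomial.coeff_monomial]
  rw [Finset.sum_ite_eq']
  split_ifs with h
  · rfl
  · rw [Finset.mem_range] at h
    rw [ch_eq_zero (by omega)]; simp

lemma EP_derivative (k : ℤ) (M : ℕ) : Polynomial.derivative (EP k M) = EP (k + 1) M := by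
  ext b
  rw [Polynomial.coeff_derivative, EP_coeff, EP_coeff, Nat.factorial_succ]
  have : ((b + 1 : ℕ) : ℤ) + k = b + (k + 1) := by push_cast; ring
  rw [this]
  have h1 : (b.factorial : ℝ) ≠ 0 := by positivity
  have h2 : ((b : ℝ) + 1) ≠ 0 := by positivity
  push_cast
  field_simp

lemma EP_succ (k : ℤ) (M : ℕ) : EP k (M + 1) = EP k M + EP (k - 1) M := by
  ext b
  rw [Polynomial.coeff_add, EP_coeff, EP_coeff, EP_coeff, ch_succ]
  rw [show (b : ℤ) + (k - 1) = b + k - 1 by ring]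
  ring

lemma EP_sum (k : ℤ) (a b : ℕ) (h : a ≤ b) :
    EP (k + 1) b = EP (k + 1) a + ∑ y ∈ Finset.Ico a b, EP k y := by
  induction b, h using Nat.le_induction with
  | base => simp
  | succ m hm ih =>
    rw [EP_succ, ih, Finset.sum_Ico_succ_top hm, add_sub_cancel_right]; ring

lemma EP_zero {k : ℤ} (h : 0 < k) : EP k 0 = 0 := by
  ext b
  rw [EP_coeff, ch_eq_zero (by push_cast; omega)]; simp

noncomputable def Mat (n : ℕ) (x : ℕ → ℕ) : Matrix (Fin n) (Fin n) (Polynomial ℝ) :=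
  Matrix.of fun i j => EP ((i : ℤ) - j) (x i)

lemma derivative_det {n : ℕ} (A : Matrix (Fin n) (Fin n) (Polynomial ℝ)) :
    Polynomial.derivative A.det =
      ∑ i, (A.updateRow i fun j => Polynomial.derivative (A i j)).det := by
  have key : ∀ B : Matrix (Fin n) (Fin n) (Polynomial ℝ), B.det =
      ∑ σ : Equiv.Perm (Fin n), (Equiv.Perm.sign σ : ℤ) • ∏ i, B i (σ i) := by
    intro B
    rw [← Matrix.det_transpose, Matrix.det_apply]
    rfl
  rw [key A]
  simp_rw [key]
  rw [Finset.sum_comm, Polynomial.derivative_sum]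
  refine Finset.sum_congr rfl fun σ _ => ?_
  rw [map_zsmul, Polynomial.derivative_prod_finset, Finset.smul_sum]
  refine Finset.sum_congr rfl fun i _ => ?_
  congr 1
  rw [← Finset.mul_prod_erase Finset.univ _ (Finset.mem_univ i), Matrix.updateRow_self, mul_comm]
  congr 1
  refine Finset.prod_congr rfl fun k hk => ?_
  rw [Matrix.updateRow_ne (Finset.ne_of_mem_erase hk)]

lemma det_updateRow_sum' {n : ℕ} (A : Matrix (Fin n) (Fin n) (Polynomial ℝ)) (i : Fin n)
    (s : Finset ℕ) (f : ℕ → Fin n → Polynomial ℝ) :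
    (A.updateRow i (fun j => ∑ y ∈ s, f y j)).det = ∑ y ∈ s, (A.updateRow i (f y)).det := by
  classical
  induction s using Finset.induction_on with
  | empty =>
    simp only [Finset.sum_empty]
    exact Matrix.det_eq_zero_of_row_eq_zero i (by simp)
  | insert a s ha ih =>
    rw [Finset.sum_insert ha, ← ih, ← Matrix.det_updateRow_add]
    congr 2
    ext1 j
    simp [Finset.sum_insert ha]

lemma Mat_derivative {n : ℕ} {x : ℕ → ℕ} (hx : Antitone x) (hn : x n = 0) :
    Polynomial.derivative (Mat n x).det =
      ∑ i ∈ Finset.range n, ∑ y ∈ Finset.Ico (x (i + 1)) (x i),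
        (Mat n (Function.update x i y)).det := by
  rw [derivative_det, ← Fin.sum_univ_eq_sum_range
    (fun i => ∑ y ∈ Finset.Ico (x (i + 1)) (x i), (Mat n (Function.update x i y)).det) n]
  refine Finset.sum_congr rfl fun i _ => ?_
  have h1 : (fun j => Polynomial.derivative (Mat n x i j)) =
      (fun j : Fin n => EP ((i : ℤ) - j + 1) (x (i + 1))) +
      (fun j : Fin n => ∑ y ∈ Finset.Ico (x (i + 1)) (x i), EP ((i : ℤ) - j) y) := by
    ext1 j
    simp only [Mat, Matrix.of_apply, Pi.add_apply]
    rw [EP_derivative, EP_sum _ _ _ (hx (Nat.le_succ (i : ℕ)))]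
  rw [h1, Matrix.det_updateRow_add, det_updateRow_sum' _ _ _ (fun y j => EP ((i : ℤ) - j) y)]
  have h2 : ((Mat n x).updateRow i (fun j : Fin n => EP ((i : ℤ) - j + 1) (x (i + 1)))).det = 0 := by
    by_cases hi : (i : ℕ) + 1 < n
    · refine Matrix.det_zero_of_row_eq (i := i) (j := ⟨i + 1, hi⟩)
        (by intro h; simpa using congrArg Fin.val h) ?_
      rw [Matrix.updateRow_self, Matrix.updateRow_ne (by intro h; simpa using congrArg Fin.val h)]
      ext1 j
      simp only [Mat, Matrix.of_apply]
      congr 1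
      push_cast; ring
    · have hi' : (i : ℕ) + 1 = n := by have := i.2; omega
      refine Matrix.det_eq_zero_of_row_eq_zero i fun j => ?_
      rw [Matrix.updateRow_self, hi', hn, EP_zero]
      have := j.2
      omega
  rw [h2, zero_add]
  refine Finset.sum_congr rfl fun y _ => ?_
  congr 1
  ext1 a b
  rcases eq_or_ne a i with rfl | h
  · rw [Matrix.updateRow_self]; simp [Mat]
  · rw [Matrix.updateRow_ne h]
    simp only [Mat, Matrix.of_apply]
    rw [Function.update_of_ne (by intro h'; exact h (Fin.ext h'))]

lemma Mat_coeff (n N : ℕ) : ∀ (x : ℕ → ℕ), Antitone x → x n = 0 →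
    (Mat n x).det.coeff N * N.factorial = hcount n N x := by
  induction N with
  | zero =>
    intro x _ _
    rw [Polynomial.coeff_zero_eq_eval_zero]
    have : Polynomial.eval 0 (Mat n x).det = ((Polynomial.evalRingHom (0 : ℝ)).mapMatrix (Mat n x)).det := by
      rw [← RingHom.map_det]; rfl
    rw [this, Matrix.det_of_isLowerTriangular]
    · simp [hcount, Mat, ← Polynomial.coeff_zero_eq_eval_zero, EP_coeff, ch]
    · intro i j hij
      have : (i : ℕ) < j := hij
      simp [Mat, ← Polynomial.coeff_zero_eq_eval_zero, EP_coeff, ch]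
      omega
  | succ N ih =>
    intro x hx hn
    have h := Polynomial.coeff_derivative (Mat n x).det N
    rw [Nat.factorial_succ]
    push_cast
    rw [← mul_assoc, ← h, Mat_derivative hx hn, hcount]
    simp only [Polynomial.finsetSum_coeff, Finset.sum_mul]
    push_cast
    refine Finset.sum_congr rfl fun i hi => Finset.sum_congr rfl fun y hy => ?_
    rw [Finset.mem_Ico] at hy
    rw [Finset.mem_range] at hi
    refine ih _ (antitone_update hx hy.1 hy.2.le) ?_
    rw [Function.update_of_ne hi.ne', hn]

end BDJ

namespace BDJ

lemma inc_ofFn {N k : ℕ} (g : Fin N → ℕ) :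
    Inc (List.ofFn g) k 0 ↔ ∃ f : Fin k → Fin N, StrictMono f ∧ Monotone fun a => g (f a) := by
  constructor
  · rintro ⟨l, h1, rfl, h3, -⟩
    obtain ⟨f, hf⟩ := List.sublist_iff_exists_fin_orderEmbedding_get_eq.1 h1
    refine ⟨fun a => Fin.cast (by simp) (f a), fun a b hab => ?_, fun a b hab => ?_⟩
    · exact f.strictMono hab
    · have e : ∀ a, g (Fin.cast (by simp) (f a)) = l.get a := by
        intro a
        rw [hf a]
        simp
        rfl
      simp only [e]
      rcases eq_or_lt_of_le hab with rfl | hlt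
      · exact le_rfl
      · exact List.pairwise_iff_get.1 h3 a b hlt
  · rintro ⟨f, hf, hm⟩
    refine ⟨List.ofFn fun a => g (f a), ?_, by simp, ?_, by simp⟩
    · rw [List.sublist_iff_exists_fin_orderEmbedding_get_eq]
      refine ⟨OrderEmbedding.ofStrictMono
        (fun a => Fin.cast (by simp) (f (Fin.cast (by simp) a))) ?_, ?_⟩
      · intro a b hab
        exact hf (show Fin.cast _ a < Fin.cast _ b from hab)
      · intro a
        simp
        rfl
    · rw [List.pairwise_ofFn]
      intro i j hij
      exact hm hij.le

lemma lisLen_le_iff {N : ℕ} (σ : Equiv.Perm (Fin N)) (n : ℕ) :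
    lisLen σ ≤ n ↔ ¬ ∃ f : Fin (n + 1) → Fin N, StrictMono f ∧ StrictMono fun a => σ (f a) := by
  have hb : BddAbove {k : ℕ | ∃ f : Fin k → Fin N, StrictMono f ∧ StrictMono fun a => σ (f a)} := by
    refine ⟨N, ?_⟩
    rintro k ⟨f, hf, -⟩
    simpa using Fintype.card_le_of_injective f hf.injective
  have hne : {k : ℕ | ∃ f : Fin k → Fin N, StrictMono f ∧ StrictMono fun a => σ (f a)}.Nonempty :=
    ⟨0, Fin.elim0, fun a => a.elim0, fun a => a.elim0⟩
  constructor
  · rintro h hf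
    have := le_csSup hb (show n + 1 ∈ _ from hf)
    unfold lisLen at h
    omega
  · intro h
    refine csSup_le hne ?_
    rintro k ⟨f, h1, h2⟩
    by_contra hk
    have hk' : n + 1 ≤ k := by omega
    exact h ⟨fun a => f (Fin.castLE hk' a), fun a b hab => h1 (by simpa using hab),
      fun a b hab => h2 (by simpa using hab)⟩

lemma inc_perm {N M n : ℕ} (σ : Equiv.Perm (Fin N)) (e : Fin N ↪o Fin M) :
    ¬ Inc (List.ofFn fun a => (e (σ a) : ℕ)) (n + 1) 0 ↔ lisLen σ ≤ n := by
  rw [lisLen_le_iff, inc_ofFn, not_iff_not]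
  refine exists_congr fun f => and_congr_right fun hf => ?_
  constructor
  · intro h a b hab
    have h1 : e (σ (f a)) ≤ e (σ (f b)) := h hab.le
    rw [e.le_iff_le] at h1
    exact lt_of_le_of_ne h1 fun h2 => hab.ne (hf.injective (σ.injective h2))
  · intro h a b hab
    exact e.monotone (h.monotone hab)

noncomputable def q (N n : ℕ) : ℝ :=
  (Nat.card {σ : Equiv.Perm (Fin N) // lisLen σ ≤ n} : ℝ) / (N.factorial : ℝ)

lemma comp_bij (N M : ℕ) : Function.Bijective
    (fun p : Equiv.Perm (Fin N) × (Fin N ↪o Fin M) =>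
      (⟨fun a => p.2 (p.1 a), fun a b h => p.1.injective (p.2.injective h)⟩ :
        {w : Fin N → Fin M // Function.Injective w})) := by
  constructor
  · rintro ⟨σ, e⟩ ⟨σ', e'⟩ h
    have h1 : ∀ a, e (σ a) = e' (σ' a) := fun a => congrFun (congrArg Subtype.val h) a
    have h2 : e = e' := by
      apply DFunLike.coe_injective
      refine (StrictMono.range_inj e.strictMono e'.strictMono).1 ?_
      ext y
      constructor
      · rintro ⟨a, rfl⟩
        exact ⟨σ' (σ.symm a), by rw [← h1]; simp⟩
      · rintro ⟨a, rfl⟩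
        exact ⟨σ (σ'.symm a), by rw [h1]; simp⟩
    subst h2
    congr 1
    ext1 a
    exact e.injective (h1 a)
  · rintro ⟨w, hw⟩
    refine ⟨⟨(Tuple.sort w)⁻¹, OrderEmbedding.ofStrictMono (w ∘ Tuple.sort w)
      ((Tuple.monotone_sort w).strictMono_of_injective (hw.comp (Tuple.sort w).injective))⟩, ?_⟩
    apply Subtype.ext
    ext1 a
    simp

open Classical in
lemma card_inj (N M n : ℕ) :
    ((Finset.univ.filter fun w : Fin N → Fin M => Function.Injective w ∧
      ¬ Inc (List.ofFn fun a => (w a : ℕ)) (n + 1) 0).card : ℝ) = q N n * M.descFactorial N := by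
  have h0 : Nat.card {w : Fin N → Fin M // Function.Injective w} = M.descFactorial N := by
    rw [Nat.card_congr (Equiv.subtypeInjectiveEquivEmbedding (Fin N) (Fin M))]
    simp [Fintype.card_embedding_eq]
  have h1 : Nat.card {w : Fin N → Fin M // Function.Injective w} =
      N.factorial * Nat.card (Fin N ↪o Fin M) := by
    rw [← Nat.card_congr (Equiv.ofBijective _ (comp_bij N M)), Nat.card_prod, Nat.card_perm]
    simp
  have h2 : (Finset.univ.filter fun w : Fin N → Fin M => Function.Injective w ∧
      ¬ Inc (List.ofFn fun a => (w a : ℕ)) (n + 1) 0).card =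
      Nat.card {σ : Equiv.Perm (Fin N) // lisLen σ ≤ n} * Nat.card (Fin N ↪o Fin M) := by
    rw [← Nat.card_prod]
    have : (Finset.univ.filter fun w : Fin N → Fin M => Function.Injective w ∧
      ¬ Inc (List.ofFn fun a => (w a : ℕ)) (n + 1) 0).card =
      Nat.card {w : Fin N → Fin M // Function.Injective w ∧
      ¬ Inc (List.ofFn fun a => (w a : ℕ)) (n + 1) 0} := by
      rw [Nat.card_eq_fintype_card, Fintype.card_subtype]
    rw [this]
    symm
    refine Nat.card_congr (Equiv.ofBijective (fun p => ⟨fun a => p.2 (p.1.1 a),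
      fun a b h => p.1.1.injective (p.2.injective h), (inc_perm p.1.1 p.2).2 p.1.2⟩) ⟨?_, ?_⟩)
    · rintro ⟨⟨σ, hσ⟩, e⟩ ⟨⟨σ', hσ'⟩, e'⟩ h
      have := @(comp_bij N M).1 (σ, e) (σ', e') (Subtype.ext (by simpa using h))
      simpa using this
    · rintro ⟨w, hw, hi⟩
      obtain ⟨⟨σ, e⟩, h⟩ := (comp_bij N M).2 ⟨w, hw⟩
      have h' := congrArg Subtype.val h
      simp only at h'
      subst h'
      exact ⟨⟨⟨σ, (inc_perm σ e).1 hi⟩, e⟩, rfl⟩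
  rw [h2, ← h0, h1, q]
  have : (N.factorial : ℝ) ≠ 0 := by positivity
  push_cast
  field_simp

def xM (n M : ℕ) : ℕ → ℕ := fun k => if k < n then M else 0

lemma xM_anti (n M : ℕ) : Antitone (xM n M) := by
  intro a b h
  unfold xM
  split_ifs <;> omega

lemma good_xM {N n M : ℕ} (w : Fin N → Fin M) :
    Good n (xM n M) (List.ofFn fun a => (w a : ℕ)) ↔
      ¬ Inc (List.ofFn fun a => (w a : ℕ)) (n + 1) 0 := by
  constructor
  · intro h
    simpa [xM] using h n le_rfl
  · intro h i hi hI
    rcases hi.eq_or_lt with rfl | hlt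
    · exact h (inc_mono_y (Nat.zero_le _) hI)
    · obtain ⟨l, h1, h2, -, h4⟩ := hI
      rw [xM, if_pos hlt] at h4
      cases l with
      | nil => simp at h2
      | cons a l =>
        have := h4 a (by simp)
        have h5 := h1.subset (show a ∈ a :: l by simp)
        rw [List.mem_ofFn] at h5
        obtain ⟨b, rfl⟩ := h5
        have := (w b).2
        omega

open Classical in
lemma hcount_bounds (N n M : ℕ) :
    q N n * M.descFactorial N ≤ hcount n N (xM n M) ∧
    (hcount n N (xM n M) : ℝ) ≤ q N n * M.descFactorial N + ((M : ℝ) ^ N - M.descFactorial N) ∧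
    (hcount n N (xM n M) : ℝ) ≤ (M : ℝ) ^ N := by
  rw [← card_good n M N (xM n M) (xM_anti n M) (by simp [xM]) (by unfold xM; split_ifs <;> omega)]
  simp only [good_xM]
  rw [← card_inj]
  have h0 : (Finset.univ.filter fun w : Fin N → Fin M => Function.Injective w).card
      = M.descFactorial N := by
    rw [← Fintype.card_subtype, Fintype.card_congr (Equiv.subtypeInjectiveEquivEmbedding _ _)]
    simp [Fintype.card_embedding_eq]
  refine ⟨?_, ?_, ?_⟩
  · norm_cast
    exact Finset.card_le_card fun w hw => by
      simp only [Finset.mem_filter, Finset.mem_univ, true_and] at hw ⊢; exact hw.2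
  · have h1 := Finset.card_filter_add_card_filter_not (s := (Finset.univ : Finset (Fin N → Fin M)))
      (fun w => Function.Injective w)
    rw [h0] at h1
    simp only [Finset.card_univ, Fintype.card_pi, Fintype.card_fin, Finset.prod_const] at h1
    have h2 : (Finset.univ.filter fun w : Fin N → Fin M =>
        ¬ Inc (List.ofFn fun a => (w a : ℕ)) (n + 1) 0).card ≤
        (Finset.univ.filter fun w : Fin N → Fin M => Function.Injective w ∧
      ¬ Inc (List.ofFn fun a => (w a : ℕ)) (n + 1) 0).card +
        (Finset.univ.filter fun w : Fin N → Fin M => ¬ Function.Injective w).card := by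
      refine le_trans (Finset.card_le_card ?_) (Finset.card_union_le _ _)
      intro w hw
      simp only [Finset.mem_filter, Finset.mem_univ, true_and, Finset.mem_union] at hw ⊢
      tauto
    have h1' : (M.descFactorial N : ℝ) + ((Finset.univ.filter fun w : Fin N → Fin M =>
        ¬ Function.Injective w).card : ℝ) = (M : ℝ) ^ N := by exact_mod_cast h1
    rw [← h1', add_sub_cancel_left]
    exact_mod_cast h2
  · have := Finset.card_filter_le (Finset.univ : Finset (Fin N → Fin M))
      (fun w => ¬ Inc (List.ofFn fun a => (w a : ℕ)) (n + 1) 0)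
    simp only [Finset.card_univ, Fintype.card_pi, Fintype.card_fin, Finset.prod_const] at this
    exact_mod_cast this

lemma tendsto_desc (N : ℕ) :
    Tendsto (fun M : ℕ => (M.descFactorial N : ℝ) / (M : ℝ) ^ N) atTop (𝓝 1) := by
  induction N with
  | zero => simp
  | succ N ih =>
    have h : Tendsto (fun M : ℕ => ((M - N : ℕ) : ℝ) / M) atTop (𝓝 1) := by
      have : Tendsto (fun M : ℕ => 1 - (N : ℝ) / M) atTop (𝓝 (1 - 0)) :=
        tendsto_const_nhds.sub (tendsto_const_div_atTop_nhds_zero_nat (N : ℝ))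
      rw [sub_zero] at this
      refine this.congr' ?_
      filter_upwards [eventually_ge_atTop (N + 1)] with M hM
      rw [Nat.cast_sub (by omega)]
      have : (M : ℝ) ≠ 0 := Nat.cast_ne_zero.2 (by omega)
      field_simp
    have := h.mul ih
    rw [one_mul] at this
    refine this.congr fun M => ?_
    rw [Nat.descFactorial_succ, pow_succ]
    push_cast
    rw [div_mul_div_comm, mul_comm (M : ℝ)]

lemma tendsto_hcount (N n : ℕ) :
    Tendsto (fun M : ℕ => (hcount n N (xM n M) : ℝ) / (M : ℝ) ^ N) atTop (𝓝 (q N n)) := by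
  have h := tendsto_desc N
  have h1 : Tendsto (fun M : ℕ => q N n * ((M.descFactorial N : ℝ) / (M : ℝ) ^ N)) atTop
      (𝓝 (q N n)) := by simpa using h.const_mul (q N n)
  have h2 : Tendsto (fun M : ℕ => q N n * ((M.descFactorial N : ℝ) / (M : ℝ) ^ N) +
      (1 - (M.descFactorial N : ℝ) / (M : ℝ) ^ N)) atTop (𝓝 (q N n)) := by
    simpa using h1.add (h.const_sub 1)
  refine tendsto_of_tendsto_of_tendsto_of_le_of_le' h1 h2 ?_ ?_
  · filter_upwards [eventually_ge_atTop 1] with M hM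
    have hp : 0 < (M : ℝ) ^ N := by positivity
    rw [← mul_div_assoc]
    exact div_le_div_of_nonneg_right (hcount_bounds N n M).1 hp.le
  · filter_upwards [eventually_ge_atTop 1] with M hM
    have hp : 0 < (M : ℝ) ^ N := by positivity
    refine (div_le_div_of_nonneg_right (hcount_bounds N n M).2.1 hp.le).trans (le_of_eq ?_)
    field_simp

end BDJ

namespace BDJ

noncomputable def invf (m : ℤ) : ℝ := if 0 ≤ m then 1 / (m.toNat.factorial : ℝ) else 0

noncomputable def eZ (k : ℤ) (τ : ℝ) : ℝ := ∑' b : ℕ, τ ^ b / b.factorial * invf (b + k)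

lemma invf_nonneg (m : ℤ) : 0 ≤ invf m := by
  unfold invf; split_ifs <;> positivity

lemma invf_le_one (m : ℤ) : invf m ≤ 1 := by
  unfold invf
  split_ifs
  · rw [div_le_one (by positivity)]
    exact_mod_cast Nat.one_le_iff_ne_zero.2 (Nat.factorial_ne_zero _)
  · norm_num

lemma eZ_summable (k : ℤ) (τ : ℝ) : Summable fun b : ℕ => τ ^ b / b.factorial * invf (b + k) := by
  refine Summable.of_norm_bounded (g := fun b : ℕ => |τ| ^ b / b.factorial)
    (Real.summable_pow_div_factorial _) fun b => ?_
  rw [norm_mul, norm_div, norm_pow]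
  simp only [Real.norm_eq_abs, Nat.abs_cast]
  rw [abs_of_nonneg (invf_nonneg _)]
  exact mul_le_of_le_one_right (by positivity) (invf_le_one _)

lemma ch_div_le {M : ℕ} (hM : 1 ≤ M) (m : ℤ) : |ch M m / (M : ℝ) ^ m| ≤ 1 := by
  have h0 : (0 : ℝ) < M := by exact_mod_cast hM
  unfold ch
  split_ifs with h
  · obtain ⟨k, rfl⟩ := Int.eq_ofNat_of_zero_le h
    simp only [Int.toNat_natCast, zpow_natCast]
    rw [abs_of_nonneg (by positivity), div_le_one (by positivity)]
    exact_mod_cast Nat.choose_le_pow M k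
  · simp

lemma ch_div_tendsto (m : ℤ) : Tendsto (fun M : ℕ => ch M m / (M : ℝ) ^ m) atTop (𝓝 (invf m)) := by
  unfold ch invf
  split_ifs with h
  · obtain ⟨k, rfl⟩ := Int.eq_ofNat_of_zero_le h
    simp only [Int.toNat_natCast, zpow_natCast]
    refine ((tendsto_desc k).div_const (k.factorial : ℝ)).congr fun M => ?_
    have h1 : (M.descFactorial k : ℝ) = k.factorial * M.choose k := by
      exact_mod_cast Nat.descFactorial_eq_factorial_mul_choose M k
    have : (k.factorial : ℝ) ≠ 0 := by positivity
    rw [h1]; field_simp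
  · simp

lemma EP_tendsto (k : ℤ) (τ : ℝ) :
    Tendsto (fun M : ℕ => (M : ℝ) ^ (-k) * (EP k M).eval (τ / M)) atTop (𝓝 (eZ k τ)) := by
  have h : Tendsto (fun M : ℕ => ∑' b : ℕ, τ ^ b / b.factorial * (ch M (b + k) / (M : ℝ) ^ ((b : ℤ) + k)))
      atTop (𝓝 (eZ k τ)) := by
    refine tendsto_tsum_of_dominated_convergence (bound := fun b : ℕ => |τ| ^ b / b.factorial)
      (Real.summable_pow_div_factorial _) (fun b => (ch_div_tendsto _).const_mul _) ?_
    filter_upwards [eventually_ge_atTop 1] with M hM b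
    rw [norm_mul, norm_div, norm_pow]
    simp only [Real.norm_eq_abs, Nat.abs_cast]
    exact mul_le_of_le_one_right (by positivity) (ch_div_le hM _)
  refine h.congr' ?_
  filter_upwards [eventually_ge_atTop 1] with M hM
  have h0 : (0 : ℝ) < M := by exact_mod_cast hM
  rw [tsum_eq_sum (s := Finset.range (M + k.natAbs + 1))]
  · simp only [EP, Polynomial.eval_finsetSum, Polynomial.eval_monomial, Finset.mul_sum]
    refine Finset.sum_congr rfl fun b _ => ?_
    rw [zpow_add₀ h0.ne', zpow_neg, zpow_natCast, div_pow]
    field_simp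
  · intro b hb
    rw [Finset.mem_range] at hb
    rw [ch_eq_zero (by omega)]; simp

lemma det_conj {n : ℕ} (v : ℝ) (hv : v ≠ 0) (A : Matrix (Fin n) (Fin n) ℝ) :
    (Matrix.of fun i j : Fin n => v ^ (-((i : ℤ) - j)) * A i j).det = A.det := by
  have h1 := Matrix.det_mul_column (fun i : Fin n => v ^ (-(i : ℤ))) A
  have h2 := Matrix.det_mul_row (fun j : Fin n => v ^ (j : ℤ))
    (Matrix.of fun i j => v ^ (-(i : ℤ)) * A i j)
  have h3 : (Matrix.of fun i j : Fin n => v ^ (-((i : ℤ) - j)) * A i j) =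
      Matrix.of fun i j : Fin n => v ^ (j : ℤ) * (Matrix.of (fun i j : Fin n => v ^ (-(i : ℤ)) * A i j)) i j := by
    ext i j
    simp only [Matrix.of_apply]
    rw [← mul_assoc, ← zpow_add₀ hv]
    congr 2; ring
  rw [h3, h2, h1, ← mul_assoc, ← Finset.prod_mul_distrib]
  have : ∀ i : Fin n, v ^ (i : ℤ) * v ^ (-(i : ℤ)) = 1 := fun i => by
    rw [← zpow_add₀ hv]; simp
  rw [Finset.prod_congr rfl fun i _ => this i]
  simp

lemma q_nonneg (N n : ℕ) : 0 ≤ q N n := by unfold q; positivity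

lemma q_le_one (N n : ℕ) : q N n ≤ 1 := by
  unfold q
  rw [div_le_one (by positivity)]
  have := Nat.card_le_card_of_injective
    (fun σ : {σ : Equiv.Perm (Fin N) // lisLen σ ≤ n} => σ.1) Subtype.val_injective
  rw [Nat.card_perm] at this
  rw [Nat.card_eq_fintype_card (α := Fin N), Fintype.card_fin] at this
  exact_mod_cast this

lemma gessel (n : ℕ) (τ : ℝ) :
    ∑' N : ℕ, q N n * (τ ^ N / N.factorial) =
      (Matrix.of fun i j : Fin n => eZ ((i : ℤ) - j) τ).det := by
  have h1 : Tendsto (fun M : ℕ => ∑' N : ℕ, (hcount n N (xM n M) : ℝ) / (M : ℝ) ^ N *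
      (τ ^ N / N.factorial)) atTop (𝓝 (∑' N : ℕ, q N n * (τ ^ N / N.factorial))) := by
    refine tendsto_tsum_of_dominated_convergence (bound := fun b : ℕ => |τ| ^ b / b.factorial)
      (Real.summable_pow_div_factorial _) (fun b => (tendsto_hcount _ _).mul_const _) ?_
    filter_upwards [eventually_ge_atTop 1] with M hM b
    have h0 : (0 : ℝ) < M := by exact_mod_cast hM
    rw [norm_mul, norm_div (τ ^ b), norm_pow]
    simp only [Real.norm_eq_abs, Nat.abs_cast]
    refine mul_le_of_le_one_left (by positivity) ?_
    rw [abs_of_nonneg (by positivity), div_le_one (by positivity)]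
    exact (hcount_bounds b n M).2.2
  have h2 : Tendsto (fun M : ℕ => (Matrix.of fun i j : Fin n =>
      (M : ℝ) ^ (-((i : ℤ) - j)) * (EP ((i : ℤ) - j) M).eval (τ / M)).det) atTop
      (𝓝 (Matrix.of fun i j : Fin n => eZ ((i : ℤ) - j) τ).det) := by
    have hc : Continuous (fun A : Matrix (Fin n) (Fin n) ℝ => A.det) :=
      Continuous.matrix_det continuous_id
    refine (hc.tendsto _).comp ?_
    refine tendsto_pi_nhds.2 fun i => tendsto_pi_nhds.2 fun j => ?_
    exact EP_tendsto _ _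
  refine tendsto_nhds_unique (h1.congr' ?_) h2
  filter_upwards [eventually_ge_atTop 1] with M hM
  have h0 : (0 : ℝ) < M := by exact_mod_cast hM
  have h3 := det_conj (n := n) (M : ℝ) h0.ne'
    (Matrix.of fun i j : Fin n => (EP ((i : ℤ) - j) M).eval (τ / M))
  simp only [Matrix.of_apply] at h3
  rw [h3]
  have h4 : (Matrix.of fun i j : Fin n => (EP ((i : ℤ) - j) M).eval (τ / M)) =
      (Polynomial.evalRingHom (τ / (M : ℝ))).mapMatrix (Mat n (xM n M)) := by
    ext i j
    simp [Mat, xM]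
  rw [h4, ← RingHom.map_det, Polynomial.coe_evalRingHom, Polynomial.eval_eq_sum_range]
  have h5 : ∀ N, (Mat n (xM n M)).det.coeff N = hcount n N (xM n M) / N.factorial := by
    intro N
    rw [← Mat_coeff n N (xM n M) (xM_anti n M) (by simp [xM])]
    have : (N.factorial : ℝ) ≠ 0 := by positivity
    field_simp
  rw [tsum_eq_sum (s := Finset.range ((Mat n (xM n M)).det.natDegree + 1))]
  · refine Finset.sum_congr rfl fun N _ => ?_
    rw [h5, div_pow]
    field_simp
  · intro N hN
    rw [Finset.mem_range, not_lt] at hN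
    have h6 := h5 N
    rw [Polynomial.coeff_eq_zero_of_natDegree_lt (by omega)] at h6
    have h7 : (N.factorial : ℝ) ≠ 0 := by positivity
    have : (hcount n N (xM n M) : ℝ) = 0 := by
      rcases div_eq_zero_iff.1 h6.symm with h | h
      · exact h
      · exact absurd h h7
    rw [this]; simp

lemma lisLen_le {N : ℕ} (σ : Equiv.Perm (Fin N)) : lisLen σ ≤ N := by
  rw [lisLen_le_iff]
  rintro ⟨f, hf, -⟩
  have := Fintype.card_le_of_injective f hf.injective
  simp at this

lemma q_eq_one {N n : ℕ} (h : N ≤ n) : q N n = 1 := by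
  unfold q
  have : Nat.card {σ : Equiv.Perm (Fin N) // lisLen σ ≤ n} = N.factorial := by
    rw [Nat.card_congr (Equiv.subtypeUnivEquiv fun σ => (lisLen_le σ).trans h), Nat.card_perm]
    simp
  rw [this, div_self (by positivity)]

lemma q_succ_le (N n : ℕ) : q (N + 1) n ≤ q N n := by
  unfold q
  have key : Nat.card {σ : Equiv.Perm (Fin (N + 1)) // lisLen σ ≤ n} ≤
      Nat.card (Fin (N + 1) × {σ : Equiv.Perm (Fin N) // lisLen σ ≤ n}) := by
    have hw : ∀ σ : Equiv.Perm (Fin (N + 1)), Function.Injective fun a : Fin N => σ a.succ :=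
      fun σ a b h => Fin.succ_injective _ (σ.injective h)
    have hdec : ∀ σ : Equiv.Perm (Fin (N + 1)), ∃ τ : Equiv.Perm (Fin N),
        ∀ a, σ a.succ = (σ 0).succAbove (τ a) := by
      intro σ
      have : ∀ a : Fin N, ∃ b, (σ 0).succAbove b = σ a.succ := fun a =>
        Fin.exists_succAbove_eq (fun h => (Fin.succ_ne_zero a) (σ.injective h))
      choose g hg using this
      have hgi : Function.Injective g := fun a b h => hw σ (by simp only [← hg, h])
      exact ⟨Equiv.ofBijective g (Finite.injective_iff_bijective.1 hgi), fun a => (hg a).symm⟩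
    choose T hT using hdec
    refine Nat.card_le_card_of_injective (fun σ => (σ.1 0, ⟨T σ.1, ?_⟩)) ?_
    · have h1 := (lisLen_le_iff σ.1 n).1 σ.2
      rw [lisLen_le_iff]
      rintro ⟨f, hf, hf'⟩
      refine h1 ⟨fun a => (f a).succ, fun a b h => Fin.succ_lt_succ_iff.2 (hf h), fun a b h => ?_⟩
      simp only [hT]
      exact Fin.strictMono_succAbove _ (hf' h)
    · rintro ⟨σ, hσ⟩ ⟨σ', hσ'⟩ h
      simp only [Prod.mk.injEq, Subtype.mk.injEq] at h
      apply Subtype.ext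
      apply Equiv.ext
      intro a
      cases a using Fin.cases with
      | zero => exact h.1
      | succ a => 
        show σ a.succ = σ' a.succ
        rw [hT, hT, h.1, h.2]
  rw [Nat.card_prod, Nat.card_eq_fintype_card (α := Fin (N + 1)), Fintype.card_fin] at key
  rw [div_le_div_iff₀ (by positivity) (by positivity), Nat.factorial_succ]
  have k2 : (Nat.card {σ : Equiv.Perm (Fin (N + 1)) // lisLen σ ≤ n} : ℝ) ≤
    (N + 1) * Nat.card {σ : Equiv.Perm (Fin N) // lisLen σ ≤ n} := by exact_mod_cast key
  push_cast
  nlinarith [mul_le_mul_of_nonneg_right k2 (show (0 : ℝ) ≤ N.factorial by positivity)]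

lemma q_anti (n : ℕ) : Antitone fun N => q N n := antitone_nat_of_succ_le fun N => q_succ_le N n

noncomputable def D (n : ℕ) (t : ℝ) : ℝ := ∑' N : ℕ, q N n * ((t ^ 2) ^ N / N.factorial)

lemma D_summable (n : ℕ) (τ : ℝ) : Summable fun N : ℕ => q N n * (τ ^ N / N.factorial) := by
  refine Summable.of_norm_bounded (g := fun b : ℕ => |τ| ^ b / b.factorial)
    (Real.summable_pow_div_factorial _) fun b => ?_
  rw [norm_mul, norm_div, norm_pow]
  simp only [Real.norm_eq_abs, Nat.abs_cast]
  rw [abs_of_nonneg (q_nonneg _ _)]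
  exact mul_le_of_le_one_left (by positivity) (q_le_one _ _)

lemma D_pos (n : ℕ) (t : ℝ) : 0 < D n t := by
  have h : ∀ N : ℕ, 0 ≤ q N n * ((t ^ 2) ^ N / N.factorial) := fun N =>
    mul_nonneg (q_nonneg _ _) (by positivity)
  have := (D_summable n (t ^ 2)).le_tsum 0 fun N _ => h N
  rw [q_eq_one (Nat.zero_le n)] at this
  simp at this
  unfold D; linarith

lemma D_tendsto (t : ℝ) : Tendsto (fun n => D n t) atTop (𝓝 (Real.exp (t ^ 2))) := by
  rw [Real.exp_eq_exp_ℝ, NormedSpace.exp_eq_tsum_div]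
  unfold D
  refine tendsto_tsum_of_dominated_convergence (bound := fun b : ℕ => |t ^ 2| ^ b / b.factorial)
      (Real.summable_pow_div_factorial _) (fun N => ?_) (Eventually.of_forall fun n b => ?_)
  · refine tendsto_const_nhds.congr' ?_
    filter_upwards [eventually_ge_atTop N] with n hn
    rw [q_eq_one hn, one_mul]
  · rw [norm_mul, norm_div, norm_pow]
    simp only [Real.norm_eq_abs, Nat.abs_cast]
    rw [abs_of_nonneg (q_nonneg _ _)]
    exact mul_le_of_le_one_left (by positivity) (q_le_one _ _)

end BDJ

namespace BDJ

lemma invf_natCast (k : ℕ) : invf k = 1 / (k.factorial : ℝ) := by simp [invf]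

lemma invf_neg {m : ℤ} (h : m < 0) : invf m = 0 := by unfold invf; rw [if_neg (by omega)]

lemma mul_invf (m : ℤ) : (m : ℝ) * invf m = invf (m - 1) := by
  rcases lt_trichotomy m 0 with h | h | h
  · rw [invf_neg h, invf_neg (by omega)]; simp
  · subst h; rw [invf_neg (show (0 : ℤ) - 1 < 0 by omega)]; simp
  · obtain ⟨k, rfl⟩ : ∃ k : ℕ, m = ((k + 1 : ℕ) : ℤ) := ⟨(m - 1).toNat, by omega⟩
    rw [show (((k + 1 : ℕ) : ℤ) - 1) = (k : ℤ) by push_cast; ring, invf_natCast, invf_natCast,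
      Nat.factorial_succ]
    have : (k.factorial : ℝ) ≠ 0 := by positivity
    have : (k : ℝ) + 1 ≠ 0 := by positivity
    push_cast
    field_simp

lemma eZ_rec (k : ℤ) (τ : ℝ) : k * eZ k τ = eZ (k - 1) τ - τ * eZ (k + 1) τ := by
  have h1 := eZ_summable (k - 1) τ
  have h2 := (eZ_summable (k + 1) τ).mul_left τ
  have h3 := (eZ_summable k τ).mul_left (k : ℝ)
  have h4 : (fun b : ℕ => τ ^ b / b.factorial * invf (b + (k - 1)) -
      k * (τ ^ b / b.factorial * invf (b + k))) = fun b : ℕ => b * (τ ^ b / b.factorial * invf (b + k)) := by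
    ext b
    have := mul_invf (b + k)
    rw [show (b : ℤ) + (k - 1) = b + k - 1 by ring, ← this]
    push_cast; ring
  have h5 : Summable fun b : ℕ => (b : ℝ) * (τ ^ b / b.factorial * invf (b + k)) := by
    rw [← h4]; exact h1.sub h3
  have h6 := h1.tsum_sub h3
  rw [h4, h5.tsum_eq_zero_add] at h6
  have h7 : (fun b : ℕ => ((b + 1 : ℕ) : ℝ) * (τ ^ (b + 1) / (b + 1).factorial * invf ((b + 1 : ℕ) + k))) =
      fun b : ℕ => τ * (τ ^ b / b.factorial * invf (b + (k + 1))) := by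
    ext b
    rw [show (((b + 1 : ℕ) : ℤ) + k) = b + (k + 1) by push_cast; ring, Nat.factorial_succ]
    have : (b.factorial : ℝ) ≠ 0 := by positivity
    have : (b : ℝ) + 1 ≠ 0 := by positivity
    push_cast
    field_simp
    ring
  rw [h7, tsum_mul_left, tsum_mul_left] at h6
  simp only [Nat.cast_zero, zero_mul, zero_add] at h6
  unfold eZ
  linarith

lemma eZ_neg (k : ℕ) (τ : ℝ) : eZ (-k) τ = τ ^ k * eZ k τ := by
  unfold eZ
  rw [← (eZ_summable (-k) τ).sum_add_tsum_nat_add k, ← tsum_mul_left, Finset.sum_eq_zero, zero_add]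
  · congr 1
    ext b
    rw [show (((b + k : ℕ) : ℤ) + -k) = b by push_cast; ring,
      show ((b : ℤ) + k) = ((b + k : ℕ) : ℤ) by push_cast; ring, invf_natCast, invf_natCast, pow_add]
    have : (b.factorial : ℝ) ≠ 0 := by positivity
    have : ((b + k).factorial : ℝ) ≠ 0 := by positivity
    field_simp
  · intro b hb
    rw [Finset.mem_range] at hb
    rw [invf_neg (by omega)]; simp

lemma fact_ratio (k b : ℕ) : (k.factorial : ℝ) * invf (b + k) ≤ 1 := by
  rw [show ((b : ℤ) + k) = ((b + k : ℕ) : ℤ) by push_cast; ring, invf_natCast, mul_one_div,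
    div_le_one (by positivity)]
  exact_mod_cast Nat.factorial_le (by omega)

lemma eZ_tendsto (τ : ℝ) : Tendsto (fun k : ℕ => (k.factorial : ℝ) * eZ k τ) atTop (𝓝 1) := by
  have h : Tendsto (fun k : ℕ => ∑' b : ℕ, τ ^ b / b.factorial * ((k.factorial : ℝ) * invf (b + k)))
      atTop (𝓝 (∑' b : ℕ, if b = 0 then (1 : ℝ) else 0)) := by
    refine tendsto_tsum_of_dominated_convergence (bound := fun b : ℕ => |τ| ^ b / b.factorial)
      (Real.summable_pow_div_factorial _) (fun b => ?_) (Eventually.of_forall fun k b => ?_)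
    · rcases Nat.eq_zero_or_pos b with rfl | hb
      · refine tendsto_const_nhds.congr fun k => ?_
        have : (k.factorial : ℝ) ≠ 0 := by positivity
        simp [invf_natCast, this]
      · rw [if_neg (by omega)]
        have : Tendsto (fun k : ℕ => (k.factorial : ℝ) * invf (b + k)) atTop (𝓝 0) := by
          refine squeeze_zero (fun k => mul_nonneg (by positivity) (invf_nonneg _)) (fun k => ?_)
            (tendsto_one_div_add_atTop_nhds_zero_nat (𝕜 := ℝ))
          rw [show ((b : ℤ) + k) = ((b + k : ℕ) : ℤ) by push_cast; ring, invf_natCast, mul_one_div]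
          have h1 : ((k + 1).factorial : ℝ) ≤ (b + k).factorial := by
            exact_mod_cast Nat.factorial_le (by omega)
          rw [div_le_div_iff₀ (by positivity) (by positivity)]
          rw [Nat.factorial_succ] at h1
          push_cast at h1
          nlinarith
        simpa using this.const_mul (τ ^ b / b.factorial)
    · rw [norm_mul, norm_div, norm_pow]
      simp only [Real.norm_eq_abs, Nat.abs_cast]
      refine mul_le_of_le_one_right (by positivity) ?_
      rw [abs_of_nonneg (mul_nonneg (by positivity) (invf_nonneg _))]
      exact fact_ratio k b
  rw [tsum_ite_eq] at h
  refine h.congr fun k => ?_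
  rw [eZ, ← tsum_mul_left]
  congr 1; ext b; ring

noncomputable def cc (t : ℝ) (k : ℤ) : ℝ := (-t) ^ k * eZ k (t ^ 2)

variable {t : ℝ}

lemma cc_even (ht : 0 < t) (k : ℤ) : cc t (-k) = cc t k := by
  have key : ∀ k : ℕ, cc t (-k) = cc t k := by
    intro k
    unfold cc
    have : (-t) ≠ 0 := by linarith
    rw [eZ_neg, zpow_neg, zpow_natCast, ← mul_assoc, ← pow_mul, mul_comm 2 k, pow_mul]
    congr 1
    rw [show (t ^ k) ^ 2 = (-t) ^ k * (-t) ^ k by rw [← mul_pow, ← pow_mul, mul_comm k 2, pow_mul]; ring]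
    field_simp
  rcases Int.eq_nat_or_neg k with ⟨m, rfl | rfl⟩
  · exact key m
  · rw [neg_neg]; exact (key m).symm

lemma cc_rec (ht : 0 < t) (k : ℤ) : k * cc t k = t * (cc t (k + 1) - cc t (k - 1)) := by
  unfold cc
  have h : (-t) ≠ 0 := by linarith
  have h1 := eZ_rec k (t ^ 2)
  rw [zpow_add₀ h, zpow_sub₀ h, zpow_one]
  calc (k : ℝ) * ((-t) ^ k * eZ k (t ^ 2)) = (-t) ^ k * (k * eZ k (t ^ 2)) := by ring
    _ = _ := by rw [h1]; field_simp; ring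

lemma cc_bound (ht : 0 < t) : ∃ B : ℝ, 0 ≤ B ∧ ∀ k, |cc t k| ≤ B := by
  refine ⟨Real.exp t * Real.exp (t ^ 2), by positivity, fun k => ?_⟩
  have key : ∀ k : ℕ, |cc t k| ≤ Real.exp t * Real.exp (t ^ 2) := by
    intro k
    have h1 : |eZ k (t ^ 2)| ≤ (1 / k.factorial) * Real.exp (t ^ 2) := by
      rw [Real.exp_eq_exp_ℝ, NormedSpace.exp_eq_tsum_div, ← tsum_mul_left]
      have hs := (Real.summable_pow_div_factorial (t ^ 2)).mul_left (1 / (k.factorial : ℝ))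
      rw [← Real.norm_eq_abs]
      refine tsum_of_norm_bounded hs.hasSum fun b => ?_
      rw [norm_mul, norm_div, norm_pow]
      simp only [Real.norm_eq_abs, Nat.abs_cast]
      rw [abs_of_nonneg (invf_nonneg _), abs_of_nonneg (sq_nonneg t), mul_comm]
      gcongr
      rw [le_div_iff₀ (by positivity), mul_comm]
      exact fact_ratio k b
    unfold cc
    rw [zpow_natCast, abs_mul, abs_pow, abs_neg, abs_of_pos ht]
    calc t ^ k * |eZ k (t ^ 2)| ≤ t ^ k * ((1 / k.factorial) * Real.exp (t ^ 2)) := by gcongr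
      _ = (t ^ k / k.factorial) * Real.exp (t ^ 2) := by ring
      _ ≤ _ := by gcongr; exact Real.pow_div_factorial_le_exp t ht.le k
  rcases Int.eq_nat_or_neg k with ⟨m, rfl | rfl⟩
  · exact key m
  · rw [cc_even ht]; exact key m

lemma D_eq_det (ht : 0 < t) (n : ℕ) :
    D n t = (Matrix.of fun i j : Fin n => cc t ((i : ℤ) - j)).det := by
  unfold D
  rw [gessel]
  have h := det_conj (n := n) (-t)⁻¹ (by simpa using ht.ne')
    (Matrix.of fun i j : Fin n => eZ ((i : ℤ) - j) (t ^ 2))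
  rw [← h]
  congr 1
  ext i j
  simp only [Matrix.of_apply, cc]
  rw [inv_zpow, zpow_neg, inv_inv]

lemma cc_gen (ht : 0 < t) (j : ℕ) :
    Summable (fun m : ℕ => t ^ m / m.factorial * cc t ((j : ℤ) - m)) ∧
    ∑' m : ℕ, t ^ m / m.factorial * cc t ((j : ℤ) - m) = if j = 0 then 1 else 0 := by
  have hn : (-t) ≠ 0 := by linarith
  obtain ⟨F, hF⟩ : ∃ F : ℕ → ℕ → ℝ, ∀ m b, F m b = t ^ m / m.factorial *
    ((-t) ^ ((j : ℤ) - m) * ((t ^ 2) ^ b / b.factorial * invf (b + ((j : ℤ) - m)))) :=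
    ⟨_, fun _ _ => rfl⟩
  have hF0 : ∀ m b, b + j < m → F m b = 0 := by
    intro m b h
    rw [hF]
    rw [invf_neg (by omega)]; simp
  have hF1 : ∀ m b r, m + r = b + j → F m b =
      t ^ m / m.factorial * ((-t) ^ r / r.factorial) * ((-t) ^ b / b.factorial) := by
    intro m b r h
    rw [hF]
    have e1 : (j : ℤ) - m = r - b := by omega
    have e2 : (b : ℤ) + (r - b) = (r : ℤ) := by ring
    rw [e1, e2, invf_natCast, zpow_sub₀ hn, zpow_natCast, zpow_natCast]
    have e3 : (t ^ 2) ^ b = (-t) ^ b * (-t) ^ b := by rw [← mul_pow]; ring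
    rw [e3]
    field_simp
  have hbd : ∀ p : ℕ × ℕ, ‖F p.1 p.2‖ ≤ (t ^ p.1 / p.1.factorial) * (Real.exp t * (t ^ p.2 / p.2.factorial)) := by
    rintro ⟨m, b⟩
    simp only
    rcases lt_or_ge (b + j) m with h | h
    · rw [hF0 m b h, norm_zero]; positivity
    · obtain ⟨r, hr⟩ := Nat.exists_eq_add_of_le h
      rw [hF1 m b r (by omega)]
      simp only [norm_mul, norm_div, norm_pow, norm_neg, Real.norm_eq_abs, Nat.abs_cast, abs_of_pos ht]
      rw [mul_assoc]
      gcongr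
      exact Real.pow_div_factorial_le_exp t ht.le r
  have hs : Summable fun p : ℕ × ℕ => F p.1 p.2 :=
    Summable.of_norm_bounded ((Real.summable_pow_div_factorial t).mul_of_nonneg
      ((Real.summable_pow_div_factorial t).mul_left (Real.exp t)) (fun m => by positivity)
      (fun m => by positivity)) hbd
  have e1 : ∀ m : ℕ, t ^ m / m.factorial * cc t ((j : ℤ) - m) = ∑' b, F m b := by
    intro m
    simp only [hF, cc, eZ]
    rw [tsum_mul_left, tsum_mul_left]
  have e2 : ∀ b, ∑' m, F m b = if b = 0 then (if j = 0 then 1 else 0) else 0 := by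
    intro b
    rw [tsum_eq_sum (s := Finset.range (b + j + 1))]
    · have : ∑ m ∈ Finset.range (b + j + 1), F m b =
          (t + -t) ^ (b + j) / (b + j).factorial * ((-t) ^ b / b.factorial) := by
        rw [add_pow, Finset.sum_div, Finset.sum_mul]
        refine Finset.sum_congr rfl fun m hm => ?_
        rw [Finset.mem_range] at hm
        rw [hF1 m b (b + j - m) (by omega)]
        have h3 := Nat.choose_mul_factorial_mul_factorial (show m ≤ b + j by omega)
        have h4 : ((b + j).choose m : ℝ) * m.factorial * (b + j - m).factorial = (b + j).factorial := by
          exact_mod_cast h3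
        congr 1
        rw [← h4]
        have : ((b + j).choose m : ℝ) ≠ 0 := by
          have := Nat.choose_pos (show m ≤ b + j by omega)
          positivity
        field_simp
      rw [this, add_neg_cancel]
      by_cases hb : b = 0
      · subst hb
        by_cases hj : j = 0
        · subst hj; simp
        · simp [hj]
      · simp [hb]
    · intro m hm
      rw [Finset.mem_range] at hm
      exact hF0 m b (by omega)
  simp only [e1]
  refine ⟨hs.prod, ?_⟩
  rw [← Summable.tsum_comm (f := F) hs]
  simp only [e2]
  rw [tsum_ite_eq]

end BDJ

namespace BDJ

noncomputable def SS (t : ℝ) : ℕ → ℤ → ℝ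
  | 0 => cc t
  | n + 1 => fun m => SS t n (m - 1) + (-SS t n (-1) / SS t n n) * SS t n (n - m)

noncomputable def rho (t : ℝ) : ℕ → ℝ
  | 0 => 1
  | n + 1 => -SS t n (-1) / SS t n n

variable {t : ℝ}

lemma SS_succ (n : ℕ) (m : ℤ) : SS t (n + 1) m = SS t n (m - 1) + rho t (n + 1) * SS t n (n - m) := rfl

lemma SS_phi (ht : 0 < t) (n : ℕ) : ∃ φ : ℕ → ℝ, φ n = 1 ∧ φ 0 = rho t n ∧
    ∀ m : ℤ, SS t n m = ∑ j ∈ Finset.range (n + 1), φ j * cc t (j - m) := by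
  induction n with
  | zero =>
    refine ⟨fun _ => 1, rfl, rfl, fun m => ?_⟩
    simp [SS, cc_even ht]
  | succ n ih =>
    obtain ⟨φ, h1, -, h3⟩ := ih
    refine ⟨fun j => (if j = 0 then 0 else φ (j - 1)) + rho t (n + 1) * (if j ≤ n then φ (n - j) else 0),
      by simp [h1], by simp [h1], fun m => ?_⟩
    simp only [add_mul, Finset.sum_add_distrib]
    rw [SS_succ, h3, h3]
    congr 1
    · rw [Finset.sum_range_succ' _ (n + 1)]
      simp only [Nat.add_sub_cancel, if_true, zero_mul, add_zero]
      refine Finset.sum_congr rfl fun j _ => ?_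
      rw [if_neg (by omega)]
      congr 2; push_cast; ring
    · rw [Finset.sum_range_succ _ (n + 1), if_neg (by omega), Finset.mul_sum, ← Finset.sum_range_reflect]
      simp only [mul_zero, zero_mul, add_zero]
      refine Finset.sum_congr rfl fun j hj => ?_
      rw [Finset.mem_range] at hj
      rw [if_pos (by omega), mul_assoc, show n + 1 - 1 - j = n - j by omega]
      congr 2
      rw [← cc_even ht]
      congr 1
      rw [Nat.cast_sub (by omega)]; ring

lemma D_succ (ht : 0 < t) (n : ℕ) (h0 : ∀ m : ℤ, 0 ≤ m → m < n → SS t n m = 0) :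
    D (n + 1) t = SS t n n * D n t := by
  obtain ⟨φ, h1, -, h3⟩ := SS_phi ht n
  rw [D_eq_det ht, D_eq_det ht]
  set A : Matrix (Fin (n + 1)) (Fin (n + 1)) ℝ := Matrix.of fun i j => cc t ((i : ℤ) - j) with hA
  have e := Matrix.det_updateRow_sum A (Fin.last n) (fun k => φ k)
  have e1 : (∑ k, (fun k : Fin (n + 1) => φ k) k • A k) = fun j : Fin (n + 1) => SS t n j := by
    ext j
    rw [Finset.sum_apply, h3, Finset.sum_range]
    rfl
  rw [e1] at e
  simp only [Fin.val_last, h1, one_smul] at e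
  rw [← e, Matrix.det_succ_row _ (Fin.last n), Finset.sum_eq_single (Fin.last n)]
  · rw [Matrix.updateRow_self]
    have : ((A.updateRow (Fin.last n) fun j : Fin (n + 1) => SS t n j).submatrix
        (Fin.last n).succAbove (Fin.last n).succAbove) =
        Matrix.of fun i j : Fin n => cc t ((i : ℤ) - j) := by
      ext i j
      simp [Matrix.updateRow_ne, hA, Fin.castSucc_ne_last]
    rw [this, ← two_mul, pow_mul]
    simp
  · intro j _ hj
    have : (j : ℕ) < n := lt_of_le_of_ne (Nat.le_of_lt_succ j.2) fun h => hj (Fin.ext h)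
    rw [Matrix.updateRow_self, h0 _ (by omega) (by omega)]; simp
  · simp

lemma SS_zero (ht : 0 < t) (n : ℕ) : ∀ m : ℤ, 0 ≤ m → m < n → SS t n m = 0 := by
  induction n with
  | zero => intro m h1 h2; simp at h2; omega
  | succ n ih =>
    intro m h1 h2
    have hne : SS t n n ≠ 0 := by
      intro h
      have := D_succ ht n ih
      rw [h, zero_mul] at this
      exact (D_pos (n + 1) t).ne' this
    rw [SS_succ]
    rcases h1.eq_or_lt with rfl | h1
    · simp only [rho, sub_zero, zero_sub]
      field_simp
      ring
    · rw [ih _ (by omega) (by push_cast at h2; omega), ih _ (by push_cast at h2; omega) (by omega)]; simp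

lemma hh_pos (ht : 0 < t) (n : ℕ) : 0 < SS t n n := by
  have h := D_succ ht n (SS_zero ht n)
  have h1 := D_pos (n + 1) t
  have h2 := D_pos n t
  rw [h] at h1
  exact (pos_iff_pos_of_mul_pos h1).2 h2

lemma SS_neg_one (ht : 0 < t) (n : ℕ) : SS t n (-1) = - rho t (n + 1) * SS t n n := by
  have := (hh_pos ht n).ne'
  simp only [rho]
  field_simp

lemma hh_succ (ht : 0 < t) (n : ℕ) : SS t (n + 1) ((n + 1 : ℕ) : ℤ) = (1 - rho t (n + 1) ^ 2) * SS t n n := by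
  rw [SS_succ]
  have h1 : ((n + 1 : ℕ) : ℤ) - 1 = n := by push_cast; ring
  have h2 : (n : ℤ) - ((n + 1 : ℕ) : ℤ) = -1 := by push_cast; ring
  rw [h1, h2, SS_neg_one ht]; ring

lemma rho_sq_lt (ht : 0 < t) (n : ℕ) : rho t (n + 1) ^ 2 < 1 := by
  have h := hh_pos ht (n + 1)
  rw [hh_succ ht] at h
  have := (pos_iff_pos_of_mul_pos h).2 (hh_pos ht n)
  linarith

lemma D_rec (ht : 0 < t) (n : ℕ) :
    D (n + 2) t * D n t = D (n + 1) t ^ 2 * (1 - rho t (n + 1) ^ 2) := by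
  rw [D_succ ht (n + 1) (SS_zero ht _), hh_succ ht, D_succ ht n (SS_zero ht _)]; ring

def Lax (t : ℝ) (n : ℕ) : Prop := ∀ m : ℤ,
    ((m : ℝ) - (n + 1)) * SS t (n + 1) m + t * (SS t (n + 1) (m - 1) - SS t (n + 1) (m + 1)) =
    -t * (1 - rho t (n + 1) ^ 2) * (SS t n m - rho t n * SS t n (n - m)) -
      (n + 1) * rho t (n + 1) * SS t n (n - m)

lemma lax_dp (ht : 0 < t) (n : ℕ) (h : Lax t n) :
    (n + 1) * rho t (n + 1) = t * (1 - rho t (n + 1) ^ 2) * (rho t (n + 2) + rho t n) := by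
  have h0 := h 0
  have hp := hh_pos ht n
  rw [SS_zero ht (n + 1) 0 le_rfl (by push_cast; omega), zero_sub, SS_neg_one ht, hh_succ ht,
    sub_zero, zero_add] at h0
  apply mul_right_cancel₀ hp.ne'
  cases n with
  | zero =>
    have h1 := hh_succ ht 0
    simp only [zero_add, Nat.cast_one] at h1
    simp only [zero_add, h1, rho, Nat.cast_zero] at h0 ⊢
    linear_combination h0
  | succ n =>
    rw [SS_zero ht (n + 1 + 1) 1 (by norm_num) (by push_cast; omega),
      SS_zero ht (n + 1) 0 le_rfl (by push_cast; omega)] at h0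
    linear_combination h0

lemma lax (ht : 0 < t) (n : ℕ) : Lax t n := by
  induction n with
  | zero =>
    intro m
    have ha := cc_rec ht (m - 1)
    have hb := cc_rec ht (-m)
    have e := cc_even ht m
    simp only [SS, rho, Nat.cast_zero, zero_sub, zero_add]
    rw [show m - 1 + 1 = m by ring] at ha
    rw [show -(m - 1) = -m + 1 by ring, show -(m + 1) = -m - 1 by ring, show m + 1 - 1 = m by ring]
    push_cast at ha hb
    rw [e] at hb ⊢
    generalize -cc t (-1) / cc t 0 = r at *
    linear_combination ha - r * hb
  | succ n ih =>
    have hd := lax_dp ht n ih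
    intro m
    have h1 := ih (m - 1)
    have h2 := ih (n + 1 - m)
    have s1 := SS_succ (t := t) n m
    have s2 := SS_succ (t := t) n (n + 1 - m)
    rw [SS_succ (n + 1) m, SS_succ (n + 1) (m - 1), SS_succ (n + 1) (m + 1)]
    push_cast at h1 h2 ⊢
    rw [show (n : ℤ) + 1 - (m - 1) = n + 1 - m + 1 by ring,
      show (n : ℤ) + 1 - (m + 1) = n + 1 - m - 1 by ring, show m + 1 - 1 = m by ring]
    rw [show m - 1 + 1 = m by ring, show (n : ℤ) - (m - 1) = n + 1 - m by ring] at h1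
    rw [show (n : ℤ) - (n + 1 - m) = m - 1 by ring] at h2 s2
    rw [show (n : ℤ) + 1 - m - 1 = n - m by ring] at s2
    rw [show (n : ℤ) + 1 - m - 1 = n - m by ring, show ((n : ℤ) + 1 - m + 1) = n + 2 - m by ring] at *
    generalize SS t (n + 1) (m - 1) = a1 at *
    generalize SS t (n + 1) (m - 1 - 1) = a2 at *
    generalize SS t (n + 1) (n - m) = a3 at *
    generalize SS t (n + 1) (n + 2 - m) = a4 at *
    rw [s1, s2] at *
    generalize SS t n (m - 1) = b1 at *
    generalize SS t n (n + 1 - m) = b2 at *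
    generalize SS t n (n - m) = b3 at *
    linear_combination h1 - rho t (n + 2) * h2 - (b2 - rho t (n + 2) * b1) * hd

end BDJ

namespace BDJ
variable {t : ℝ}

lemma rho_eq (ht : 0 < t) (n : ℕ) :
    Summable (fun k : ℕ => t ^ (k + n) / (k + n).factorial * SS t n ((k + n : ℕ) : ℤ)) ∧
    rho t n = ∑' k : ℕ, t ^ (k + n) / (k + n).factorial * SS t n ((k + n : ℕ) : ℤ) := by
  obtain ⟨φ, h1, h2, h3⟩ := SS_phi ht n
  have hs : ∀ j ∈ Finset.range (n + 1), HasSum (fun m : ℕ => t ^ m / m.factorial * (φ j * cc t ((j : ℤ) - m)))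
      (φ j * if j = 0 then 1 else 0) := by
    intro j _
    have := ((cc_gen ht j).1.hasSum).mul_left (φ j)
    rw [(cc_gen ht j).2] at this
    refine this.congr_fun ?_ 
    intro m; ring
  have h4 := hasSum_sum hs
  have e : (fun m : ℕ => ∑ j ∈ Finset.range (n + 1), t ^ m / m.factorial * (φ j * cc t ((j : ℤ) - m)))
      = fun m : ℕ => t ^ m / m.factorial * SS t n m := by
    ext m; rw [h3, Finset.mul_sum]
  rw [e] at h4
  have e2 : ∑ j ∈ Finset.range (n + 1), (φ j * if j = 0 then 1 else 0) = rho t n := by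
    rw [Finset.sum_eq_single 0]
    · simp [h2]
    · intro j _ hj; simp [hj]
    · simp
  rw [e2] at h4
  refine ⟨(summable_nat_add_iff (f := fun m : ℕ => t ^ m / m.factorial * SS t n m) n).2 h4.summable, ?_⟩
  rw [← h4.tsum_eq, ← h4.summable.sum_add_tsum_nat_add n, Finset.sum_eq_zero, zero_add]
  intro m hm
  rw [Finset.mem_range] at hm
  rw [SS_zero ht n m (by omega) (by omega), mul_zero]

lemma rho_abs_le (ht : 0 < t) (n : ℕ) : |rho t (n + 1)| ≤ 1 := by
  have := rho_sq_lt ht n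
  rw [← sq_le_one_iff_abs_le_one]; exact this.le

lemma SS_bound (ht : 0 < t) : ∃ C : ℝ, 0 ≤ C ∧ ∀ n m, |SS t n m| ≤ C := by
  obtain ⟨B, hB, hc⟩ := cc_bound ht
  have h1 : ∀ n m, |SS t n m| ≤ B * ∏ i ∈ Finset.range n, (1 + |rho t (i + 1)|) := by
    intro n
    induction n with
    | zero => intro m; simpa [SS] using hc m
    | succ n ih =>
      intro m
      rw [SS_succ, Finset.prod_range_succ]
      refine (abs_add_le _ _).trans ?_
      rw [abs_mul]
      have a := ih (m - 1)
      have b := mul_le_mul_of_nonneg_left (ih (n - m)) (abs_nonneg (rho t (n + 1)))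
      linarith
  have h2 : ∀ n m, |SS t n m| ≤ B * 2 ^ n := by
    intro n m
    refine (h1 n m).trans (mul_le_mul_of_nonneg_left ?_ hB)
    have e : (2 : ℝ) ^ n = ∏ _i ∈ Finset.range n, (2 : ℝ) := by simp
    rw [e]
    refine Finset.prod_le_prod (fun i _ => by positivity) fun i _ => ?_
    have := rho_abs_le ht i
    linarith
  have h3 : ∀ n, |rho t n| ≤ (2 * t) ^ n / n.factorial * (Real.exp t * B) := by
    intro n
    rw [(rho_eq ht n).2, ← Real.norm_eq_abs]
    have hs := (Real.summable_pow_div_factorial t).mul_left (t ^ n / n.factorial * (B * 2 ^ n))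
    refine (tsum_of_norm_bounded hs.hasSum fun k => ?_).trans (le_of_eq ?_)
    · simp only [norm_mul, norm_div, norm_pow, Real.norm_eq_abs, Nat.abs_cast, abs_of_pos ht]
      have a := h2 n ((k + n : ℕ) : ℤ)
      have b : (k.factorial : ℝ) * n.factorial ≤ (k + n).factorial := by
        exact_mod_cast Nat.le_of_dvd (Nat.factorial_pos _) (Nat.factorial_mul_factorial_dvd_factorial_add k n)
      calc t ^ (k + n) / (k + n).factorial * |SS t n ((k + n : ℕ) : ℤ)|
          ≤ t ^ (k + n) / (k.factorial * n.factorial) * (B * 2 ^ n) := by gcongr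
        _ = _ := by rw [pow_add]; field_simp
    · rw [tsum_mul_left, Real.exp_eq_exp_ℝ, NormedSpace.exp_eq_tsum_div, mul_pow]; ring
  have h4 : Summable fun n => |rho t (n + 1)| := by
    have h5 : Summable fun n => |rho t n| := Summable.of_nonneg_of_le (fun n => abs_nonneg _) h3
      ((Real.summable_pow_div_factorial _).mul_right _)
    exact (summable_nat_add_iff 1).2 h5
  refine ⟨B * Real.exp (∑' n, |rho t (n + 1)|), by positivity, fun n m => (h1 n m).trans ?_⟩
  gcongr
  calc ∏ i ∈ Finset.range n, (1 + |rho t (i + 1)|) ≤ ∏ i ∈ Finset.range n, Real.exp |rho t (i + 1)| :=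
        Finset.prod_le_prod (fun i _ => by positivity) fun i _ => by
          have := Real.add_one_le_exp |rho t (i + 1)|; linarith
    _ = Real.exp (∑ i ∈ Finset.range n, |rho t (i + 1)|) := (Real.exp_sum _ _).symm
    _ ≤ _ := Real.exp_le_exp.2 (h4.sum_le_tsum _ fun i _ => abs_nonneg _)

lemma rho_asymp (ht : 0 < t) : Tendsto (fun n : ℕ => rho t n * n.factorial / t ^ n) atTop (𝓝 1) := by
  obtain ⟨C, hC, hS⟩ := SS_bound ht
  have hh : Tendsto (fun n : ℕ => SS t n n) atTop (𝓝 1) := by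
    have h1 := (D_tendsto t).comp (tendsto_add_atTop_nat 1)
    have h2 := h1.div (D_tendsto t) (Real.exp_pos _).ne'
    rw [div_self (Real.exp_pos _).ne'] at h2
    refine h2.congr fun n => ?_
    simp only [Pi.div_apply, Function.comp_apply]
    rw [D_succ ht n (SS_zero ht n)]
    have := (D_pos n t).ne'
    field_simp
  have h : Tendsto (fun n : ℕ => ∑' k : ℕ, t ^ k * (n.factorial * (1 / (k + n).factorial)) * SS t n ((k + n : ℕ) : ℤ))
      atTop (𝓝 (∑' k : ℕ, if k = 0 then (1 : ℝ) else 0)) := by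
    refine tendsto_tsum_of_dominated_convergence (bound := fun k : ℕ => t ^ k / k.factorial * C)
      ((Real.summable_pow_div_factorial _).mul_right _) (fun k => ?_) (Eventually.of_forall fun n k => ?_)
    · rcases Nat.eq_zero_or_pos k with rfl | hk
      · simp only [if_true]
        refine hh.congr fun n => ?_
        have : (n.factorial : ℝ) ≠ 0 := by positivity
        simp [this]
      · rw [if_neg (by omega)]
        apply squeeze_zero_norm (a := fun n : ℕ => t ^ k * C * (1 / ((n : ℝ) + 1))) _
          (by simpa using (tendsto_one_div_add_atTop_nhds_zero_nat (𝕜 := ℝ)).const_mul (t ^ k * C))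
        intro n
        simp only [norm_mul, norm_div, norm_pow, norm_one, Real.norm_eq_abs, Nat.abs_cast, abs_of_pos ht]
        have h1 : ((n + 1).factorial : ℝ) ≤ (k + n).factorial := by
          exact_mod_cast Nat.factorial_le (by omega)
        have h2 : (n.factorial : ℝ) * (1 / (k + n).factorial) ≤ 1 / ((n : ℝ) + 1) := by
          rw [mul_one_div, div_le_div_iff₀ (by positivity) (by positivity)]
          rw [Nat.factorial_succ] at h1
          push_cast at h1
          nlinarith
        calc _ ≤ t ^ k * (1 / ((n : ℝ) + 1)) * C := by gcongr; exact hS _ _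
          _ = _ := by ring
    · simp only [norm_mul, norm_div, norm_pow, norm_one, Real.norm_eq_abs, Nat.abs_cast, abs_of_pos ht]
      have b : (k.factorial : ℝ) * n.factorial ≤ (k + n).factorial := by
        exact_mod_cast Nat.le_of_dvd (Nat.factorial_pos _) (Nat.factorial_mul_factorial_dvd_factorial_add k n)
      have h2 : (n.factorial : ℝ) * (1 / (k + n).factorial) ≤ 1 / (k.factorial : ℝ) := by
        rw [mul_one_div, div_le_div_iff₀ (by positivity) (by positivity)]
        linarith
      calc _ ≤ t ^ k * (1 / (k.factorial : ℝ)) * C := by gcongr; exact hS _ _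
        _ = _ := by ring
  rw [tsum_ite_eq] at h
  refine h.congr fun n => ?_
  rw [(rho_eq ht n).2, mul_div_assoc, ← tsum_mul_right]
  congr 1; ext k
  rw [pow_add]
  field_simp

end BDJ

namespace BDJ

lemma compare (c r R : ℕ → ℝ) (a : ℕ) (hr0 : ∀ n, 0 ≤ r n) (hr1 : ∀ n, r n ≤ 1)
    (hR : ∀ n, a ≤ n → 0 < R n)
    (hr : ∀ n, a < n → c n * r n ≤ (1 - r n ^ 2) * (r (n + 1) + r (n - 1)))
    (hRc : ∀ n, a < n → R n < 1 → (1 - R n ^ 2) * (R (n + 1) + R (n - 1)) ≤ c n * R n)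
    (ha : r a ≤ R a) (hev : ∀ᶠ n in atTop, r n ≤ R n) : ∀ n, a ≤ n → r n ≤ R n := by
  by_contra! hcon
  obtain ⟨m, ham, hm⟩ := hcon
  obtain ⟨N, hN⟩ := eventually_atTop.1 hev
  classical
  let s := (Finset.Icc a N).filter fun n => R n < r n
  have hs : s.Nonempty := ⟨m, by
    simp only [s, Finset.mem_filter, Finset.mem_Icc]
    refine ⟨⟨ham, ?_⟩, hm⟩
    by_contra h
    exact absurd (hN m (by omega)) (not_le.2 hm)⟩
  obtain ⟨n, hn, hmax⟩ := Finset.exists_max_image s (fun n => r n / R n) hs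
  simp only [s, Finset.mem_filter, Finset.mem_Icc] at hn hmax
  obtain ⟨⟨han, hnN⟩, hlt⟩ := hn
  have han' : a < n := lt_of_le_of_ne han fun h => by subst h; linarith
  have hRn := hR n han
  set θ := r n / R n with hθ
  have hθ1 : 1 < θ := by rw [hθ, one_lt_div hRn]; exact hlt
  have key : ∀ k, a ≤ k → r k ≤ θ * R k := by
    intro k hk
    have hRk := hR k hk
    by_cases hc : R k < r k
    · have hkN : k ≤ N := by
        by_contra h
        exact absurd (hN k (by omega)) (not_le.2 hc)
      have := hmax k ⟨⟨hk, hkN⟩, hc⟩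
      rwa [div_le_iff₀ hRk] at this
    · push Not at hc
      nlinarith
  have k1 := key (n + 1) (by omega)
  have k2 := key (n - 1) (by omega)
  have p1 := hR (n + 1) (by omega)
  have p2 := hR (n - 1) (by omega)
  have h1 := hr n han'
  have h2 := hRc n han' (by linarith [hr1 n])
  have h3 : r n = θ * R n := by rw [hθ]; field_simp
  have h4 : 0 ≤ 1 - r n ^ 2 := by nlinarith [hr1 n, hr0 n]
  have h5 : (1 - r n ^ 2) * (r (n + 1) + r (n - 1)) ≤ (1 - r n ^ 2) * (θ * (R (n + 1) + R (n - 1))) :=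
    mul_le_mul_of_nonneg_left (by linarith) h4
  have h6 : (1 - r n ^ 2) * (θ * (R (n + 1) + R (n - 1))) < (1 - R n ^ 2) * (θ * (R (n + 1) + R (n - 1))) := by
    refine mul_lt_mul_of_pos_right ?_ (by positivity)
    nlinarith
  have h7 : θ * ((1 - R n ^ 2) * (R (n + 1) + R (n - 1))) ≤ θ * (c n * R n) :=
    mul_le_mul_of_nonneg_left h2 (by linarith)
  have h8 : c n * r n = θ * (c n * R n) := by rw [h3]; ring
  linarith

variable {t η : ℝ}

lemma rho_abs_le_one (ht : 0 < t) (n : ℕ) : |rho t n| ≤ 1 := by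
  cases n with
  | zero => simp [rho]
  | succ n => exact rho_abs_le ht n

lemma rho_tendsto (ht : 0 < t) : Tendsto (fun n => rho t n) atTop (𝓝 0) := by
  have h := (rho_asymp ht).mul (FloorSemiring.tendsto_pow_div_factorial_atTop t)
  rw [mul_zero] at h
  refine h.congr fun n => ?_
  field_simp

lemma t_pos (hη : 0 < η) (hte : t * η ^ 3 = 1) : 0 < t := by
  by_contra h
  push Not at h
  have : t * η ^ 3 ≤ 0 := mul_nonpos_of_nonpos_of_nonneg h (by positivity)
  linarith

lemma dpII (hη : 0 < η) (hte : t * η ^ 3 = 1) (n : ℕ) (hn : 1 ≤ n) :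
    (2 + (n - 2 * t) * η * η ^ 2) * rho t n = (1 - rho t n ^ 2) * (rho t (n + 1) + rho t (n - 1)) := by
  have ht := t_pos hη hte
  obtain ⟨m, rfl⟩ : ∃ m, n = m + 1 := ⟨n - 1, by omega⟩
  have h := lax_dp ht m (lax ht m)
  rw [Nat.add_sub_cancel]
  apply mul_left_cancel₀ ht.ne'
  push_cast
  linear_combination h + (m + 1 - 2 * t) * rho t (m + 1) * hte

lemma abs_sub (hη : 0 < η) (hte : t * η ^ 3 = 1) (n : ℕ) (hn : 1 ≤ n) :
    (2 + (n - 2 * t) * η * η ^ 2) * |rho t n| ≤ (1 - |rho t n| ^ 2) * (|rho t (n + 1)| + |rho t (n - 1)|) := by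
  have h := dpII hη hte n hn
  have ht := t_pos hη hte
  have e : 2 + (n - 2 * t) * η * η ^ 2 = n * η ^ 3 := by linear_combination -2 * hte
  have h1 : |rho t n| ^ 2 ≤ 1 := by
    have := rho_abs_le_one ht n
    have := abs_nonneg (rho t n)
    nlinarith
  rw [e] at h ⊢
  have h2 := congrArg abs h
  rw [abs_mul, abs_mul (1 - _), abs_of_nonneg (show 0 ≤ (n : ℝ) * η ^ 3 by positivity), ← sq_abs (rho t n),
    abs_of_nonneg (sub_nonneg.2 h1)] at h2
  rw [h2]
  exact mul_le_mul_of_nonneg_left (abs_add_le _ _) (sub_nonneg.2 h1)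

lemma aux_sq (K : ℝ) (hK : 0 ≤ K) : K + 1 ≤ (K + 2) ^ 2 := by nlinarith

lemma rho_bound1 (hη : 0 < η) (hη1 : η ≤ 1 / 2) (hte : t * η ^ 3 = 1) {K : ℝ} (hK : 0 ≤ K)
    (hK2 : (K + 1) * η ^ 2 ≤ 2) (n : ℕ) (hn : -K ≤ (n - 2 * t) * η) : |rho t n| ≤ (K + 6) * η := by
  have ht := t_pos hη hte
  set a := ⌈2 * t - (K + 1) / η⌉₊ with ha
  have h0 : 0 ≤ 2 * t - (K + 1) / η := by
    rw [sub_nonneg, div_le_iff₀ hη]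
    have h1 := mul_le_mul_of_nonneg_left hK2 (mul_pos ht hη).le
    have h2 : t * η * ((K + 1) * η ^ 2) = K + 1 := by linear_combination (K + 1) * hte
    linarith
  have ha1 : 2 * t - (K + 1) / η ≤ a := Nat.le_ceil _
  have ha2 : (a : ℝ) < 2 * t - (K + 1) / η + 1 := Nat.ceil_lt_add_one h0
  have e1 : (K + 1) / η * η = K + 1 := by field_simp
  have e2 : 1 / η * η = 1 := by field_simp
  have hna : 1 / (2 * η) ≤ n - a := by
    rw [div_le_iff₀ (by positivity)]
    have h1 := mul_lt_mul_of_pos_right ha2 hη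
    have h2 : (2 * t - (K + 1) / η + 1) * η = 2 * t * η - (K + 1) + η := by
      rw [add_mul, sub_mul, e1]; ring
    linarith
  have hna' : 1 ≤ (n : ℝ) - a := by
    refine le_trans ?_ hna
    rw [le_div_iff₀ (by positivity)]; linarith
  have hna2 : a + 1 ≤ n := by
    have : (a : ℝ) + 1 ≤ n := by linarith
    exact_mod_cast this
  have main := compare (fun n => 2 + (n - 2 * t) * η * η ^ 2) (fun n => |rho t n|)
    (fun n => 2 / ((n : ℝ) - a) + (K + 2) * η) (a + 1) (fun n => abs_nonneg _)
    (fun n => rho_abs_le_one ht n) ?_ (fun n hn => abs_sub hη hte n (by omega)) ?_ ?_ ?_ n hna2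
  · refine main.trans ?_
    have : 2 / ((n : ℝ) - a) ≤ 4 * η := by
      rw [div_le_iff₀ (by linarith)]
      have := mul_le_mul_of_nonneg_left hna (show 0 ≤ 4 * η by positivity)
      have e : 4 * η * (1 / (2 * η)) = 2 := by field_simp; norm_num
      linarith
    linarith
  · intro m hm
    have : (a : ℝ) + 1 ≤ m := by exact_mod_cast hm
    have : 0 < (m : ℝ) - a := by linarith
    positivity
  · intro m hm _
    obtain ⟨k, rfl⟩ : ∃ k, m = a + (k + 2) := ⟨m - a - 2, by omega⟩
    have e3 : a + (k + 2) - 1 = a + (k + 1) := by omega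
    rw [e3]
    push_cast
    have f1 : (a : ℝ) + (k + 2) - a = k + 2 := by ring
    have f2 : (a : ℝ) + (k + 2) + 1 - a = k + 3 := by ring
    have f3 : (a : ℝ) + (k + 1) - a = k + 1 := by ring
    rw [f1, f2, f3]
    have hc : 2 - (K + 1) * η ^ 2 ≤ 2 + ((a : ℝ) + (k + 2) - 2 * t) * η * η ^ 2 := by
      have : -(K + 1) ≤ ((a : ℝ) + (k + 2) - 2 * t) * η := by
        have h1 : 0 ≤ ((k : ℝ) + 2) * η := by positivity
        have h2 := mul_le_mul_of_nonneg_right ha1 hη.le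
        rw [sub_mul, e1] at h2
        linarith
      have := mul_le_mul_of_nonneg_right this (sq_nonneg η)
      linarith
    set R := 2 / ((k : ℝ) + 2) + (K + 2) * η with hR
    have hk0 : (0 : ℝ) ≤ k := by positivity
    have hRp : 0 < R := by positivity
    have hsum : 2 / ((k : ℝ) + 3) + (K + 2) * η + (2 / ((k : ℝ) + 1) + (K + 2) * η) =
        2 * R + 4 / (((k : ℝ) + 1) * (k + 2) * (k + 3)) := by
      rw [hR]; field_simp; ring
    rw [hsum]
    have hq : 4 / (((k : ℝ) + 1) * (k + 2) * (k + 3)) ≤ 8 / ((k : ℝ) + 2) ^ 2 * R := by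
      have : 8 / ((k : ℝ) + 2) ^ 2 * (2 / ((k : ℝ) + 2)) ≤ 8 / ((k : ℝ) + 2) ^ 2 * R := by
        gcongr; rw [hR]; linarith [show 0 ≤ (K + 2) * η by positivity]
      refine le_trans ?_ this
      rw [div_mul_div_comm, div_le_div_iff₀ (by positivity) (by positivity)]
      have : 0 ≤ ((k : ℝ) + 2) * (12 * k ^ 2 + 48 * k + 32) := by positivity
      linarith
    have hR2 : 4 / ((k : ℝ) + 2) ^ 2 + (K + 1) * η ^ 2 ≤ R ^ 2 := by
      have : R ^ 2 = 4 / ((k : ℝ) + 2) ^ 2 + 4 / ((k : ℝ) + 2) * ((K + 2) * η) + (K + 2) ^ 2 * η ^ 2 := by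
        rw [hR]; field_simp; ring
      rw [this]
      have h1 : 0 ≤ 4 / ((k : ℝ) + 2) * ((K + 2) * η) := by positivity
      have h2 : (K + 1) * η ^ 2 ≤ (K + 2) ^ 2 * η ^ 2 :=
        mul_le_mul_of_nonneg_right (aux_sq K hK) (sq_nonneg η)
      linarith
    have hQ0 : 0 ≤ 4 / (((k : ℝ) + 1) * (k + 2) * (k + 3)) := by positivity
    have h8 : 8 / ((k : ℝ) + 2) ^ 2 = 2 * (4 / ((k : ℝ) + 2) ^ 2) := by ring
    rw [h8] at hq
    have t1 := mul_le_mul_of_nonneg_right hR2 hRp.le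
    have t2 := mul_le_mul_of_nonneg_right hc hRp.le
    have t3 : 0 ≤ R ^ 2 * (4 / (((k : ℝ) + 1) * (k + 2) * (k + 3))) := by positivity
    have t4 : 0 ≤ (K + 1) * η ^ 2 * R := by positivity
    clear_value R
    generalize 4 / (((k : ℝ) + 1) * (k + 2) * (k + 3)) = Q at *
    generalize 4 / ((k : ℝ) + 2) ^ 2 = P at *
    generalize (K + 1) * η ^ 2 = δ at *
    generalize 2 + ((a : ℝ) + (k + 2) - 2 * t) * η * η ^ 2 = c at *
    have : (1 - R ^ 2) * (2 * R + Q) = 2 * R + Q - 2 * (R ^ 2 * R) - R ^ 2 * Q := by ring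
    linarith
  · have := rho_abs_le_one ht (a + 1)
    have h1 : 0 ≤ (K + 2) * η := by positivity
    push_cast
    have e : (a : ℝ) + 1 - a = 1 := by ring
    rw [e]; linarith
  · have hb : 0 < (K + 2) * η := by positivity
    have := (rho_tendsto ht).abs
    rw [abs_zero] at this
    filter_upwards [this.eventually (gt_mem_nhds hb), eventually_ge_atTop a] with m hm hma
    have : (0 : ℝ) ≤ 2 / ((m : ℝ) - a) := by
      have : (a : ℝ) ≤ m := by exact_mod_cast hma
      exact div_nonneg (by norm_num) (by linarith)
    linarith

end BDJ

namespace BDJ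
variable {t η : ℝ}

lemma cosh_bound (hη : 0 < η) (hη1 : η ≤ 1 / 2) : Real.exp η + Real.exp (-η) ≤ 2 + 2 * η ^ 2 := by
  have h := Real.cosh_le_exp_half_sq η
  rw [Real.cosh_eq] at h
  have h2 : Real.exp (η ^ 2 / 2) ≤ 1 + η ^ 2 := by
    have := Real.abs_exp_sub_one_le (x := η ^ 2 / 2) (by rw [abs_of_nonneg (by positivity)]; nlinarith)
    have := le_abs_self (Real.exp (η ^ 2 / 2) - 1)
    rw [abs_of_nonneg (show 0 ≤ η ^ 2 / 2 by positivity)] at *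
    linarith
  linarith

lemma rho_bound2 (hη : 0 < η) (hη1 : η ≤ 1 / 2) (hte : t * η ^ 3 = 1) (n : ℕ)
    (hn : 0 ≤ (n - 2 * t) * η) : |rho t n| ≤ 6 * Real.exp 3 * η * Real.exp (-((n - 2 * t) * η)) := by
  have ht := t_pos hη hte
  have hb : ∀ n : ℕ, 0 ≤ (n - 2 * t) * η → |rho t n| ≤ 6 * η := by
    intro n hn
    have := rho_bound1 hη hη1 hte (K := 0) le_rfl (by nlinarith) n (by simpa using hn)
    linarith
  set a := ⌈2 * t + 2 / η⌉₊ with ha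
  have ha1 : 2 * t + 2 / η ≤ a := Nat.le_ceil _
  have ha2 : (a : ℝ) < 2 * t + 2 / η + 1 := Nat.ceil_lt_add_one (by positivity)
  have e1 : 2 / η * η = 2 := by field_simp
  have ha3 : 2 ≤ (a - 2 * t) * η := by
    have := mul_le_mul_of_nonneg_right ha1 hη.le
    rw [add_mul, e1] at this
    linarith
  have ha4 : (a - 2 * t) * η ≤ 3 := by
    have := mul_lt_mul_of_pos_right ha2 hη
    rw [add_mul, add_mul, e1] at this
    linarith
  rcases le_or_gt a n with h | h
  · have main : ∀ ε : ℝ, 0 < ε → |rho t n| ≤ 6 * η * Real.exp (-((n - a : ℝ) * η)) + ε := by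
      intro ε hε
      refine compare (fun n => 2 + (n - 2 * t) * η * η ^ 2) (fun n => |rho t n|)
        (fun n => 6 * η * Real.exp (-((n - a : ℝ) * η)) + ε) a (fun n => abs_nonneg _)
        (fun n => rho_abs_le_one ht n) (fun m hm => by positivity)
        (fun n hn => abs_sub hη hte n (by omega)) ?_ ?_ ?_ n h
      · intro m hm _
        obtain ⟨k, rfl⟩ : ∃ k, m = k + 1 := ⟨m - 1, by omega⟩
        rw [Nat.add_sub_cancel]
        have hmk : (a : ℝ) ≤ k + 1 := by exact_mod_cast hm.le
        have hc : 2 + 2 * η ^ 2 ≤ 2 + (((k + 1 : ℕ) : ℝ) - 2 * t) * η * η ^ 2 := by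
          have : 2 ≤ (((k + 1 : ℕ) : ℝ) - 2 * t) * η := by
            push_cast
            refine ha3.trans (mul_le_mul_of_nonneg_right (by linarith) hη.le)
          have := mul_le_mul_of_nonneg_right this (sq_nonneg η)
          linarith
        have q1 : Real.exp (-((((k + 1 + 1 : ℕ) : ℝ) - a) * η)) =
            Real.exp (-((((k + 1 : ℕ) : ℝ) - a) * η)) * Real.exp (-η) := by
          rw [← Real.exp_add]; congr 1; push_cast; ring
        have q2 : Real.exp (-(((k : ℝ) - a) * η)) =
            Real.exp (-((((k + 1 : ℕ) : ℝ) - a) * η)) * Real.exp η := by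
          rw [← Real.exp_add]; congr 1; push_cast; ring
        rw [q1, q2]
        have hE := Real.exp_pos (-((((k + 1 : ℕ) : ℝ) - a) * η))
        have hcosh := cosh_bound hη hη1
        have h1 := Real.exp_pos η
        have h2 := Real.exp_pos (-η)
        generalize Real.exp (-((((k + 1 : ℕ) : ℝ) - a) * η)) = E at *
        generalize Real.exp η = p at *
        generalize Real.exp (-η) = p' at *
        have hR : 0 < 6 * η * E + ε := by positivity
        have s1 : 6 * η * (E * p') + ε + (6 * η * (E * p) + ε) ≤ (2 + 2 * η ^ 2) * (6 * η * E + ε) := by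
          have := mul_le_mul_of_nonneg_left hcosh (show 0 ≤ 6 * η * E by positivity)
          have : 0 ≤ 2 * η ^ 2 * ε := by positivity
          linarith
        have s2 : (1 - (6 * η * E + ε) ^ 2) * (6 * η * (E * p') + ε + (6 * η * (E * p) + ε)) ≤
            1 * (6 * η * (E * p') + ε + (6 * η * (E * p) + ε)) :=
          mul_le_mul_of_nonneg_right (by linarith [sq_nonneg (6 * η * E + ε)]) (by positivity)
        have s3 := mul_le_mul_of_nonneg_right hc hR.le
        linarith
      · have := hb a (by linarith)
        simp only [sub_self, zero_mul, neg_zero, Real.exp_zero, mul_one]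
        linarith
      · have := (rho_tendsto ht).abs
        rw [abs_zero] at this
        filter_upwards [this.eventually (gt_mem_nhds hε)] with m hm
        have : 0 ≤ 6 * η * Real.exp (-((m - a : ℝ) * η)) := by positivity
        linarith
    have := le_of_forall_pos_le_add main
    refine this.trans ?_
    have e : Real.exp (-((n - a : ℝ) * η)) = Real.exp ((a - 2 * t) * η) * Real.exp (-((n - 2 * t) * η)) := by
      rw [← Real.exp_add]; congr 1; ring
    rw [e]
    have := Real.exp_le_exp.2 ha4
    calc 6 * η * (Real.exp ((a - 2 * t) * η) * Real.exp (-((n - 2 * t) * η)))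
        ≤ 6 * η * (Real.exp 3 * Real.exp (-((n - 2 * t) * η))) := by gcongr
      _ = _ := by ring
  · refine (hb n hn).trans ?_
    have h1 : (n - 2 * t) * η ≤ 3 := by
      refine le_trans (mul_le_mul_of_nonneg_right ?_ hη.le) ha4
      have : (n : ℝ) ≤ a := by exact_mod_cast h.le
      linarith
    have h2 : 1 ≤ Real.exp 3 * Real.exp (-((n - 2 * t) * η)) := by
      rw [← Real.exp_add]; apply Real.one_le_exp; linarith
    calc 6 * η = 6 * η * 1 := by ring
      _ ≤ 6 * η * (Real.exp 3 * Real.exp (-((n - 2 * t) * η))) := by gcongr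
      _ = _ := by ring

lemma rho_bound (hη : 0 < η) (hη1 : η ≤ 1 / 2) (hte : t * η ^ 3 = 1) {K : ℝ} (hK : 0 ≤ K)
    (hK2 : (K + 1) * η ^ 2 ≤ 2) (n : ℕ) (hn : -K ≤ (n - 2 * t) * η) :
    |rho t n| ≤ (K + 6) * Real.exp 3 * η * Real.exp (-((n - 2 * t) * η)) := by
  rcases le_total 0 ((n - 2 * t) * η) with h | h
  · refine (rho_bound2 hη hη1 hte n h).trans ?_
    gcongr; linarith
  · refine (rho_bound1 hη hη1 hte hK hK2 n hn).trans ?_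
    have h1 : 1 ≤ Real.exp (-((n - 2 * t) * η)) := Real.one_le_exp (by linarith)
    have h2 : (1 : ℝ) ≤ Real.exp 3 := Real.one_le_exp (by norm_num)
    have h3 : 0 < (K + 6) * η := by positivity
    calc (K + 6) * η = (K + 6) * 1 * η * 1 := by ring
      _ ≤ _ := by gcongr

noncomputable def JJ (t : ℝ) (n : ℕ) : ℝ := t ^ n * eZ n (-t ^ 2)

lemma JJ_rec (hη : 0 < η) (hte : t * η ^ 3 = 1) (n : ℕ) (hn : 1 ≤ n) :
    (2 + (n - 2 * t) * η * η ^ 2) * JJ t n = JJ t (n + 1) + JJ t (n - 1) := by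
  have ht := t_pos hη hte
  obtain ⟨m, rfl⟩ : ∃ m, n = m + 1 := ⟨n - 1, by omega⟩
  have h := eZ_rec ((m + 1 : ℕ) : ℤ) (-t ^ 2)
  have e1 : ((m + 1 : ℕ) : ℤ) - 1 = (m : ℤ) := by push_cast; ring
  have e2 : ((m + 1 : ℕ) : ℤ) + 1 = ((m + 1 + 1 : ℕ) : ℤ) := by push_cast; ring
  rw [e1, e2] at h
  rw [Nat.add_sub_cancel]
  unfold JJ
  apply mul_left_cancel₀ ht.ne'
  push_cast at h ⊢
  have : (2 + ((m : ℝ) + 1 - 2 * t) * η * η ^ 2) * t = m + 1 := by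
    linear_combination (m + 1 - 2 * t) * hte
  calc t * ((2 + ((m : ℝ) + 1 - 2 * t) * η * η ^ 2) * (t ^ (m + 1) * eZ (m + 1) (-t ^ 2))) =
      ((2 + ((m : ℝ) + 1 - 2 * t) * η * η ^ 2) * t) * (t ^ (m + 1) * eZ (m + 1) (-t ^ 2)) := by ring
    _ = t ^ (m + 1) * (((m : ℝ) + 1) * eZ (m + 1) (-t ^ 2)) := by rw [this]; ring
    _ = _ := by rw [h]; ring

lemma JJ_asymp (ht : 0 < t) : Tendsto (fun n : ℕ => JJ t n * n.factorial / t ^ n) atTop (𝓝 1) := by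
  refine (eZ_tendsto (-t ^ 2)).congr fun n => ?_
  unfold JJ
  field_simp

/-- sequences with factorial asymptotics -/
lemma asymp_pos_anti (ht : 0 < t) (y : ℕ → ℝ)
    (ha : Tendsto (fun n : ℕ => y n * n.factorial / t ^ n) atTop (𝓝 1))
    (hc : ∀ n : ℕ, 1 ≤ n → 2 * t ≤ n → 0 < y n → 2 * y n ≤ y (n + 1) + y (n - 1)) :
    ∀ n : ℕ, 2 * t ≤ n → 0 < y n ∧ y (n + 1) ≤ y n := by
  have hpos : ∀ᶠ n : ℕ in atTop, 0 < y n ∧ y (n + 1) ≤ y n := by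
    have h1 := ha.eventually (lt_mem_nhds (show (1 / 2 : ℝ) < 1 by norm_num))
    have h2 := (ha.comp (tendsto_add_atTop_nat 1)).eventually (gt_mem_nhds (show (1 : ℝ) < 2 by norm_num))
    filter_upwards [h1, h2, eventually_ge_atTop ⌈4 * t⌉₊] with n h1 h2 h3
    have h3' : 4 * t ≤ n := Nat.ceil_le.1 h3
    simp only [Function.comp_apply] at h2
    rw [lt_div_iff₀ (by positivity)] at h1
    rw [div_lt_iff₀ (by positivity), Nat.factorial_succ, pow_succ] at h2
    push_cast at h2
    have hf : (0 : ℝ) < n.factorial := by positivity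
    have hp : 0 < t ^ n := by positivity
    have hy : 0 < y n := by
      have : 0 < y n * n.factorial := by nlinarith
      exact (pos_iff_pos_of_mul_pos this).2 hf
    refine ⟨hy, ?_⟩
    by_contra hlt
    push Not at hlt
    have a1 : y n * n.factorial < y (n + 1) * n.factorial := mul_lt_mul_of_pos_right hlt hf
    have a2 : y (n + 1) * n.factorial * (4 * t) ≤ y (n + 1) * n.factorial * (n + 1) :=
      mul_le_mul_of_nonneg_left (by linarith) (by nlinarith)
    have a3 := mul_lt_mul_of_pos_right (h1.trans a1) ht
    linarith
  obtain ⟨N, hN⟩ := eventually_atTop.1 hpos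
  have key : ∀ k n : ℕ, 2 * t ≤ n → N ≤ n + k → 0 < y n ∧ y (n + 1) ≤ y n := by
    intro k
    induction k with
    | zero => intro n _ h; exact hN n h
    | succ k ih =>
      intro n hn h
      obtain ⟨h1, h2⟩ := ih (n + 1) (by push_cast; linarith) (by omega)
      have := hc (n + 1) (by omega) (by push_cast; linarith) h1
      rw [Nat.add_sub_cancel] at this
      constructor <;> linarith
  exact fun n hn => key N n hn (by omega)

end BDJ

namespace BDJ
variable {t η : ℝ}

lemma rho_pos_anti (hη : 0 < η) (hte : t * η ^ 3 = 1) :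
    ∀ n : ℕ, 2 * t ≤ n → 0 < rho t n ∧ rho t (n + 1) ≤ rho t n := by
  have ht := t_pos hη hte
  refine asymp_pos_anti ht _ (rho_asymp ht) fun n h1 h2 h3 => ?_
  have h := dpII hη hte n h1
  obtain ⟨m, rfl⟩ : ∃ m, n = m + 1 := ⟨n - 1, by omega⟩
  have hq := rho_sq_lt ht m
  have hx : 0 ≤ (((m + 1 : ℕ) : ℝ) - 2 * t) * η * η ^ 2 :=
    mul_nonneg (mul_nonneg (by linarith) hη.le) (sq_nonneg η)
  have h4 : 2 * rho t (m + 1) ≤ (1 - rho t (m + 1) ^ 2) * (rho t (m + 1 + 1) + rho t (m + 1 - 1)) := by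
    rw [← h]; exact mul_le_mul_of_nonneg_right (by linarith) h3.le
  have h5 : 0 < rho t (m + 1 + 1) + rho t (m + 1 - 1) := by
    have : 0 < (1 - rho t (m + 1) ^ 2) * (rho t (m + 1 + 1) + rho t (m + 1 - 1)) := by linarith
    exact (pos_iff_pos_of_mul_pos this).1 (by linarith)
  have : 0 ≤ rho t (m + 1) ^ 2 * (rho t (m + 1 + 1) + rho t (m + 1 - 1)) := by positivity
  linarith

lemma JJ_pos_anti (hη : 0 < η) (hte : t * η ^ 3 = 1) :
    ∀ n : ℕ, 2 * t ≤ n → 0 < JJ t n ∧ JJ t (n + 1) ≤ JJ t n := by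
  have ht := t_pos hη hte
  refine asymp_pos_anti ht _ (JJ_asymp ht) fun n h1 h2 h3 => ?_
  have h := JJ_rec hη hte n h1
  have hx : 0 ≤ ((n : ℝ) - 2 * t) * η * η ^ 2 :=
    mul_nonneg (mul_nonneg (by linarith) hη.le) (sq_nonneg η)
  rw [← h]; exact mul_le_mul_of_nonneg_right (by linarith) h3.le

lemma anti_le {t : ℝ} {y : ℕ → ℝ} (h : ∀ n : ℕ, 2 * t ≤ n → 0 < y n ∧ y (n + 1) ≤ y n) {n m : ℕ}
    (hn : 2 * t ≤ n) (hm : n ≤ m) : y m ≤ y n := by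
  induction m, hm using Nat.le_induction with
  | base => exact le_rfl
  | succ m hm ih =>
    have : (n : ℝ) ≤ m := by exact_mod_cast hm
    exact (h m (by linarith)).2.trans ih

lemma telescoping {a g : ℕ → ℝ} {K L : ℝ} {n : ℕ}
    (h : ∀ m, n ≤ m → a m - a (m + 1) ≤ K * (g m - g (m + 1)))
    (ha : Tendsto a atTop (𝓝 L)) (hg : Tendsto g atTop (𝓝 0)) : a n ≤ L + K * g n := by
  have hm : Monotone fun k => a (n + k) - K * g (n + k) := by
    refine monotone_nat_of_le_succ fun k => ?_
    have := h (n + k) (by omega)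
    rw [← add_assoc]
    linarith
  have ht : Tendsto (fun k => a (n + k) - K * g (n + k)) atTop (𝓝 (L - K * 0)) := by
    have := (ha.sub (hg.const_mul K)).comp (tendsto_add_atTop_nat n)
    refine this.congr fun k => ?_
    simp [add_comm]
  have := hm.ge_of_tendsto ht 0
  simp only [add_zero, mul_zero, sub_zero] at this
  linarith

noncomputable def Cas (t : ℝ) (n : ℕ) : ℝ := rho t (n + 1) * JJ t n - rho t n * JJ t (n + 1)

lemma Cas_succ (hη : 0 < η) (hte : t * η ^ 3 = 1) (n : ℕ) :
    Cas t (n + 1) - Cas t n = rho t (n + 1) ^ 2 * JJ t (n + 1) * (rho t (n + 2) + rho t n) := by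
  have h1 := dpII hη hte (n + 1) (by omega)
  have h2 := JJ_rec hη hte (n + 1) (by omega)
  rw [Nat.add_sub_cancel] at h1 h2
  unfold Cas
  linear_combination -(JJ t (n + 1)) * h1 + rho t (n + 1) * h2

lemma JJ_tendsto (ht : 0 < t) : Tendsto (fun n => JJ t n) atTop (𝓝 0) := by
  have h := (JJ_asymp ht).mul (FloorSemiring.tendsto_pow_div_factorial_atTop t)
  rw [mul_zero] at h
  refine h.congr fun n => ?_
  field_simp

lemma Cas_tendsto (ht : 0 < t) : Tendsto (fun n => Cas t n) atTop (𝓝 0) := by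
  have h1 := ((rho_tendsto ht).comp (tendsto_add_atTop_nat 1)).mul (JJ_tendsto ht)
  have h2 := (rho_tendsto ht).mul ((JJ_tendsto ht).comp (tendsto_add_atTop_nat 1))
  simpa [Cas] using h1.sub h2

lemma theta_tendsto (ht : 0 < t) : Tendsto (fun n => rho t n / JJ t n) atTop (𝓝 1) := by
  have h := (rho_asymp ht).div (JJ_asymp ht) one_ne_zero
  rw [div_one] at h
  refine h.congr fun n => ?_
  simp only [Pi.div_apply]
  have h1 : (n.factorial : ℝ) ≠ 0 := by positivity
  have h2 : t ^ n ≠ 0 := by positivity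
  rw [div_div_div_cancel_right₀ h2, mul_div_mul_right _ _ h1]

lemma theta_sub (hη : 0 < η) (hte : t * η ^ 3 = 1) (n : ℕ) (hn : 2 * t ≤ n) :
    rho t n / JJ t n - rho t (n + 1) / JJ t (n + 1) = - Cas t n / (JJ t n * JJ t (n + 1)) := by
  have h1 := (JJ_pos_anti hη hte n hn).1.ne'
  have h2 := (JJ_pos_anti hη hte (n + 1) (by push_cast; linarith)).1.ne'
  unfold Cas
  field_simp
  ring

lemma Cas_nonpos (hη : 0 < η) (hte : t * η ^ 3 = 1) (n : ℕ) (hn : 2 * t ≤ n) : Cas t n ≤ 0 := by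
  have := telescoping (a := Cas t) (g := fun _ => 0) (K := 0) (n := n) ?_
    (Cas_tendsto (t_pos hη hte)) tendsto_const_nhds
  · simpa using this
  · intro m hm
    have hm' : (n : ℝ) ≤ m := by exact_mod_cast hm
    have h := Cas_succ hη hte m
    have h1 := (JJ_pos_anti hη hte (m + 1) (by push_cast; linarith)).1
    have h2 := (rho_pos_anti hη hte m (by linarith)).1
    have h3 := (rho_pos_anti hη hte (m + 2) (by push_cast; linarith)).1
    have : 0 ≤ rho t (m + 1) ^ 2 * JJ t (m + 1) * (rho t (m + 2) + rho t m) := by positivity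
    linarith

lemma J_le_rho (hη : 0 < η) (hte : t * η ^ 3 = 1) (n : ℕ) (hn : 2 * t ≤ n) : JJ t n ≤ rho t n := by
  have ht := t_pos hη hte
  have hJ := (JJ_pos_anti hη hte n hn).1
  have := telescoping (a := fun n => -(rho t n / JJ t n)) (g := fun _ => 0) (K := 0) (n := n) ?_
    (theta_tendsto ht).neg tendsto_const_nhds
  · rw [zero_mul, add_zero, neg_le_neg_iff, one_le_div hJ] at this
    exact this
  · intro m hm
    have hm' : (n : ℝ) ≤ m := by exact_mod_cast hm
    have h := theta_sub hη hte m (by linarith)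
    have h1 := (JJ_pos_anti hη hte (m + 1) (by push_cast; linarith)).1
    have h2 := (JJ_pos_anti hη hte m (by linarith)).1
    have h3 := Cas_nonpos hη hte m (by linarith)
    have : 0 ≤ - Cas t m / (JJ t m * JJ t (m + 1)) := div_nonneg (by linarith) (by positivity)
    linarith

lemma exp_sq_step (hη : 0 < η) (hη1 : η ≤ 1 / 2) (x : ℝ) :
    η * Real.exp (-(2 * (x * η))) ≤ Real.exp (-(2 * (x * η))) - Real.exp (-(2 * ((x + 1) * η))) := by
  have h : Real.exp (-(2 * ((x + 1) * η))) = Real.exp (-(2 * (x * η))) * Real.exp (-(2 * η)) := by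
    rw [← Real.exp_add]; congr 1; ring
  rw [h]
  have h1 : Real.exp (-(2 * η)) ≤ 1 - η := by
    have h2 : (1 + 2 * η) ≤ Real.exp (2 * η) := by linarith [Real.add_one_le_exp (2 * η)]
    rw [Real.exp_neg]
    refine inv_le_of_inv_le₀ (by linarith) (le_trans ?_ h2)
    rw [inv_le_iff_one_le_mul₀ (by linarith)]
    nlinarith
  have := mul_le_mul_of_nonneg_left h1 (Real.exp_pos (-(2 * (x * η)))).le
  linarith

lemma rho_le_J (hη : 0 < η) (hη1 : η ≤ 1 / 2) (hte : t * η ^ 3 = 1) (n : ℕ) (hn : 2 * t ≤ n) :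
    (1 - 2 * (6 * Real.exp 3) ^ 2 * Real.exp (-(2 * ((n - 2 * t) * η)))) * rho t n ≤ JJ t n := by
  have ht := t_pos hη hte
  have hJ := JJ_pos_anti hη hte
  have hr := rho_pos_anti hη hte
  have hexp : Tendsto (fun m : ℕ => Real.exp (-(2 * ((m - 2 * t) * η)))) atTop (𝓝 0) := by
    refine Real.tendsto_exp_neg_atTop_nhds_zero.comp ?_
    refine Tendsto.const_mul_atTop (by norm_num) (Tendsto.atTop_mul_const hη ?_)
    exact tendsto_atTop_add_const_right _ _ tendsto_natCast_atTop_atTop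
  set E : ℕ → ℝ := fun m => Real.exp (-(2 * ((m - 2 * t) * η))) with hE
  have hEs : ∀ m : ℕ, η * E m ≤ E m - E (m + 1) := by
    intro m
    have := exp_sq_step hη hη1 ((m : ℝ) - 2 * t)
    simp only [hE]
    push_cast
    rwa [show (m : ℝ) + 1 - 2 * t = m - 2 * t + 1 by ring]
  set C := 6 * Real.exp 3 with hC
  have hsq : ∀ m : ℕ, 2 * t ≤ m → rho t m ^ 2 ≤ C ^ 2 * η ^ 2 * E m := by
    intro m hm
    have h := rho_bound2 hη hη1 hte m (mul_nonneg (by linarith) hη.le)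
    rw [abs_of_pos (hr m hm).1] at h
    have h2 := pow_le_pow_left₀ (hr m hm).1.le h 2
    refine h2.trans (le_of_eq ?_)
    have : E m = Real.exp (-((m - 2 * t) * η)) ^ 2 := by
      rw [← Real.exp_nat_mul]; simp only [hE]; congr 1; push_cast; ring
    rw [this]; ring
  have hcas : ∀ m : ℕ, 2 * t ≤ m → - Cas t m ≤ 2 * JJ t (m + 1) * rho t m * (C ^ 2 * η * E m) := by
    intro n hn
    have := telescoping (a := fun m => - Cas t m) (g := fun m => E m)
      (K := 2 * JJ t (n + 1) * rho t n * (C ^ 2 * η)) (n := n) (L := 0) ?_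
      (by simpa using (Cas_tendsto ht).neg) hexp
    · linarith
    · intro m hm
      have hm' : (n : ℝ) ≤ m := by exact_mod_cast hm
      have hm1 : 2 * t ≤ ((m + 1 : ℕ) : ℝ) := by push_cast; linarith
      have h := Cas_succ hη hte m
      have h1 := anti_le hr hn hm
      have h2 := anti_le hJ (show 2 * t ≤ ((n + 1 : ℕ) : ℝ) by push_cast; linarith)
        (show n + 1 ≤ m + 1 by omega)
      have h3 : rho t (m + 2) ≤ rho t n := anti_le hr hn (by omega)
      have h4 := hsq (m + 1) hm1
      have h5 : E (m + 1) ≤ E m := by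
        have := hEs m
        have : 0 ≤ η * E m := by positivity
        linarith
      have p1 := (hJ (m + 1) hm1).1
      have p3 := (hr n hn).1
      have p4 := (hr m (by linarith)).1
      have p5 := (hr (m + 2) (by push_cast; linarith)).1
      have p6 := (hJ (n + 1) (by push_cast; linarith)).1
      calc -Cas t m - -Cas t (m + 1) = rho t (m + 1) ^ 2 * JJ t (m + 1) * (rho t (m + 2) + rho t m) := by linarith
        _ ≤ (C ^ 2 * η ^ 2 * E m) * JJ t (n + 1) * (rho t n + rho t n) := by
            gcongr
            exact h4.trans (by gcongr)
        _ = 2 * JJ t (n + 1) * rho t n * (C ^ 2 * η) * (η * E m) := by ring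
        _ ≤ _ := mul_le_mul_of_nonneg_left (hEs m) (by positivity)
  have hJn := (hJ n hn).1
  have hrn := (hr n hn).1
  have := telescoping (a := fun n => rho t n / JJ t n) (g := E) (K := rho t n / JJ t n * (2 * C ^ 2))
    (n := n) ?_ (theta_tendsto ht) hexp
  · have h2 : rho t n / JJ t n * JJ t n = rho t n := by field_simp
    have h3 := mul_le_mul_of_nonneg_right this hJn.le
    have h4 : (1 + rho t n / JJ t n * (2 * C ^ 2) * E n) * JJ t n =
      JJ t n + (2 * C ^ 2 * E n) * (rho t n / JJ t n * JJ t n) := by ring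
    rw [h4, h2] at h3
    linarith
  · intro m hm
    have hm' : (n : ℝ) ≤ m := by exact_mod_cast hm
    have hmt : 2 * t ≤ (m : ℝ) := by linarith
    have hJm := (hJ m hmt).1
    have hJm1 := (hJ (m + 1) (by push_cast; linarith)).1
    have hanti : rho t m / JJ t m ≤ rho t n / JJ t n := by
      induction m, hm using Nat.le_induction with
      | base => exact le_rfl
      | succ k hk ih =>
        have hk' : (n : ℝ) ≤ k := by exact_mod_cast hk
        have hkt : 2 * t ≤ (k : ℝ) := by linarith
        refine le_trans ?_ (ih hk' hkt (hJ k hkt).1 hJm)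
        have h := theta_sub hη hte k hkt
        have h3 := Cas_nonpos hη hte k hkt
        have : 0 ≤ - Cas t k / (JJ t k * JJ t (k + 1)) :=
          div_nonneg (by linarith) (mul_nonneg (hJ k hkt).1.le hJm.le)
        linarith
    rw [theta_sub hη hte m hmt]
    calc - Cas t m / (JJ t m * JJ t (m + 1)) ≤
        2 * JJ t (m + 1) * rho t m * (C ^ 2 * η * E m) / (JJ t m * JJ t (m + 1)) := by
          gcongr; exact hcas m hmt
      _ = rho t m / JJ t m * (2 * C ^ 2) * (η * E m) := by field_simp
      _ ≤ rho t n / JJ t n * (2 * C ^ 2) * (E m - E (m + 1)) := by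
          have p : 0 ≤ rho t n / JJ t n := by positivity
          have q : 0 ≤ η * E m := by positivity
          gcongr
          exact hEs m

end BDJ

namespace BDJ

lemma ray_hasSum (t T : ℝ) (hT : 0 ≤ T) (n : ℕ) (w : ℂ) :
    HasSum (fun p : ℕ × ℕ => ((t : ℂ) ^ p.1 / p.1.factorial * ((-t : ℂ) ^ p.2 / p.2.factorial)) *
      ∫ τ in (0 : ℝ)..T, w * cexp (((p.1 - p.2 - n : ℤ) : ℂ) * w * τ))
      (∫ τ in (0 : ℝ)..T, w * cexp (2 * t * Complex.sinh (w * τ) - n * (w * τ))) := by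
  simp_rw [← intervalIntegral.integral_const_mul]
  set R : ℝ := Real.exp (‖w‖ * T) with hR
  set C : ℝ := ‖w‖ * Real.exp (n * (‖w‖ * T)) with hC
  have hexp : ∀ z : ℂ, HasSum (fun n : ℕ => z ^ n / n.factorial) (cexp z) := fun z => by
    have := NormedSpace.expSeries_div_hasSum_exp z
    rwa [← Complex.exp_eq_exp_ℂ] at this
  have hsn : ∀ z : ℂ, Summable fun n : ℕ => ‖z ^ n / (n.factorial : ℂ)‖ := fun z => by
    refine (Real.summable_pow_div_factorial ‖z‖).congr fun n => ?_
    simp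
  have hterm : ∀ (p : ℕ × ℕ) (τ : ℝ), ((t : ℂ) ^ p.1 / p.1.factorial * ((-t : ℂ) ^ p.2 / p.2.factorial)) *
      (w * cexp (((p.1 - p.2 - n : ℤ) : ℂ) * w * τ)) =
      (t * cexp (w * τ)) ^ p.1 / p.1.factorial * ((-t * cexp (-(w * τ))) ^ p.2 / p.2.factorial) *
      (w * cexp (-(n * (w * τ)))) := by
    intro p τ
    rw [mul_pow, mul_pow, ← Complex.exp_nat_mul, ← Complex.exp_nat_mul]
    have : cexp (((p.1 - p.2 - n : ℤ) : ℂ) * w * τ) =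
      cexp (p.1 * (w * τ)) * cexp (p.2 * (-(w * τ))) * cexp (-(n * (w * τ))) := by
      rw [← Complex.exp_add, ← Complex.exp_add]; congr 1; push_cast; ring
    rw [this]; ring
  have hlim : ∀ τ : ℝ, HasSum (fun p : ℕ × ℕ => ((t : ℂ) ^ p.1 / p.1.factorial *
      ((-t : ℂ) ^ p.2 / p.2.factorial)) * (w * cexp (((p.1 - p.2 - n : ℤ) : ℂ) * w * τ)))
      (w * cexp (2 * t * Complex.sinh (w * τ) - n * (w * τ))) := by
    intro τ
    refine HasSum.congr_fun ?_ fun p => hterm p τ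
    have e : 2 * (t : ℂ) * Complex.sinh (w * τ) - n * (w * τ) =
      t * cexp (w * τ) + -t * cexp (-(w * τ)) + -(n * (w * τ)) := by
      rw [Complex.sinh]; ring
    rw [e, Complex.exp_add, Complex.exp_add]
    have e2 : ∀ a b c : ℂ, w * (a * b * c) = a * b * (w * c) := fun a b c => by ring
    rw [e2]
    generalize (t : ℂ) * cexp (w * τ) = z1
    generalize -(t : ℂ) * cexp (-(w * τ)) = z2
    have hsm := summable_mul_of_summable_norm (f := fun n : ℕ => z1 ^ n / (n.factorial : ℂ))
      (g := fun n : ℕ => z2 ^ n / (n.factorial : ℂ)) (hsn z1) (hsn z2)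
    exact ((hexp z1).mul (hexp z2) hsm).mul_right _
  have hsum : Summable fun p : ℕ × ℕ => (|t| * R) ^ p.1 / p.1.factorial *
      ((|t| * R) ^ p.2 / p.2.factorial) * C := by
    refine Summable.mul_right _ ?_
    have h := Real.summable_pow_div_factorial (|t| * R)
    exact h.mul_of_nonneg h (fun n => by positivity) (fun n => by positivity)
  refine intervalIntegral.hasSum_integral_of_dominated_convergence
    (fun p _ => (|t| * R) ^ p.1 / p.1.factorial * ((|t| * R) ^ p.2 / p.2.factorial) * C)
    (fun p => ?_) (fun p => ?_) (ae_of_all _ fun τ _ => hsum) intervalIntegrable_const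
    (ae_of_all _ fun τ _ => hlim τ)
  · exact Continuous.aestronglyMeasurable (by fun_prop)
  · refine ae_of_all _ fun τ hτ => ?_
    rw [Set.uIoc_of_le hT] at hτ
    have hb : ‖w * (τ : ℂ)‖ ≤ ‖w‖ * T := by
      rw [norm_mul, Complex.norm_real, Real.norm_eq_abs, abs_of_pos hτ.1]
      exact mul_le_mul_of_nonneg_left hτ.2 (norm_nonneg _)
    have hne : ∀ z : ℂ, ‖z‖ ≤ ‖w‖ * T → ‖cexp z‖ ≤ R := fun z hz =>
      (Complex.norm_exp_le_exp_norm z).trans (Real.exp_le_exp.2 hz)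
    rw [hterm]
    simp only [norm_mul, norm_div, norm_pow, norm_neg, Complex.norm_real, Complex.norm_natCast,
      Real.norm_eq_abs]
    have h1 := hne _ hb
    have h2 := hne (-(w * τ)) (by rwa [norm_neg])
    have h3 : ‖cexp (-(n * (w * τ)))‖ ≤ Real.exp (n * (‖w‖ * T)) := by
      refine (Complex.norm_exp_le_exp_norm _).trans (Real.exp_le_exp.2 ?_)
      rw [norm_neg, norm_mul, Complex.norm_natCast]
      gcongr
    rw [hC]
    gcongr

noncomputable def om : ℂ := ⟨1 / 2, √3 / 2⟩
noncomputable def om' : ℂ := ⟨1 / 2, -(√3 / 2)⟩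
noncomputable def TT : ℝ := 2 * Real.pi / √3

lemma om_sub : om * TT = om' * TT + 2 * Real.pi * I := by
  have : √3 ≠ 0 := by positivity
  apply Complex.ext
  · simp [om, om', TT]
  · simp [om, om', TT]; field_simp; ring

lemma ray_int (w : ℂ) (hw : w ≠ 0) (k : ℤ) (T : ℝ) :
    ∫ τ in (0 : ℝ)..T, w * cexp ((k : ℂ) * w * τ) =
      if k = 0 then w * T else (cexp (k * (w * T)) - 1) / k := by
  split_ifs with h
  · subst h; simp [mul_comm]
  · have hk : (k : ℂ) ≠ 0 := by exact_mod_cast h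
    rw [intervalIntegral.integral_const_mul, integral_exp_mul_complex (mul_ne_zero hk hw)]
    simp only [ofReal_zero, mul_zero, Complex.exp_zero, mul_assoc]
    field_simp

lemma om_ne : om ≠ 0 := fun h => by simpa [om] using congrArg Complex.re h
lemma om'_ne : om' ≠ 0 := fun h => by simpa [om'] using congrArg Complex.re h

lemma J_contour (t : ℝ) (n : ℕ) :
    (∫ τ in (0 : ℝ)..TT, om * cexp (2 * t * Complex.sinh (om * τ) - n * (om * τ))) -
    (∫ τ in (0 : ℝ)..TT, om' * cexp (2 * t * Complex.sinh (om' * τ) - n * (om' * τ))) =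
    2 * Real.pi * I * (JJ t n : ℂ) := by
  have hT : 0 ≤ TT := by unfold TT; positivity
  have h := (ray_hasSum t TT hT n om).sub (ray_hasSum t TT hT n om')
  refine h.unique ?_
  simp_rw [ray_int om om_ne, ray_int om' om'_ne, ← mul_sub]
  have hkey : ∀ k : ℤ, ((if k = 0 then om * (TT : ℂ) else (cexp (k * (om * TT)) - 1) / k) -
      if k = 0 then om' * (TT : ℂ) else (cexp (k * (om' * TT)) - 1) / k) =
      if k = 0 then 2 * Real.pi * I else 0 := by
    intro k
    split_ifs with hk
    · rw [om_sub]; ring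
    · rw [om_sub, mul_add, Complex.exp_add, Complex.exp_int_mul_two_pi_mul_I, mul_one, sub_self]
  simp_rw [hkey]
  have hinj : Function.Injective fun b : ℕ => ((b + n, b) : ℕ × ℕ) := fun a b h => (Prod.ext_iff.1 h).2
  rw [← hinj.hasSum_iff]
  · have hs := (eZ_summable n (-t ^ 2)).hasSum.mul_left (t ^ n)
    have hs' : HasSum _ (JJ t n) := hs
    have hs2 := (Complex.hasSum_ofReal.2 hs').mul_left (2 * Real.pi * I)
    refine hs2.congr_fun fun b => ?_
    have e : ((b + n : ℕ) : ℤ) - (b : ℤ) - n = 0 := by push_cast; ring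
    simp only [Function.comp_apply, e, if_true]
    have e2 : invf ((b : ℤ) + n) = 1 / ((b + n).factorial : ℝ) := by
      have := invf_natCast (b + n)
      push_cast at this
      exact this
    rw [e2]
    push_cast
    rw [pow_add, neg_pow (t : ℂ), neg_pow ((t : ℂ) ^ 2)]
    ring
  · rintro ⟨a, b⟩ hab
    have : ¬ ((a : ℤ) - b - n = 0) := fun h => hab ⟨b, Prod.ext (by simp; omega) rfl⟩
    simp [this]

end BDJ

namespace BDJ

lemma sinh_le {σ : ℝ} (h0 : 0 ≤ σ) (h1 : σ ≤ 1) : Real.sinh σ ≤ σ + σ ^ 3 / 5 := by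
  have a1 := Real.exp_bound (x := σ) (by rwa [abs_of_nonneg h0]) (n := 5) (by norm_num)
  have a2 := Real.exp_bound (x := -σ) (by rwa [abs_neg, abs_of_nonneg h0]) (n := 5) (by norm_num)
  rw [abs_neg] at a2
  rw [abs_of_nonneg h0] at a1 a2
  simp only [Finset.sum_range_succ, Finset.sum_range_zero, Nat.factorial] at a1 a2
  norm_num at a1 a2
  have b1 := (abs_le.1 a1).2
  have b2 := (abs_le.1 a2).1
  have h5 : σ ^ 5 ≤ σ ^ 3 := pow_le_pow_of_le_one h0 h1 (by norm_num)
  have h3 : 0 ≤ σ ^ 3 := by positivity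
  have e : (-σ) ^ 3 = - σ ^ 3 := by ring
  rw [e] at b2
  rw [Real.sinh_eq]
  linarith

lemma ray_ineq {σ : ℝ} (h0 : 0 ≤ σ) (h1 : √3 * σ ≤ Real.pi) :
    Real.sinh σ * Real.cos (√3 * σ) - σ ≤ -(3 / 10 * σ ^ 3) := by
  have hs : √3 ^ 2 = 3 := Real.sq_sqrt (by norm_num)
  have hs0 : 0 ≤ √3 := by positivity
  have hp0 := Real.pi_pos
  have hp : Real.pi ^ 2 < 9.9 := by
    have := Real.pi_lt_d4
    nlinarith
  have hsh : 0 ≤ Real.sinh σ := Real.sinh_nonneg_iff.2 h0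
  have hσ : 3 * σ ^ 2 ≤ Real.pi ^ 2 := by
    have := pow_le_pow_left₀ (by positivity) h1 2
    rw [mul_pow, hs] at this; exact this
  have h3 : 0 ≤ σ ^ 3 := by positivity
  rcases le_or_gt σ 1 with h | h
  · have hc := Real.cos_le_one_sub_mul_cos_sq (x := √3 * σ)
      (by rw [abs_of_nonneg (by positivity)]; exact h1)
    have hc2 : Real.cos (√3 * σ) ≤ 1 - 3 / 5 * σ ^ 2 := by
      refine hc.trans ?_
      rw [mul_pow, hs]
      have : (1 : ℝ) / 5 ≤ 2 / Real.pi ^ 2 := by rw [div_le_div_iff₀ (by norm_num) (by positivity)]; linarith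
      nlinarith [sq_nonneg σ]
    have hpos : 0 ≤ 1 - 3 / 5 * σ ^ 2 := by nlinarith
    calc Real.sinh σ * Real.cos (√3 * σ) - σ ≤ (σ + σ ^ 3 / 5) * (1 - 3 / 5 * σ ^ 2) - σ := by
          have i1 := mul_le_mul_of_nonneg_left hc2 hsh
          have i2 := mul_le_mul_of_nonneg_right (sinh_le h0 h) hpos
          linarith
      _ ≤ -(3 / 10 * σ ^ 3) := by
          have : 0 ≤ σ ^ 5 := by positivity
          nlinarith
  · have hc : Real.cos (√3 * σ) ≤ 0 := by
      have h17 : (1.7 : ℝ) ≤ √3 := Real.le_sqrt_of_sq_le (by norm_num)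
      refine Real.cos_nonpos_of_pi_div_two_le_of_le ?_ ?_
      · have := Real.pi_lt_d2
        nlinarith
      · linarith
    have := mul_nonpos_of_nonneg_of_nonpos hsh hc
    have : 3 / 10 * σ ^ 3 ≤ σ := by
      have : σ * (3 * σ ^ 2) ≤ σ * 9.9 := mul_le_mul_of_nonneg_left (by linarith) h0
      nlinarith
    linarith

lemma sinh_approx {z : ℂ} (hz : ‖z‖ ≤ 1) : ‖Complex.sinh z - z - z ^ 3 / 6‖ ≤ ‖z‖ ^ 4 := by
  have a1 := Complex.exp_bound hz (n := 4) (by norm_num)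
  have a2 := Complex.exp_bound (x := -z) (by rwa [norm_neg]) (n := 4) (by norm_num)
  rw [norm_neg] at a2
  simp only [Finset.sum_range_succ, Finset.sum_range_zero, Nat.factorial] at a1 a2
  norm_num at a1 a2
  have e : Complex.sinh z - z - z ^ 3 / 6 =
    ((cexp z - (1 + z + z ^ 2 / 2 + z ^ 3 / 6)) - (cexp (-z) - (1 + -z + z ^ 2 / 2 + (-z) ^ 3 / 6))) / 2 := by
    rw [Complex.sinh]; ring
  rw [e, norm_div, Complex.norm_ofNat]
  have := norm_sub_le (cexp z - (1 + z + z ^ 2 / 2 + z ^ 3 / 6))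
    (cexp (-z) - (1 + -z + z ^ 2 / 2 + (-z) ^ 3 / 6))
  have : 0 ≤ ‖z‖ ^ 4 := by positivity
  linarith

lemma cubic_bound (A : ℝ) (hA : 0 ≤ A) : ∃ B : ℝ, ∀ s : ℝ, 0 ≤ s →
    A * s - 3 / 40 * s ^ 3 ≤ B - s := by
  refine ⟨(A + 1) * √((A + 1) * 40 / 3), fun s hs => ?_⟩
  rcases le_or_gt s √((A + 1) * 40 / 3) with h | h
  · have := mul_le_mul_of_nonneg_left h (show 0 ≤ A + 1 by linarith)
    have : 0 ≤ s ^ 3 := by positivity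
    linarith
  · have h2 := Real.lt_sq_of_sqrt_lt h
    have : s * ((A + 1) * 40 / 3) ≤ s * s ^ 2 := mul_le_mul_of_nonneg_left h2.le hs
    have : 0 ≤ (A + 1) * √((A + 1) * 40 / 3) := by positivity
    nlinarith

lemma sinh_re (a b : ℝ) : (Complex.sinh ⟨a, b⟩).re = Real.sinh a * Real.cos b := by
  rw [Complex.sinh, Real.sinh_eq]
  have e : -(⟨a, b⟩ : ℂ) = ⟨-a, -b⟩ := rfl
  rw [e]
  simp [Complex.exp_re]
  ring

variable {ι : Type*} {l : Filter ι}

lemma ray_limit [l.IsCountablyGenerated] {η t : ι → ℝ} {n : ι → ℕ} {x ε : ℝ} {w : ℂ} (hε : ε = 1 ∨ ε = -1)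
    (hw : w = ⟨1 / 2, ε * (√3 / 2)⟩) (hη : ∀ i, 0 < η i) (hte : ∀ i, t i * η i ^ 3 = 1)
    (hη0 : Tendsto η l (𝓝 0)) (hx : Tendsto (fun i => (n i - 2 * t i) * η i) l (𝓝 x)) :
    IntegrableOn (fun s : ℝ => w * cexp (-(x * w * s)) * cexp (-(s : ℂ) ^ 3 / 3)) (Set.Ioi 0) ∧
    Tendsto (fun i => (η i : ℂ)⁻¹ * ∫ τ in (0 : ℝ)..TT,
      w * cexp (2 * t i * Complex.sinh (w * τ) - n i * (w * τ))) l
      (𝓝 (∫ s in Set.Ioi (0 : ℝ), w * cexp (-(x * w * s)) * cexp (-(s : ℂ) ^ 3 / 3))) := by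
  have h3 : √3 ^ 2 = 3 := Real.sq_sqrt (by norm_num)
  have hε2 : ε ^ 2 = 1 := by rcases hε with rfl | rfl <;> norm_num
  have hre : w.re = 1 / 2 := by rw [hw]
  have hw2 : ‖w‖ = 1 := by
    rw [hw, Complex.norm_def, Complex.normSq_mk, Real.sqrt_eq_one]; nlinarith
  have hw3 : w ^ 3 = -1 := by
    rw [hw]
    apply Complex.ext
    · simp [pow_succ]; nlinarith
    · simp [pow_succ]
      have : ε * √3 * (√3 ^ 2) * ε ^ 2 = 3 * ε * √3 := by rw [h3, hε2]; ring
      nlinarith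
  obtain ⟨B, hB⟩ := cubic_bound (|x| + 1) (by positivity)
  have hBint : IntegrableOn (fun s : ℝ => Real.exp B * Real.exp (-1 * s)) (Set.Ioi 0) :=
    (exp_neg_integrableOn_Ioi 0 one_pos).const_mul _
  have hexpB : ∀ s : ℝ, 0 ≤ s → Real.exp ((|x| + 1) * s - 3 / 40 * s ^ 3) ≤
      Real.exp B * Real.exp (-1 * s) := by
    intro s hs
    rw [← Real.exp_add]
    exact Real.exp_le_exp.2 (by linarith [hB s hs])
  constructor
  · refine hBint.mono' (Continuous.aestronglyMeasurable (by fun_prop)) ?_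
    refine (ae_restrict_iff' measurableSet_Ioi).2 (ae_of_all _ fun s hs => ?_)
    have hs0 : 0 < s := hs
    refine le_trans ?_ (hexpB s hs0.le)
    rw [norm_mul, norm_mul, hw2, one_mul, Complex.norm_exp, Complex.norm_exp, ← Real.exp_add]
    refine Real.exp_le_exp.2 ?_
    have e1 : (-(↑x * w * ↑s)).re = -(x * s / 2) := by simp [hre]; ring
    have e2 : (-(s : ℂ) ^ 3 / 3).re = - s ^ 3 / 3 := by norm_cast
    rw [e1, e2]
    have := mul_le_mul_of_nonneg_right (neg_le_abs x) hs0.le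
    have : 0 < s ^ 3 := by positivity
    have : 0 ≤ |x| * s := by positivity
    linarith
  have hTT : 0 < TT := by unfold TT; positivity
  have hexpo : ∀ i (s : ℝ), 2 * t i * Complex.sinh (w * (η i * s : ℝ)) - n i * (w * (η i * s : ℝ)) =
      2 * t i * (Complex.sinh (w * (η i * s : ℝ)) - w * (η i * s : ℝ)) -
        ((n i - 2 * t i) * η i : ℝ) * w * s := by
    intro i s; push_cast; ring
  have hrw : ∀ i, (η i : ℂ)⁻¹ * ∫ τ in (0 : ℝ)..TT,
      w * cexp (2 * t i * Complex.sinh (w * τ) - n i * (w * τ)) =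
      ∫ s in Set.Ioi (0 : ℝ), (Set.Iic (TT / η i)).indicator (fun s : ℝ => w * cexp
        (2 * t i * Complex.sinh (w * (η i * s : ℝ)) - n i * (w * (η i * s : ℝ)))) s := by
    intro i
    rw [setIntegral_indicator measurableSet_Iic, Set.Ioi_inter_Iic,
      ← intervalIntegral.integral_of_le (div_pos hTT (hη i)).le,
      intervalIntegral.integral_comp_mul_left (fun τ : ℝ => w * cexp
        (2 * t i * Complex.sinh (w * τ) - n i * (w * τ))) (hη i).ne', mul_zero,
      mul_div_cancel₀ _ (hη i).ne', Complex.real_smul, Complex.ofReal_inv]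
  simp_rw [hrw]
  refine tendsto_integral_filter_of_dominated_convergence
    (fun s : ℝ => Real.exp B * Real.exp (-1 * s)) ?_ ?_ hBint ?_
  · refine Eventually.of_forall fun i => ?_
    exact (Continuous.aestronglyMeasurable (by fun_prop)).indicator measurableSet_Iic
  · have hxe : ∀ᶠ i in l, |(n i - 2 * t i) * η i| ≤ |x| + 1 :=
      (hx.abs.eventually (gt_mem_nhds (show |x| < |x| + 1 by linarith))).mono fun i h => h.le
    filter_upwards [hxe] with i hi
    refine (ae_restrict_iff' measurableSet_Ioi).2 (ae_of_all _ fun s hs => ?_)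
    have hs0 : 0 < s := hs
    by_cases hsT : s ∈ Set.Iic (TT / η i)
    swap
    · rw [Set.indicator_of_notMem hsT, norm_zero]; positivity
    rw [Set.indicator_of_mem hsT, norm_mul, hw2, one_mul, Complex.norm_exp]
    refine le_trans (Real.exp_le_exp.2 ?_) (hexpB s hs0.le)
    rw [hexpo]
    generalize hX : ((n i : ℝ) - 2 * t i) * η i = X at hi ⊢
    have e0 : w * ((η i * s : ℝ) : ℂ) = ⟨η i * s / 2, ε * (√3 * (η i * s / 2))⟩ := by
      rw [hw]; apply Complex.ext <;> simp <;> ring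
    have e1 : (2 * (t i : ℂ) * (Complex.sinh (w * (η i * s : ℝ)) - w * (η i * s : ℝ)) - X * w * s).re =
        2 * t i * (Real.sinh (η i * s / 2) * Real.cos (√3 * (η i * s / 2)) - η i * s / 2) - X * s / 2 := by
      have hcos : Real.cos (ε * (√3 * (η i * s / 2))) = Real.cos (√3 * (η i * s / 2)) := by
        rcases hε with rfl | rfl
        · rw [one_mul]
        · rw [neg_one_mul, Real.cos_neg]
      rw [Complex.sub_re, show (2 * (t i : ℂ)) = ((2 * t i : ℝ) : ℂ) by push_cast; ring,
        Complex.re_ofReal_mul, Complex.sub_re, e0, sinh_re, hcos,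
        show (X : ℂ) * w * s = ((X * s : ℝ) : ℂ) * w by push_cast; ring, Complex.re_ofReal_mul, hre]
      ring
    rw [e1]
    have hsT' : η i * s ≤ TT := by
      have := (le_div_iff₀ (hη i)).1 (Set.mem_Iic.1 hsT)
      linarith
    have hr := ray_ineq (σ := η i * s / 2) (by have := hη i; positivity) (by
      have : √3 * TT = 2 * Real.pi := by unfold TT; field_simp
      have := mul_le_mul_of_nonneg_left hsT' (show 0 ≤ √3 by positivity)
      linarith)
    have ht := t_pos (hη i) (hte i)
    have hm := mul_le_mul_of_nonneg_left hr (show 0 ≤ 2 * t i by linarith)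
    have e2 : 2 * t i * -(3 / 10 * (η i * s / 2) ^ 3) = - (3 / 40 * s ^ 3) * (t i * η i ^ 3) := by ring
    rw [e2, hte i] at hm
    have h4 := mul_le_mul_of_nonneg_right ((neg_le_abs X).trans hi) hs0.le
    have : 0 ≤ (|x| + 1) * s := by positivity
    linarith
  · refine (ae_restrict_iff' measurableSet_Ioi).2 (ae_of_all _ fun s hs => ?_)
    have hs0 : 0 < s := hs
    have hηs : Tendsto (fun i => η i * s) l (𝓝 0) := by simpa using hη0.mul_const s
    have hlim : Tendsto (fun i => 2 * (t i : ℂ) * Complex.sinh (w * (η i * s : ℝ)) -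
        n i * (w * (η i * s : ℝ))) l (𝓝 (-(s : ℂ) ^ 3 / 3 - x * w * s)) := by
      simp_rw [hexpo]
      refine Tendsto.sub ?_ ((((continuous_ofReal.tendsto x).comp hx).mul_const w).mul_const _)
      rw [tendsto_iff_norm_sub_tendsto_zero]
      refine squeeze_zero' (Eventually.of_forall fun i => norm_nonneg _) ?_
        (show Tendsto (fun i => 2 * η i * s ^ 4) l (𝓝 0) by
          simpa using (hη0.const_mul 2).mul_const (s ^ 4))
      filter_upwards [hηs.eventually (gt_mem_nhds one_pos)] with i hi
      have hi0 : 0 < η i * s := mul_pos (hη i) hs0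
      have hnz : ‖w * ((η i * s : ℝ) : ℂ)‖ = η i * s := by
        rw [norm_mul, hw2, one_mul, Complex.norm_real, Real.norm_eq_abs, abs_of_pos hi0]
      have ha := sinh_approx (z := w * ((η i * s : ℝ) : ℂ)) (by rw [hnz]; exact hi.le)
      rw [hnz] at ha
      have hteC : (t i : ℂ) * (η i : ℂ) ^ 3 = 1 := by exact_mod_cast hte i
      have e : 2 * (t i : ℂ) * (Complex.sinh (w * (η i * s : ℝ)) - w * (η i * s : ℝ)) - -(s : ℂ) ^ 3 / 3 =
        2 * t i * (Complex.sinh (w * (η i * s : ℝ)) - w * (η i * s : ℝ) - (w * (η i * s : ℝ)) ^ 3 / 6) := by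
        have : (t i : ℂ) * (w * (η i * s : ℝ)) ^ 3 = - s ^ 3 := by
          push_cast
          rw [mul_pow, mul_pow, hw3]
          linear_combination (-(s : ℂ) ^ 3) * hteC
        linear_combination (1 / 3 : ℂ) * this
      have ht := t_pos (hη i) (hte i)
      rw [e, norm_mul, norm_mul, Complex.norm_ofNat, Complex.norm_real, Real.norm_eq_abs, abs_of_pos ht]
      calc 2 * t i * _ ≤ 2 * t i * (η i * s) ^ 4 := by gcongr
        _ = 2 * (t i * η i ^ 3) * η i * s ^ 4 := by ring
        _ = 2 * η i * s ^ 4 := by rw [hte i]; ring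
    have hfin : Tendsto (fun i => w * cexp (2 * (t i : ℂ) * Complex.sinh (w * (η i * s : ℝ)) -
        n i * (w * (η i * s : ℝ)))) l (𝓝 (w * cexp (-(x * w * s)) * cexp (-(s : ℂ) ^ 3 / 3))) := by
      have := ((continuous_exp.tendsto _).comp hlim).const_mul w
      rw [mul_assoc, ← Complex.exp_add, show -((x : ℂ) * w * s) + -(s : ℂ) ^ 3 / 3 =
        -(s : ℂ) ^ 3 / 3 - x * w * s by ring]
      exact this
    refine hfin.congr' ?_
    filter_upwards [hηs.eventually (gt_mem_nhds hTT)] with i hi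
    rw [Set.indicator_of_mem]
    rw [Set.mem_Iic, le_div_iff₀ (hη i)]
    linarith

lemma exp_om : cexp (2 * (Real.pi : ℂ) * I / 3) = -om' ∧ cexp (-(2 * (Real.pi : ℂ) * I) / 3) = -om := by
  have hc : Real.cos (2 * Real.pi / 3) = -(1 / 2) := by
    rw [show 2 * Real.pi / 3 = Real.pi - Real.pi / 3 by ring, Real.cos_pi_sub, Real.cos_pi_div_three]
  have hs : Real.sin (2 * Real.pi / 3) = √3 / 2 := by
    rw [show 2 * Real.pi / 3 = Real.pi - Real.pi / 3 by ring, Real.sin_pi_sub, Real.sin_pi_div_three]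
  constructor
  · rw [show 2 * (Real.pi : ℂ) * I / 3 = ((2 * Real.pi / 3 : ℝ) : ℂ) * I by push_cast; ring]
    apply Complex.ext
    · rw [Complex.exp_ofReal_mul_I_re, hc]; simp [om']
    · rw [Complex.exp_ofReal_mul_I_im, hs]; simp [om']
  · rw [show -(2 * (Real.pi : ℂ) * I) / 3 = ((-(2 * Real.pi / 3) : ℝ) : ℂ) * I by push_cast; ring]
    apply Complex.ext
    · rw [Complex.exp_ofReal_mul_I_re, Real.cos_neg, hc]; simp [om]
    · rw [Complex.exp_ofReal_mul_I_im, Real.sin_neg, hs]; simp [om]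

lemma J_airy [l.IsCountablyGenerated] {η t : ι → ℝ} {n : ι → ℕ} {x : ℝ}
    (hη : ∀ i, 0 < η i) (hte : ∀ i, t i * η i ^ 3 = 1)
    (hη0 : Tendsto η l (𝓝 0)) (hx : Tendsto (fun i => (n i - 2 * t i) * η i) l (𝓝 x)) :
    Tendsto (fun i => ((JJ (t i) (n i) / η i : ℝ) : ℂ)) l (𝓝 (Ai x)) := by
  obtain ⟨i1, l1⟩ := ray_limit (ε := 1) (w := om) (Or.inl rfl) (by simp [om]) hη hte hη0 hx
  obtain ⟨i2, l2⟩ := ray_limit (ε := -1) (w := om') (Or.inr rfl) (by simp [om']) hη hte hη0 hx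
  have hA : Ai x = (2 * (Real.pi : ℂ) * I)⁻¹ *
      ((∫ s in Set.Ioi (0 : ℝ), om * cexp (-(x * om * s)) * cexp (-(s : ℂ) ^ 3 / 3)) -
      ∫ s in Set.Ioi (0 : ℝ), om' * cexp (-(x * om' * s)) * cexp (-(s : ℂ) ^ 3 / 3)) := by
    rw [← integral_sub i1 i2]
    unfold Ai
    rw [exp_om.1, exp_om.2]
    congr 2
    ext s
    rw [mul_neg, mul_neg, neg_mul, neg_mul]
    ring
  rw [hA]
  refine ((l1.sub l2).const_mul _).congr fun i => ?_
  rw [← mul_sub, J_contour]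
  have : (2 * (Real.pi : ℂ) * I) ≠ 0 := Complex.two_pi_I_ne_zero
  push_cast
  field_simp

end BDJ

namespace BDJ
variable {t η K : ℝ}

noncomputable def BK (K : ℝ) : ℝ := (K + 6) * Real.exp 3 * Real.exp K
noncomputable def MK (K : ℝ) : ℝ := 2 * BK K ^ 3 + (K + 1) * BK K
noncomputable def DK (K : ℝ) : ℝ := 2 * BK K + 4 * MK K
noncomputable def EK (K : ℝ) : ℝ := 6 * BK K ^ 2 * DK K + BK K + K * DK K

lemma BK_pos (hK : 0 ≤ K) : 0 < BK K := by unfold BK; positivity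
lemma MK_pos (hK : 0 ≤ K) : 0 < MK K := by have := BK_pos hK; unfold MK; positivity
lemma DK_pos (hK : 0 ≤ K) : 0 < DK K := by
  have := BK_pos hK; have := MK_pos hK; unfold DK; positivity
lemma EK_pos (hK : 0 ≤ K) : 0 < EK K := by
  have := BK_pos hK; have := DK_pos hK; unfold EK; positivity

lemma rho_sup (hη : 0 < η) (hη1 : η ≤ 1 / 2) (hte : t * η ^ 3 = 1) (hK : 0 ≤ K)
    (hK2 : (K + 1) * η ^ 2 ≤ 2) (n : ℕ) (hn : -K ≤ (n - 2 * t) * η) :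
    |rho t n| ≤ BK K * η ∧ |(n - 2 * t) * η| * |rho t n| ≤ (K + 1) * BK K * η := by
  have h := rho_bound hη hη1 hte hK hK2 n hn
  generalize (n - 2 * t) * η = X at *
  have hA : 0 < (K + 6) * Real.exp 3 := by positivity
  have hA2 : 0 < (K + 6) * Real.exp 3 * η := by positivity
  have he : Real.exp (-X) ≤ Real.exp K := Real.exp_le_exp.2 (by linarith)
  have he1 : (1 : ℝ) ≤ Real.exp K := Real.one_le_exp hK
  constructor
  · refine h.trans ?_
    unfold BK
    have := mul_le_mul_of_nonneg_left he hA2.le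
    linarith
  · have h2 : |X| * Real.exp (-X) ≤ (K + 1) * Real.exp K := by
      rcases le_or_gt 0 X with h0 | h0
      · rw [abs_of_nonneg h0]
        have : X * Real.exp (-X) ≤ 1 := by
          have := Real.add_one_le_exp X
          rw [Real.exp_neg, mul_inv_le_iff₀ (Real.exp_pos _)]; linarith
        nlinarith
      · have : |X| ≤ K + 1 := by rw [abs_of_neg h0]; linarith
        exact mul_le_mul this he (Real.exp_pos _).le (by linarith)
    calc |X| * |rho t n| ≤ |X| * ((K + 6) * Real.exp 3 * η * Real.exp (-X)) := by gcongr
      _ = (K + 6) * Real.exp 3 * η * (|X| * Real.exp (-X)) := by ring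
      _ ≤ (K + 6) * Real.exp 3 * η * ((K + 1) * Real.exp K) := by gcongr
      _ = _ := by unfold BK; ring

lemma second_diff (hη : 0 < η) (hte : t * η ^ 3 = 1) (n : ℕ) :
    rho t (n + 2) - 2 * rho t (n + 1) + rho t n = rho t (n + 1) ^ 2 * (rho t (n + 2) + rho t n) +
      ((n + 1 : ℕ) - 2 * t) * η * η ^ 2 * rho t (n + 1) := by
  have h := dpII hη hte (n + 1) (by omega)
  rw [Nat.add_sub_cancel] at h
  linear_combination -h

lemma X_mono (hη : 0 < η) (t : ℝ) {n m : ℕ} (h : n ≤ m) {a : ℝ} (hn : a ≤ (n - 2 * t) * η) :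
    a ≤ (m - 2 * t) * η := by
  have : (n : ℝ) ≤ m := by exact_mod_cast h
  refine hn.trans ?_
  gcongr

lemma d2_bound (hη : 0 < η) (hη1 : η ≤ 1 / 2) (hte : t * η ^ 3 = 1) (hK : 0 ≤ K)
    (hK2 : (K + 1) * η ^ 2 ≤ 2) (n : ℕ) (hn : -K ≤ (n - 2 * t) * η) :
    |rho t (n + 2) - 2 * rho t (n + 1) + rho t n| ≤ MK K * η ^ 3 := by
  have h0 := (rho_sup hη hη1 hte hK hK2 n hn).1
  have h1 := rho_sup hη hη1 hte hK hK2 (n + 1) (X_mono hη t (by omega) hn)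
  have h2 := (rho_sup hη hη1 hte hK hK2 (n + 2) (X_mono hη t (by omega) hn)).1
  rw [second_diff hη hte]
  have hB := BK_pos hK
  have a1 : |rho t (n + 1) ^ 2 * (rho t (n + 2) + rho t n)| ≤ (BK K * η) ^ 2 * (2 * (BK K * η)) := by
    rw [abs_mul, abs_pow]
    have := abs_add_le (rho t (n + 2)) (rho t n)
    gcongr
    · exact h1.1
    · linarith
  have a2 : |((n + 1 : ℕ) - 2 * t) * η * η ^ 2 * rho t (n + 1)| ≤ (K + 1) * BK K * η * η ^ 2 := by
    rw [show ((n + 1 : ℕ) - 2 * t) * η * η ^ 2 * rho t (n + 1) =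
      (((n + 1 : ℕ) - 2 * t) * η) * rho t (n + 1) * η ^ 2 by ring, abs_mul, abs_mul,
      abs_of_pos (show 0 < η ^ 2 by positivity)]
    have := h1.2
    gcongr
  refine (abs_add_le _ _).trans ((add_le_add a1 a2).trans (le_of_eq ?_))
  unfold MK; ring

lemma taylor {y : ℕ → ℝ} {n : ℕ} {M : ℝ} (hM : 0 ≤ M) (k : ℕ)
    (h : ∀ j, |y (n + j + 2) - 2 * y (n + j + 1) + y (n + j)| ≤ M) :
    |y (n + k + 1) - y (n + k) - (y (n + 1) - y n)| ≤ M * k ∧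
    |y (n + k) - y n - k * (y (n + 1) - y n)| ≤ M * k ^ 2 := by
  induction k with
  | zero => simp
  | succ k ih =>
    have hk := h k
    have e : n + (k + 1) = n + k + 1 := by omega
    rw [e]
    push_cast
    constructor
    · rw [show y (n + k + 1 + 1) - y (n + k + 1) - (y (n + 1) - y n) =
        (y (n + k + 2) - 2 * y (n + k + 1) + y (n + k)) + (y (n + k + 1) - y (n + k) - (y (n + 1) - y n)) by ring]
      refine (abs_add_le _ _).trans ?_
      linarith [ih.1]
    · rw [show y (n + k + 1) - y n - ((k : ℝ) + 1) * (y (n + 1) - y n) =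
        (y (n + k + 1) - y (n + k) - (y (n + 1) - y n)) + (y (n + k) - y n - k * (y (n + 1) - y n)) by ring]
      refine (abs_add_le _ _).trans ?_
      have : 0 ≤ M * k := by positivity
      linarith [ih.1, ih.2]

lemma d_bound (hη : 0 < η) (hη1 : η ≤ 1 / 2) (hte : t * η ^ 3 = 1) (hK : 0 ≤ K)
    (hK2 : (K + 1) * η ^ 2 ≤ 2) (n : ℕ) (hn : -K ≤ (n - 2 * t) * η) :
    |rho t (n + 1) - rho t n| ≤ DK K * η ^ 2 := by
  set k := ⌈1 / η⌉₊ with hk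
  have k1 : 1 / η ≤ k := Nat.le_ceil _
  have k2 : (k : ℝ) < 1 / η + 1 := Nat.ceil_lt_add_one (by positivity)
  have kk1 : 1 ≤ k * η := by rwa [div_le_iff₀ hη] at k1
  have kk2 : k * η ≤ 2 := by
    have := mul_lt_mul_of_pos_right k2 hη
    rw [add_mul, div_mul_cancel₀ _ hη.ne'] at this
    linarith
  have hB := BK_pos hK
  have hM := MK_pos hK
  have ht := (taylor (y := rho t) (n := n) (M := MK K * η ^ 3) (by positivity) k fun j =>
    d2_bound hη hη1 hte hK hK2 (n + j) (X_mono hη t (by omega) hn)).2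
  have h0 := (rho_sup hη hη1 hte hK hK2 n hn).1
  have h1 := (rho_sup hη hη1 hte hK hK2 (n + k) (X_mono hη t (by omega) hn)).1
  generalize rho t (n + 1) - rho t n = δ at *
  have hkd : (k : ℝ) * |δ| ≤ 2 * BK K * η + MK K * η ^ 3 * k ^ 2 := by
    have e : (k : ℝ) * |δ| = |(rho t (n + k) - rho t n) - (rho t (n + k) - rho t n - k * δ)| := by
      rw [sub_sub_cancel, abs_mul, Nat.abs_cast]
    rw [e]
    have := _root_.abs_sub (rho t (n + k) - rho t n) (rho t (n + k) - rho t n - k * δ)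
    have := _root_.abs_sub (rho t (n + k)) (rho t n)
    linarith
  have hd0 := abs_nonneg δ
  calc |δ| = 1 * |δ| := (one_mul _).symm
    _ ≤ (k * η) * |δ| := by gcongr
    _ = (k * |δ|) * η := by ring
    _ ≤ (2 * BK K * η + MK K * η ^ 3 * k ^ 2) * η := by gcongr
    _ = 2 * BK K * η ^ 2 + MK K * η ^ 2 * (k * η) ^ 2 := by ring
    _ ≤ 2 * BK K * η ^ 2 + MK K * η ^ 2 * 2 ^ 2 := by gcongr
    _ = DK K * η ^ 2 := by unfold DK; ring

lemma lip (hη : 0 < η) (hη1 : η ≤ 1 / 2) (hte : t * η ^ 3 = 1) (hK : 0 ≤ K)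
    (hK2 : (K + 1) * η ^ 2 ≤ 2) (n : ℕ) (hn : -K ≤ (n - 2 * t) * η) (j : ℕ) :
    |rho t (n + j) - rho t n| ≤ j * (DK K * η ^ 2) := by
  induction j with
  | zero => simp
  | succ j ih =>
    have := d_bound hη hη1 hte hK hK2 (n + j) (X_mono hη t (by omega) hn)
    rw [show rho t (n + (j + 1)) - rho t n =
      (rho t (n + j + 1) - rho t (n + j)) + (rho t (n + j) - rho t n) by rw [← add_assoc]; ring]
    refine (abs_add_le _ _).trans ?_
    push_cast
    linarith

lemma cube_diff {a b c v B d : ℝ} (ha : |a| ≤ B) (hb : |b| ≤ B) (hv : |v| ≤ B)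
    (da : |a - v| ≤ d) (db : |b - v| ≤ d) (dc : |c - v| ≤ d) :
    |a ^ 2 * (b + c) - 2 * v ^ 3| ≤ 6 * B ^ 2 * d := by
  have hB : 0 ≤ B := (abs_nonneg _).trans ha
  have hd : 0 ≤ d := (abs_nonneg _).trans da
  have e : a ^ 2 * (b + c) - 2 * v ^ 3 = a * b * (a - v) + a * v * (b - v) + v * v * (a - v)
    + (a * a * (c - v) + a * v * (a - v) + v * v * (a - v)) := by ring
  have key : ∀ p q r : ℝ, |p| ≤ B → |q| ≤ B → |r| ≤ d → |p * q * r| ≤ B ^ 2 * d := by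
    intro p q r hp hq hr
    rw [abs_mul, abs_mul, pow_two]
    gcongr
  rw [e]
  have i1 := key _ _ _ ha hb da
  have i2 := key _ _ _ ha hv db
  have i3 := key _ _ _ hv hv da
  have i4 := key _ _ _ ha ha dc
  have i5 := key _ _ _ ha hv da
  have i6 := abs_add_le (a * b * (a - v) + a * v * (b - v)) (v * v * (a - v))
  have i7 := abs_add_le (a * b * (a - v)) (a * v * (b - v))
  have i8 := abs_add_le (a * a * (c - v) + a * v * (a - v)) (v * v * (a - v))
  have i9 := abs_add_le (a * a * (c - v)) (a * v * (a - v))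
  refine (abs_add_le _ _).trans ?_
  linarith

lemma dd_step (hη : 0 < η) (hη1 : η ≤ 1 / 2) (hte : t * η ^ 3 = 1) (hK : 0 ≤ K)
    (hK2 : (K + 1) * η ^ 2 ≤ 2) (n : ℕ) (hn : -K ≤ (n - 2 * t) * η) (hn2 : (n - 2 * t) * η ≤ K) (j : ℕ) :
    |rho t (n + j + 2) - 2 * rho t (n + j + 1) + rho t (n + j) -
      η ^ 3 * ((n - 2 * t) * η * (rho t n / η) + 2 * (rho t n / η) ^ 3)| ≤
      EK K * η ^ 3 * ((j + 2) * η) := by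
  have hD := DK_pos hK
  have hB := BK_pos hK
  have hv : ∀ m, n ≤ m → |rho t m / η| ≤ BK K := by
    intro m hm
    rw [abs_div, abs_of_pos hη, div_le_iff₀ hη]
    exact (rho_sup hη hη1 hte hK hK2 m (X_mono hη t hm hn)).1
  have hdv : ∀ i, i ≤ j + 2 → |rho t (n + i) / η - rho t n / η| ≤ DK K * ((j + 2) * η) := by
    intro i hi
    rw [← sub_div, abs_div, abs_of_pos hη, div_le_iff₀ hη]
    refine (lip hη hη1 hte hK hK2 n hn i).trans ?_
    have : (i : ℝ) ≤ j + 2 := by exact_mod_cast hi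
    calc (i : ℝ) * (DK K * η ^ 2) ≤ (j + 2) * (DK K * η ^ 2) := by gcongr
      _ = _ := by ring
  have c1 := cube_diff (hv (n + (j + 1)) (by omega)) (hv (n + (j + 2)) (by omega)) (hv n le_rfl)
    (hdv (j + 1) (by omega)) (hdv (j + 2) le_rfl) (hdv j (by omega))
  have c2 := hdv (j + 1) (by omega)
  have c3 := hv (n + (j + 1)) (by omega)
  rw [second_diff hη hte]
  simp only [← add_assoc] at c1 c2 c3
  have hX : |(n - 2 * t) * η| ≤ K := abs_le.2 ⟨hn, hn2⟩
  have e : rho t (n + j + 1) ^ 2 * (rho t (n + j + 2) + rho t (n + j)) +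
      ((n + j + 1 : ℕ) - 2 * t) * η * η ^ 2 * rho t (n + j + 1) -
      η ^ 3 * ((n - 2 * t) * η * (rho t n / η) + 2 * (rho t n / η) ^ 3) =
      η ^ 3 * (((rho t (n + j + 1) / η) ^ 2 * (rho t (n + j + 2) / η + rho t (n + j) / η) -
        2 * (rho t n / η) ^ 3) + (((j + 1) * η) * (rho t (n + j + 1) / η) +
        ((n - 2 * t) * η) * (rho t (n + j + 1) / η - rho t n / η))) := by
    push_cast
    field_simp
    ring
  rw [e, abs_mul, abs_of_pos (show 0 < η ^ 3 by positivity), 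
    show EK K * η ^ 3 * ((j + 2) * η) = η ^ 3 * (EK K * ((j + 2) * η)) by ring]
  refine mul_le_mul_of_nonneg_left ?_ (by positivity)
  have d1 : |((j + 1) * η) * (rho t (n + j + 1) / η)| ≤ ((j + 2) * η) * BK K := by
    rw [abs_mul, abs_of_nonneg (show 0 ≤ ((j : ℝ) + 1) * η by positivity)]
    gcongr
    linarith
  have d2 : |((n - 2 * t) * η) * (rho t (n + j + 1) / η - rho t n / η)| ≤ K * (DK K * ((j + 2) * η)) := by
    rw [abs_mul]
    gcongr
  refine (abs_add_le _ _).trans ((add_le_add c1 ((abs_add_le _ _).trans (add_le_add d1 d2))).trans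
    (le_of_eq ?_))
  unfold EK; ring

lemma dd_bound (hη : 0 < η) (hη1 : η ≤ 1 / 2) (hte : t * η ^ 3 = 1) (hK : 0 ≤ K)
    (hK2 : (K + 1) * η ^ 2 ≤ 2) (n : ℕ) (hn : -K ≤ (n - 2 * t) * η) (hn2 : (n - 2 * t) * η ≤ K) (k : ℕ) :
    |(rho t (n + k + 1) - rho t (n + k)) / η ^ 2 - (rho t (n + 1) - rho t n) / η ^ 2 -
      k * η * ((n - 2 * t) * η * (rho t n / η) + 2 * (rho t n / η) ^ 3)| ≤
      EK K * (k * η) * (k * η + η) := by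
  set g := (n - 2 * t) * η * (rho t n / η) + 2 * (rho t n / η) ^ 3 with hg
  have hE := EK_pos hK
  have main : |(rho t (n + k + 1) - rho t (n + k)) - (rho t (n + 1) - rho t n) -
      k * (η ^ 3 * g)| ≤ k * (EK K * η ^ 3 * ((k + 1) * η)) := by
    induction k with
    | zero => simp
    | succ k ih =>
      have hs := dd_step hη hη1 hte hK hK2 n hn hn2 k
      rw [← hg] at hs
      rw [show n + (k + 1) = n + k + 1 by omega]
      push_cast
      rw [show rho t (n + k + 1 + 1) - rho t (n + k + 1) - (rho t (n + 1) - rho t n) -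
        ((k : ℝ) + 1) * (η ^ 3 * g) = ((rho t (n + k + 1) - rho t (n + k)) - (rho t (n + 1) - rho t n) -
        k * (η ^ 3 * g)) + (rho t (n + k + 2) - 2 * rho t (n + k + 1) + rho t (n + k) - η ^ 3 * g) by ring]
      refine (abs_add_le _ _).trans ((add_le_add ih hs).trans ?_)
      have : 0 ≤ k * (EK K * η ^ 3 * η) := by positivity
      nlinarith
  rw [show (rho t (n + k + 1) - rho t (n + k)) / η ^ 2 - (rho t (n + 1) - rho t n) / η ^ 2 - k * η * g =
    ((rho t (n + k + 1) - rho t (n + k)) - (rho t (n + 1) - rho t n) - k * (η ^ 3 * g)) / η ^ 2 by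
      field_simp, abs_div, abs_of_pos (show 0 < η ^ 2 by positivity), div_le_iff₀ (by positivity)]
  refine main.trans (le_of_eq ?_)
  ring

end BDJ

namespace BDJ

def Tay (f g : ℝ → ℝ) : Prop := ∀ K : ℝ, 0 < K → ∃ M : ℝ, ∀ x y, -K ≤ x → x ≤ y → y ≤ K →
  |f y - f x - (y - x) * g x| ≤ M * (y - x) ^ 2

lemma near_aux (x : ℝ) : ∀ᶠ y in 𝓝 x, |y - x| ≤ 1 := by
  have : Tendsto (fun y => |y - x|) (𝓝 x) (𝓝 |x - x|) := (continuous_id.sub continuous_const).abs.tendsto x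
  rw [sub_self, abs_zero] at this
  exact (this.eventually (gt_mem_nhds one_pos)).mono fun y h => h.le

lemma Tay.both {f g : ℝ → ℝ} (h : Tay f g) (x : ℝ) : ∃ M : ℝ, ∀ᶠ y in 𝓝 x,
    |f y - f x - (y - x) * g x| ≤ |y - x| * (M * |y - x| + |g y - g x|) := by
  obtain ⟨M, hM⟩ := h (|x| + 1) (by positivity)
  refine ⟨M, ?_⟩
  filter_upwards [near_aux x] with y hy
  have hx := abs_le.1 (le_refl |x|)
  have hy' := abs_le.1 hy
  rcases le_total x y with hxy | hxy
  · refine (hM x y (by linarith) hxy (by linarith)).trans ?_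
    rw [abs_of_nonneg (sub_nonneg.2 hxy)]
    have : 0 ≤ (y - x) * |g y - g x| := mul_nonneg (sub_nonneg.2 hxy) (abs_nonneg _)
    nlinarith
  · have h1 := hM y x (by linarith) hxy (by linarith)
    rw [abs_sub_comm y x, abs_of_nonneg (sub_nonneg.2 hxy)]
    rw [show f y - f x - (y - x) * g x = -((f x - f y - (x - y) * g y) + (x - y) * (g y - g x)) by ring,
      abs_neg]
    refine (abs_add_le _ _).trans ?_
    rw [abs_mul, abs_of_nonneg (sub_nonneg.2 hxy)]
    nlinarith

lemma Tay.continuous {f g : ℝ → ℝ} (h : Tay f g)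
    (hg : ∀ K : ℝ, 0 < K → ∃ M : ℝ, ∀ x, -K ≤ x → x ≤ K → |g x| ≤ M) : Continuous f := by
  refine continuous_iff_continuousAt.2 fun x => ?_
  obtain ⟨M, hM⟩ := h.both x
  obtain ⟨G, hG⟩ := hg (|x| + 1) (by positivity)
  have hx := abs_le.1 (le_refl |x|)
  have hgx := hG x (by linarith) (by linarith)
  rw [ContinuousAt, tendsto_iff_norm_sub_tendsto_zero]
  refine squeeze_zero' (Eventually.of_forall fun i => norm_nonneg _) ?_
    (show Tendsto (fun y => |y - x| * (M * |y - x| + 3 * G)) (𝓝 x) (𝓝 0) by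
      have : Continuous fun y => |y - x| * (M * |y - x| + 3 * G) := by fun_prop
      simpa using this.tendsto x)
  filter_upwards [hM, near_aux x] with y h1 hy
  have hy' := abs_le.1 hy
  have h2 := hG y (by linarith) (by linarith)
  rw [Real.norm_eq_abs, show f y - f x = (f y - f x - (y - x) * g x) + (y - x) * g x by ring]
  refine (abs_add_le _ _).trans ?_
  rw [abs_mul]
  have h3 : |g y - g x| ≤ 2 * G := (_root_.abs_sub _ _).trans (by linarith)
  have := abs_nonneg (y - x)
  calc _ ≤ |y - x| * (M * |y - x| + 2 * G) + |y - x| * G := by gcongr; exact h1.trans (by gcongr)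
    _ = _ := by ring

lemma Tay.deriv {f g : ℝ → ℝ} (h : Tay f g) (hg : Continuous g) (x : ℝ) : HasDerivAt f (g x) x := by
  rw [hasDerivAt_iff_tendsto]
  obtain ⟨M, hM⟩ := h.both x
  refine squeeze_zero' (Eventually.of_forall fun i => by positivity) ?_
    (show Tendsto (fun y => M * |y - x| + |g y - g x|) (𝓝 x) (𝓝 0) by
      have : Continuous fun y => M * |y - x| + |g y - g x| := by fun_prop
      simpa using this.tendsto x)
  filter_upwards [hM] with y h1
  rw [smul_eq_mul, Real.norm_eq_abs, Real.norm_eq_abs]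
  rcases eq_or_ne y x with rfl | hne
  · simp
  · have : 0 < |y - x| := abs_pos.2 (sub_ne_zero.2 hne)
    rw [inv_mul_le_iff₀ this]
    exact h1

noncomputable def nn (t η x : ℝ) : ℕ := ⌊2 * t + x / η⌋₊

lemma nn_bounds {t η x : ℝ} (hη : 0 < η) (hte : t * η ^ 3 = 1) (h : 0 ≤ 2 + x * η ^ 2) :
    x - η < (nn t η x - 2 * t) * η ∧ (nn t η x - 2 * t) * η ≤ x := by
  have e : 2 * t + x / η = (2 + x * η ^ 2) * t := by
    have : t = 1 / η ^ 3 := by field_simp; linarith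
    rw [this]; field_simp
  have h0 : 0 ≤ 2 * t + x / η := by
    rw [e]; exact mul_nonneg h (t_pos hη hte).le
  have h1 := Nat.floor_le h0
  have h2 := Nat.lt_floor_add_one (2 * t + x / η)
  have e2 : x / η * η = x := by field_simp
  unfold nn
  constructor
  · have := mul_lt_mul_of_pos_right h2 hη
    nlinarith
  · have := mul_le_mul_of_nonneg_right h1 hη.le
    nlinarith

lemma nn_mono {t η x y : ℝ} (hη : 0 < η) (h : x ≤ y) : nn t η x ≤ nn t η y :=
  Nat.floor_mono (by gcongr)

variable {ι : Type*} {l : Filter ι} {η t : ι → ℝ}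

lemma nn_ev (hη0 : Tendsto η l (𝓝 0)) (x : ℝ) : ∀ᶠ i in l, 0 ≤ 2 + x * η i ^ 2 := by
  have : Tendsto (fun i => 2 + x * η i ^ 2) l (𝓝 (2 + x * 0 ^ 2)) := ((hη0.pow 2).const_mul x).const_add 2
  exact (this.eventually (lt_mem_nhds (show (0 : ℝ) < 2 + x * 0 ^ 2 by norm_num))).mono fun i h => h.le

lemma K_ev (hη0 : Tendsto η l (𝓝 0)) (K : ℝ) : ∀ᶠ i in l, (K + 1) * η i ^ 2 ≤ 2 := by
  filter_upwards [nn_ev hη0 (-(K + 1))] with i hi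
  linarith

lemma nn_tendsto (hη : ∀ i, 0 < η i) (hte : ∀ i, t i * η i ^ 3 = 1)
    (hη0 : Tendsto η l (𝓝 0)) (x : ℝ) :
    Tendsto (fun i => (nn (t i) (η i) x - 2 * t i) * η i) l (𝓝 x) := by
  refine tendsto_of_tendsto_of_tendsto_of_le_of_le' (g := fun i => x - η i) (h := fun _ => x)
    (by simpa using hη0.const_sub x) tendsto_const_nhds ?_ ?_
  · filter_upwards [nn_ev hη0 x] with i hi
    exact (nn_bounds (hη i) (hte i) hi).1.le
  · filter_upwards [nn_ev hη0 x] with i hi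
    exact (nn_bounds (hη i) (hte i) hi).2

lemma ultra_lim (𝒰 : Ultrafilter ι) (f : ι → ℝ) (B : ℝ) (h : ∀ᶠ i in (𝒰 : Filter ι), |f i| ≤ B) :
    ∃ a, |a| ≤ B ∧ Tendsto f 𝒰 (𝓝 a) := by
  obtain ⟨a, ha, h2⟩ := (isCompact_Icc (a := -B) (b := B)).ultrafilter_le_nhds (𝒰.map f)
    (by
      rw [le_principal_iff]
      exact h.mono fun i hi => abs_le.1 hi)
  exact ⟨a, abs_le.2 ha, h2⟩

lemma exists_limit (𝒰 : Ultrafilter ι) (hη : ∀ i, 0 < η i) (hη1 : ∀ i, η i ≤ 1 / 2)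
    (hte : ∀ i, t i * η i ^ 3 = 1) (hη0 : Tendsto η 𝒰 (𝓝 0)) :
    ∃ u p : ℝ → ℝ, (∀ x, Tendsto (fun i => rho (t i) (nn (t i) (η i) x) / η i) 𝒰 (𝓝 (u x))) ∧
      (∀ x, Tendsto (fun i => (rho (t i) (nn (t i) (η i) x + 1) - rho (t i) (nn (t i) (η i) x)) / η i ^ 2)
        𝒰 (𝓝 (p x))) ∧
      (∀ x, HasDerivAt u (p x) x) ∧ (∀ x, HasDerivAt p (x * u x + 2 * u x ^ 3) x) := by
  have hev : ∀ x K : ℝ, -K + 1 ≤ x → ∀ᶠ i in (𝒰 : Filter ι), (K + 1) * η i ^ 2 ≤ 2 ∧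
      -K ≤ (nn (t i) (η i) x - 2 * t i) * η i ∧ (nn (t i) (η i) x - 2 * t i) * η i ≤ x := by
    intro x K hx
    filter_upwards [K_ev hη0 K, nn_ev hη0 x] with i h1 h2
    have := nn_bounds (hη i) (hte i) h2
    exact ⟨h1, by linarith [hη1 i], this.2⟩
  have hv : ∀ x K : ℝ, 0 ≤ K → -K + 1 ≤ x → ∀ᶠ i in (𝒰 : Filter ι),
      |rho (t i) (nn (t i) (η i) x) / η i| ≤ BK K := by
    intro x K hK hx
    filter_upwards [hev x K hx] with i h
    rw [abs_div, abs_of_pos (hη i), div_le_iff₀ (hη i)]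
    exact (rho_sup (hη i) (hη1 i) (hte i) hK h.1 _ h.2.1).1
  have hd : ∀ x K : ℝ, 0 ≤ K → -K + 1 ≤ x → ∀ᶠ i in (𝒰 : Filter ι),
      |(rho (t i) (nn (t i) (η i) x + 1) - rho (t i) (nn (t i) (η i) x)) / η i ^ 2| ≤ DK K := by
    intro x K hK hx
    filter_upwards [hev x K hx] with i h
    have := hη i
    rw [abs_div, abs_of_pos (pow_pos this 2), div_le_iff₀ (by positivity)]
    exact (d_bound (hη i) (hη1 i) (hte i) hK h.1 _ h.2.1)
  have h1 : ∀ x : ℝ, -(|x| + 1) + 1 ≤ x := fun x => by linarith [neg_abs_le x]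
  choose u _ hu using fun x => ultra_lim 𝒰 _ _ (hv x (|x| + 1) (by positivity) (h1 x))
  choose p _ hp using fun x => ultra_lim 𝒰 _ _ (hd x (|x| + 1) (by positivity) (h1 x))
  have hub : ∀ x K : ℝ, 0 ≤ K → -K + 1 ≤ x → |u x| ≤ BK K := fun x K hK hx =>
    le_of_tendsto (hu x).abs (hv x K hK hx)
  have hpb : ∀ x K : ℝ, 0 ≤ K → -K + 1 ≤ x → |p x| ≤ DK K := fun x K hK hx =>
    le_of_tendsto (hp x).abs (hd x K hK hx)
  have hk : ∀ x y, x ≤ y → Tendsto (fun i => ((nn (t i) (η i) y - nn (t i) (η i) x : ℕ) : ℝ) * η i) 𝒰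
      (𝓝 (y - x)) := by
    intro x y hxy
    refine ((nn_tendsto hη hte hη0 y).sub (nn_tendsto hη hte hη0 x)).congr fun i => ?_
    rw [Nat.cast_sub (nn_mono (hη i) hxy)]
    ring
  have Tu : Tay u p := by
    intro K hK
    refine ⟨MK (K + 1), fun x y hx hxy hy => ?_⟩
    refine le_of_tendsto_of_tendsto (((hu y).sub (hu x)).sub ((hk x y hxy).mul (hp x))).abs
      (((hk x y hxy).pow 2).const_mul _) ?_
    filter_upwards [hev x (K + 1) (by linarith)] with i h
    have hT := (taylor (y := rho (t i)) (n := nn (t i) (η i) x) (M := MK (K + 1) * η i ^ 3)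
      (by have := MK_pos (show 0 ≤ K + 1 by linarith); have := hη i; positivity)
      (nn (t i) (η i) y - nn (t i) (η i) x) fun j =>
      d2_bound (hη i) (hη1 i) (hte i) (by linarith) h.1 _ (X_mono (hη i) _ (by omega) h.2.1)).2
    rw [Nat.add_sub_cancel' (nn_mono (hη i) hxy)] at hT
    generalize (nn (t i) (η i) y - nn (t i) (η i) x : ℕ) = k at *
    have hp := hη i
    have e : ∀ a b c : ℝ, a / η i - b / η i - k * η i * (c / η i ^ 2) = (a - b - k * c) / η i := by
      intro a b c; field_simp
    rw [e, abs_div, abs_of_pos hp, div_le_iff₀ hp]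
    refine hT.trans (le_of_eq ?_)
    ring
  have Tp : Tay p fun x => x * u x + 2 * u x ^ 3 := by
    intro K hK
    refine ⟨EK (K + 1), fun x y hx hxy hy => ?_⟩
    have hX := nn_tendsto hη hte hη0 x
    have hr := ((hk x y hxy).const_mul (EK (K + 1))).mul ((hk x y hxy).add hη0)
    rw [show EK (K + 1) * (y - x) * (y - x + 0) = EK (K + 1) * (y - x) ^ 2 by ring] at hr
    refine le_of_tendsto_of_tendsto (((hp y).sub (hp x)).sub ((hk x y hxy).mul
      ((hX.mul (hu x)).add (((hu x).pow 3).const_mul 2)))).abs hr ?_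
    filter_upwards [hev x (K + 1) (by linarith)] with i h
    have hT := dd_bound (hη i) (hη1 i) (hte i) (K := K + 1) (by linarith) h.1 _ h.2.1 (by linarith [h.2.2])
      (nn (t i) (η i) y - nn (t i) (η i) x)
    rw [Nat.add_sub_cancel' (nn_mono (hη i) hxy)] at hT
    exact hT
  have hKb : ∀ K x : ℝ, -K ≤ x → x ≤ K → |x| ≤ K := fun K x a b => abs_le.2 ⟨a, b⟩
  have cp : Continuous p := Tp.continuous fun K hK => ⟨K * BK (K + 1) + 2 * BK (K + 1) ^ 3,
    fun x hx1 hx2 => by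
      have h2 := hub x (K + 1) (by linarith) (by linarith)
      refine (abs_add_le _ _).trans ?_
      rw [abs_mul, abs_mul, abs_pow, abs_two]
      have := hKb K x hx1 hx2
      gcongr⟩
  have cu : Continuous u := Tu.continuous fun K hK => ⟨DK (K + 1), fun x hx1 hx2 =>
    hpb x (K + 1) (by linarith) (by linarith)⟩
  exact ⟨u, p, hu, hp, fun x => Tu.deriv cp x, fun x => Tp.deriv (g := fun x => x * u x + 2 * u x ^ 3)
    (by fun_prop) x⟩

end BDJ

namespace BDJ

def HM (u : ℝ → ℝ) : Prop := (∀ s : ℝ, DifferentiableAt ℝ u s) ∧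
  (∀ s : ℝ, HasDerivAt (deriv u) (s * u s + 2 * u s ^ 3) s) ∧
  Tendsto (fun s : ℝ => (u s : ℂ) / Ai s) atTop (𝓝 1)

noncomputable def et (k : ℕ) : ℝ := 1 / (k + 2)
noncomputable def tk (k : ℕ) : ℝ := (k + 2) ^ 3
lemma et_pos (k : ℕ) : 0 < et k := by unfold et; positivity
lemma et_half (k : ℕ) : et k ≤ 1 / 2 := by
  unfold et; gcongr; linarith [(Nat.cast_nonneg k : (0 : ℝ) ≤ k)]
lemma tk_et (k : ℕ) : tk k * et k ^ 3 = 1 := by unfold tk et; field_simp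
lemma et_tendsto : Tendsto et atTop (𝓝 0) := by
  have h : Tendsto (fun k : ℕ => (k : ℝ) + 2) atTop atTop :=
    tendsto_atTop_add_const_right _ _ tendsto_natCast_atTop_atTop
  refine h.inv_tendsto_atTop.congr fun k => ?_
  simp [et]

lemma Ai_real (x : ℝ) : Ai x = ((Ai x).re : ℂ) := by
  have h := J_airy et_pos tk_et et_tendsto (nn_tendsto et_pos tk_et et_tendsto x)
  have h2 := (Complex.continuous_im.tendsto _).comp h
  have h3 : (Ai x).im = 0 := by
    refine tendsto_nhds_unique h2 ?_
    simp [Function.comp_def]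
  apply Complex.ext <;> simp [h3]

lemma Ai_zero_pos : 0 < (Ai 0).re := by
  have hi := (ray_limit (ε := 1) (w := om) (Or.inl rfl) (by simp [om]) et_pos tk_et et_tendsto
    (nn_tendsto et_pos tk_et et_tendsto 0)).1.norm
  have hn : ‖om‖ ≠ 0 := norm_ne_zero_iff.2 om_ne
  have hi2 : IntegrableOn (fun s : ℝ => Real.exp (-s ^ 3 / 3)) (Set.Ioi 0) := by
    refine (hi.const_mul ‖om‖⁻¹).congr (ae_of_all _ fun s => ?_)
    simp only [norm_mul, ofReal_zero, zero_mul, neg_zero, Complex.exp_zero, mul_one]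
    rw [← mul_assoc, inv_mul_cancel₀ hn, one_mul, Complex.norm_exp]
    congr 1
    norm_cast
  have hpos : 0 < ∫ s in Set.Ioi (0 : ℝ), Real.exp (-s ^ 3 / 3) := by
    rw [setIntegral_pos_iff_support_of_nonneg_ae (ae_of_all _ fun s => (Real.exp_pos _).le) hi2]
    have : Function.support (fun s : ℝ => Real.exp (-s ^ 3 / 3)) = Set.univ :=
      Set.eq_univ_of_forall fun s => (Real.exp_pos _).ne'
    rw [this, Set.univ_inter]
    simp
  have hA : Ai 0 = ((√3 / (2 * Real.pi) * ∫ s in Set.Ioi (0 : ℝ), Real.exp (-s ^ 3 / 3) : ℝ) : ℂ) := by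
    unfold Ai
    rw [exp_om.1, exp_om.2]
    simp only [ofReal_zero, zero_mul, Complex.exp_zero, mul_one]
    rw [integral_const_mul]
    have e1 : ∫ s in Set.Ioi (0 : ℝ), cexp (-(s : ℂ) ^ 3 / 3) =
        ((∫ s in Set.Ioi (0 : ℝ), Real.exp (-s ^ 3 / 3) : ℝ) : ℂ) := by
      rw [← integral_complex_ofReal]
      congr 1; ext s; push_cast; rfl
    have e2 : -om' - -om = (√3 : ℂ) * I := by
      apply Complex.ext <;> simp [om, om']
    rw [e1, e2]
    have : (Real.pi : ℂ) ≠ 0 := by exact_mod_cast Real.pi_ne_zero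
    push_cast
    field_simp
  rw [hA, Complex.ofReal_re]
  have := Real.pi_pos
  positivity

noncomputable def CA : ℝ := 2 * (6 * Real.exp 3) ^ 2

lemma CA_ev : ∃ S : ℝ, 0 < S ∧ ∀ x, S ≤ x → CA * Real.exp (-(2 * x)) < 1 := by
  have : Tendsto (fun x : ℝ => CA * Real.exp (-(2 * x))) atTop (𝓝 0) := by
    have h : Tendsto (fun x : ℝ => 2 * x) atTop atTop := tendsto_id.const_mul_atTop two_pos
    simpa using (Real.tendsto_exp_neg_atTop_nhds_zero.comp h).const_mul CA
  obtain ⟨S, hS⟩ := eventually_atTop.1 (this.eventually (gt_mem_nhds one_pos))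
  exact ⟨max S 1, by positivity, fun x hx => hS x (le_trans (le_max_left _ _) hx)⟩

lemma lin_ode {w r c : ℝ → ℝ} (hw : ∀ x, HasDerivAt w (r x) x)
    (hr : ∀ x, HasDerivAt r (c x * w x) x) (hc : Continuous c) {a x : ℝ} (hx : a ≤ x)
    (w0 : w x = 0) (r0 : r x = 0) : w a = 0 := by
  obtain ⟨L, hL⟩ := (isCompact_Icc (a := a) (b := x)).exists_bound_of_continuousOn
    (f := fun y => 1 + c y) (by fun_prop)
  have hG : ∀ y, HasDerivAt (fun y => Real.exp (L * y) * (w y ^ 2 + r y ^ 2))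
      (Real.exp (L * y) * (L * (w y ^ 2 + r y ^ 2) + 2 * w y * r y * (1 + c y))) y := by
    intro y
    have h1 : HasDerivAt (fun y => Real.exp (L * y)) (Real.exp (L * y) * L) y := by
      simpa using ((hasDerivAt_id y).const_mul L).exp
    refine (h1.mul (((hw y).pow 2).add ((hr y).pow 2))).congr_deriv ?_
    simp
    ring
  have hm : MonotoneOn (fun y => Real.exp (L * y) * (w y ^ 2 + r y ^ 2)) (Set.Icc a x) := by
    refine monotoneOn_of_deriv_nonneg (convex_Icc a x) (fun y _ => (hG y).continuousAt.continuousWithinAt)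
      (fun y _ => (hG y).differentiableAt.differentiableWithinAt) fun y hy => ?_
    rw [interior_Icc] at hy
    rw [(hG y).deriv]
    refine mul_nonneg (Real.exp_pos _).le ?_
    have h1 := hL y ⟨hy.1.le, hy.2.le⟩
    have h2 : |2 * w y * r y| ≤ w y ^ 2 + r y ^ 2 :=
      abs_le.2 ⟨by nlinarith [sq_nonneg (w y + r y)], by nlinarith [sq_nonneg (w y - r y)]⟩
    have h3 := neg_abs_le (2 * w y * r y * (1 + c y))
    rw [abs_mul] at h3
    have h4 := mul_le_mul h2 h1 (norm_nonneg _) (by positivity)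
    rw [Real.norm_eq_abs] at h4
    linarith
  have h := hm (Set.left_mem_Icc.2 hx) (Set.right_mem_Icc.2 hx) hx
  simp only [w0, r0] at h
  norm_num at h
  have h2 := (mul_nonpos_iff_pos_imp_nonpos.1 h).1 (Real.exp_pos _)
  exact pow_eq_zero_iff two_ne_zero |>.1 (le_antisymm (by linarith [sq_nonneg (r a)]) (sq_nonneg _))

lemma pos_of_ode {u p : ℝ → ℝ} (hu : ∀ x, HasDerivAt u (p x) x)
    (hp : ∀ x, HasDerivAt p (x * u x + 2 * u x ^ 3) x) (h0 : ∀ x, 0 < x → 0 ≤ u x) (hz : 0 < u 0)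
    (x : ℝ) (hx : 0 < x) : 0 < u x := by
  by_contra hcon
  have hux : u x = 0 := le_antisymm (not_lt.1 hcon) (h0 x hx)
  have hpx : p x = 0 := by
    refine IsLocalMin.hasDerivAt_eq_zero ?_ (hu x)
    filter_upwards [lt_mem_nhds hx] with y hy
    rw [hux]; exact h0 y hy
  have cu : Continuous u := continuous_iff_continuousAt.2 fun x => (hu x).continuousAt
  exact hz.ne' (lin_ode (c := fun y => y + 2 * u y ^ 2) hu
    (fun y => (hp y).congr_deriv (by ring)) (by fun_prop) hx.le hux hpx)

variable {ι : Type*} {l : Filter ι} {η t : ι → ℝ}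

lemma exists_HM [l.IsCountablyGenerated] (𝒰 : Ultrafilter ι) (h𝒰 : (𝒰 : Filter ι) ≤ l)
    (hη : ∀ i, 0 < η i) (hη1 : ∀ i, η i ≤ 1 / 2)
    (hte : ∀ i, t i * η i ^ 3 = 1) (hη0 : Tendsto η l (𝓝 0)) :
    ∃ u : ℝ → ℝ, HM u ∧ (∀ x, Tendsto (fun i => rho (t i) (nn (t i) (η i) x) / η i) 𝒰 (𝓝 (u x))) ∧
      ∃ S : ℝ, ∀ x, S ≤ x → 0 < (Ai x).re ∧ (Ai x).re ≤ 6 * Real.exp 3 * Real.exp (-x) := by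
  obtain ⟨u, p, hlu, hlp, hu, hp⟩ := exists_limit 𝒰 hη hη1 hte (hη0.mono_left h𝒰)
  have hX := fun x => (nn_tendsto hη hte hη0 x)
  have hJ : ∀ x, Tendsto (fun i => JJ (t i) (nn (t i) (η i) x) / η i) 𝒰 (𝓝 (Ai x).re) := fun x =>
    ((Complex.continuous_re.tendsto _).comp (J_airy hη hte hη0 (hX x))).mono_left h𝒰
  have hge : ∀ x, 0 < x → ∀ᶠ i in (𝒰 : Filter ι), 2 * t i ≤ nn (t i) (η i) x := by
    intro x hx
    filter_upwards [h𝒰 ((hX x).eventually (lt_mem_nhds hx))] with i hi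
    have := (mul_pos_iff_of_pos_right (hη i)).1 hi
    linarith
  have a0 : ∀ x, 0 < x → 0 ≤ u x := fun x hx => by
    refine ge_of_tendsto (hlu x) ?_
    filter_upwards [hge x hx] with i hi
    exact div_nonneg (rho_pos_anti (hη i) (hte i) _ hi).1.le (hη i).le
  have a1 : ∀ x, 0 < x → (Ai x).re ≤ u x := fun x hx => by
    refine le_of_tendsto_of_tendsto (hJ x) (hlu x) ?_
    filter_upwards [hge x hx] with i hi
    exact div_le_div_of_nonneg_right (J_le_rho (hη i) (hte i) _ hi) (hη i).le
  have a2 : ∀ x, 0 < x → (1 - CA * Real.exp (-(2 * x))) * u x ≤ (Ai x).re := fun x hx => by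
    have hc : Tendsto (fun i => (1 - CA * Real.exp (-(2 * ((nn (t i) (η i) x - 2 * t i) * η i)))) *
        (rho (t i) (nn (t i) (η i) x) / η i)) 𝒰 (𝓝 ((1 - CA * Real.exp (-(2 * x))) * u x)) := by
      refine Tendsto.mul ?_ (hlu x)
      have hcon : Continuous fun X : ℝ => 1 - CA * Real.exp (-(2 * X)) := by fun_prop
      exact (hcon.tendsto x).comp ((hX x).mono_left h𝒰)
    refine le_of_tendsto_of_tendsto hc (hJ x) ?_
    filter_upwards [hge x hx] with i hi
    rw [← mul_div_assoc]
    exact div_le_div_of_nonneg_right (rho_le_J (hη i) (hη1 i) (hte i) _ hi) (hη i).le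
  have a3 : (Ai 0).re ≤ u 0 := by
    have hX1 : Tendsto (fun i => (((nn (t i) (η i) 0 + 1 : ℕ) : ℝ) - 2 * t i) * η i) l (𝓝 0) := by
      have := (hX 0).add hη0
      rw [add_zero] at this
      refine this.congr fun i => ?_
      push_cast; ring
    have hJ1 := ((Complex.continuous_re.tendsto _).comp (J_airy hη hte hη0 hX1)).mono_left h𝒰
    have hr1 : Tendsto (fun i => rho (t i) (nn (t i) (η i) 0 + 1) / η i) 𝒰 (𝓝 (u 0)) := by
      have := (hlu 0).add ((hη0.mono_left h𝒰).mul (hlp 0))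
      rw [zero_mul, add_zero] at this
      refine this.congr fun i => ?_
      have := (hη i).ne'
      field_simp
      ring
    refine le_of_tendsto_of_tendsto hJ1 hr1 ?_
    filter_upwards [h𝒰 (nn_ev hη0 0)] with i hi
    have hb := (nn_bounds (hη i) (hte i) hi).1
    refine div_le_div_of_nonneg_right (J_le_rho (hη i) (hte i) _ ?_) (hη i).le
    have : 0 < (((nn (t i) (η i) 0 + 1 : ℕ) : ℝ) - 2 * t i) * η i := by push_cast; linarith
    have := (mul_pos_iff_of_pos_right (hη i)).1 this
    linarith
  have a4 : ∀ x, 0 < x → u x ≤ 6 * Real.exp 3 * Real.exp (-x) := fun x hx => by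
    have hc : Tendsto (fun i => 6 * Real.exp 3 * Real.exp (-((nn (t i) (η i) x - 2 * t i) * η i)))
        𝒰 (𝓝 (6 * Real.exp 3 * Real.exp (-x))) := by
      have hcon : Continuous fun X : ℝ => 6 * Real.exp 3 * Real.exp (-X) := by fun_prop
      exact (hcon.tendsto x).comp ((hX x).mono_left h𝒰)
    refine le_of_tendsto_of_tendsto (hlu x) hc ?_
    filter_upwards [hge x hx] with i hi
    have h0 := (hη i).le
    have := rho_bound (hη i) (hη1 i) (hte i) le_rfl (by nlinarith [hη1 i]) (nn (t i) (η i) x)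
      (by rw [neg_zero]; exact mul_nonneg (by linarith) h0)
    rw [div_le_iff₀ (hη i)]
    have h2 := le_abs_self (rho (t i) (nn (t i) (η i) x))
    linarith
  have hpos := pos_of_ode hu hp a0 (Ai_zero_pos.trans_le a3)
  obtain ⟨S, hS0, hS⟩ := CA_ev
  have hA : ∀ x, S ≤ x → 0 < (Ai x).re := fun x hx => by
    have h1 := hpos x (by linarith)
    have h2 := hS x hx
    exact (mul_pos (by linarith) h1).trans_le (a2 x (by linarith))
  refine ⟨u, ⟨fun s => (hu s).differentiableAt, ?_, ?_⟩, hlu, S, fun x hx => ⟨hA x hx, (a1 x (by linarith)).trans (a4 x (by linarith))⟩⟩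
  · have : deriv u = p := funext fun s => (hu s).deriv
    rw [this]; exact hp
  · have hr : Tendsto (fun s => u s / (Ai s).re) atTop (𝓝 1) := by
      have hc : Tendsto (fun x : ℝ => (1 - CA * Real.exp (-(2 * x)))⁻¹) atTop (𝓝 1) := by
        have h : Tendsto (fun x : ℝ => 2 * x) atTop atTop := tendsto_id.const_mul_atTop two_pos
        have h2 := ((Real.tendsto_exp_neg_atTop_nhds_zero.comp h).const_mul CA).const_sub 1
        have h3 := h2.inv₀ (by norm_num)
        simpa [Function.comp_def] using h3
      refine tendsto_of_tendsto_of_tendsto_of_le_of_le' tendsto_const_nhds hc ?_ ?_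
      · filter_upwards [eventually_ge_atTop S] with x hx
        rw [le_div_iff₀ (hA x hx), one_mul]
        exact a1 x (by linarith)
      · filter_upwards [eventually_ge_atTop S] with x hx
        have := hS x hx
        rw [div_le_iff₀ (hA x hx), inv_mul_eq_div, le_div_iff₀ (by linarith)]
        linarith [a2 x (by linarith)]
    have := (Complex.continuous_ofReal.tendsto _).comp hr
    refine this.congr fun s => ?_
    simp only [Function.comp_apply]
    rw [ofReal_div, ← Ai_real]

end BDJ

namespace BDJ

lemma mono_Ici {f f' : ℝ → ℝ} {S : ℝ} (h : ∀ x, S ≤ x → HasDerivAt f (f' x) x)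
    (h0 : ∀ x, S ≤ x → 0 ≤ f' x) : MonotoneOn f (Set.Ici S) := by
  refine monotoneOn_of_deriv_nonneg (convex_Ici S) (fun y hy => (h y hy).continuousAt.continuousWithinAt)
    (fun y hy => ?_) fun y hy => ?_
  · exact (h y (interior_subset hy)).differentiableAt.differentiableWithinAt
  · rw [(h y (interior_subset hy)).deriv]; exact h0 y (interior_subset hy)

lemma Ai_facts : ∃ S : ℝ, ∀ x, S ≤ x → 0 < (Ai x).re ∧ (Ai x).re ≤ 6 * Real.exp 3 * Real.exp (-x) := by
  obtain ⟨u, -, -, h⟩ := exists_HM (Ultrafilter.of atTop) (Ultrafilter.of_le atTop) et_pos et_half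
    tk_et et_tendsto
  exact h

lemma HM.ratio {u : ℝ → ℝ} (hu : HM u) : Tendsto (fun s => u s / (Ai s).re) atTop (𝓝 1) := by
  have := (Complex.continuous_re.tendsto _).comp hu.2.2
  refine this.congr fun s => ?_
  simp only [Function.comp_apply]
  rw [Ai_real, ← ofReal_div, ofReal_re, ofReal_re]

lemma HM.facts {u : ℝ → ℝ} (hu : HM u) : ∃ S : ℝ, 0 ≤ S ∧ ∀ s, S ≤ s → 0 < u s ∧ deriv u s ≤ 0 ∧
    u s ^ 2 ≤ Real.exp (-s) / 8 := by
  obtain ⟨S, hS⟩ := Ai_facts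
  set C : ℝ := 6 * Real.exp 3 with hC
  have hCp : 0 < C := by positivity
  have h0 := hu.ratio.eventually (lt_mem_nhds (by norm_num : (0 : ℝ) < 1))
  have h2 := hu.ratio.eventually (gt_mem_nhds (by norm_num : (1 : ℝ) < 2))
  have he : ∀ᶠ s : ℝ in atTop, 32 * C ^ 2 * Real.exp (-s) < 1 := by
    have := Real.tendsto_exp_neg_atTop_nhds_zero.const_mul (32 * C ^ 2)
    rw [mul_zero] at this
    exact this.eventually (gt_mem_nhds one_pos)
  obtain ⟨S1, h⟩ := eventually_atTop.1 (h0.and (h2.and (he.and (eventually_ge_atTop S))))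
  have key : ∀ s, max S1 0 ≤ s → 0 < u s ∧ u s ^ 2 ≤ Real.exp (-s) / 8 := by
    intro s hs
    obtain ⟨a, b, c, d⟩ := h s ((le_max_left _ _).trans hs)
    obtain ⟨e, f⟩ := hS s d
    have hp : 0 < u s := by
      have := mul_pos a e
      rwa [div_mul_cancel₀ _ e.ne'] at this
    refine ⟨hp, ?_⟩
    rw [div_lt_iff₀ e] at b
    have h5 : u s ≤ 2 * (C * Real.exp (-s)) := by linarith
    have h6 := pow_le_pow_left₀ hp.le h5 2
    have h7 := mul_le_mul_of_nonneg_right c.le (Real.exp_pos (-s)).le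
    nlinarith
  refine ⟨max S1 0, le_max_right _ _, fun s hs => ⟨(key s hs).1, ?_, (key s hs).2⟩⟩
  by_contra hcon
  push Not at hcon
  have m1 := mono_Ici (S := s) (fun x _ => hu.2.1 x) fun x hx => by
    have := (key x (hs.trans hx)).1
    have : 0 ≤ x := (le_max_right _ _).trans (hs.trans hx)
    positivity
  have m2 := mono_Ici (S := s) (fun x _ => (hu.1 x).hasDerivAt) fun x hx =>
    hcon.le.trans (m1 Set.self_mem_Ici hx hx)
  have hlim : Tendsto (fun x : ℝ => Real.exp (-x) / 8) atTop (𝓝 0) := by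
    simpa using Real.tendsto_exp_neg_atTop_nhds_zero.div_const 8
  have : u s ^ 2 ≤ 0 := by
    refine ge_of_tendsto hlim ?_
    filter_upwards [eventually_ge_atTop s] with x hx
    exact (pow_le_pow_left₀ (key s hs).1.le (m2 Set.self_mem_Ici hx hx) 2).trans (key x (hs.trans hx)).2
  have := pow_pos (key s hs).1 2
  linarith

lemma HM.div {u v : ℝ → ℝ} (hu : HM u) (hv : HM v) : Tendsto (fun s => v s / u s) atTop (𝓝 1) := by
  have := hv.ratio.div hu.ratio one_ne_zero
  rw [div_one] at this
  obtain ⟨S, hS⟩ := Ai_facts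
  refine this.congr' ?_
  filter_upwards [eventually_ge_atTop S] with s hs
  simp only [Pi.div_apply]
  rw [div_div_div_cancel_right₀ (hS s hs).1.ne']

lemma hm_case {u v : ℝ → ℝ} (hu : HM u) (hv : HM v) {S : ℝ} (hS : 0 ≤ S)
    (fu : ∀ s, S ≤ s → 0 < u s ∧ deriv u s ≤ 0 ∧ u s ^ 2 ≤ Real.exp (-s) / 8)
    (fv : ∀ s, S ≤ s → 0 < v s ∧ deriv v s ≤ 0 ∧ v s ^ 2 ≤ Real.exp (-s) / 8)
    (hlt : ∀ s, S ≤ s → u s < v s) : False := by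
  have he : ∀ s : ℝ, HasDerivAt (fun s => Real.exp (-s)) (-Real.exp (-s)) s := fun s => by
    simpa using (hasDerivAt_neg s).exp
  set Q : ℝ → ℝ := fun s => (deriv v s * u s - v s * deriv u s) * (1 + Real.exp (-s)) +
    u s * (v s - u s) * Real.exp (-s) with hQ
  set G : ℝ → ℝ := fun s => (v s / u s - 1) / (1 + Real.exp (-s)) with hG
  have dQ : ∀ s, HasDerivAt Q ((v s - u s) * (2 * u s * v s * (v s + u s) * (1 + Real.exp (-s)) +
      2 * deriv u s * Real.exp (-s) - u s * Real.exp (-s))) s := by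
    intro s
    have h1 := (hu.1 s).hasDerivAt
    have h2 := (hv.1 s).hasDerivAt
    refine (((((hv.2.1 s).mul h1).sub (h2.mul (hu.2.1 s))).mul ((he s).const_add 1)).add
      ((h1.mul (h2.sub h1)).mul (he s))).congr_deriv ?_
    simp only [Pi.sub_apply, Pi.mul_apply]
    ring
  have dG : ∀ s, S ≤ s → HasDerivAt G (Q s / (u s ^ 2 * (1 + Real.exp (-s)) ^ 2)) s := by
    intro s hs
    have h1 := (hu.1 s).hasDerivAt
    have h2 := (hv.1 s).hasDerivAt
    have hp := (fu s hs).1.ne'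
    have hb : 1 + Real.exp (-s) ≠ 0 := by positivity
    refine (((h2.div h1 hp).sub_const 1).div ((he s).const_add 1) hb).congr_deriv ?_
    simp only [hQ, Pi.div_apply]
    field_simp
    ring
  have he1 : ∀ s, S ≤ s → Real.exp (-s) ≤ 1 := fun s hs => Real.exp_le_one_iff.2 (by linarith)
  have aQ := mono_Ici (S := S) (fun s _ => (dQ s).neg) fun s hs => by
    obtain ⟨a1, a2, a3⟩ := fu s hs
    obtain ⟨b1, b2, b3⟩ := fv s hs
    have e0 := Real.exp_pos (-s)
    have e1 := he1 s hs
    have h1 : v s * (v s + u s) ≤ Real.exp (-s) / 4 := by nlinarith [sq_nonneg (v s - u s)]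
    have h2 : v s * (v s + u s) * (1 + Real.exp (-s)) ≤ Real.exp (-s) / 4 * 2 :=
      mul_le_mul h1 (by linarith) (by positivity) (by positivity)
    have h3 := mul_le_mul_of_nonneg_left h2 a1.le
    have h4 := mul_nonneg (neg_nonneg.2 a2) e0.le
    rw [← mul_neg]
    exact mul_nonneg (by linarith [hlt s hs]) (by nlinarith)
  have Gpos : ∀ s, S ≤ s → 0 < G s := fun s hs => by
    have hp := (fu s hs).1
    have : 1 < v s / u s := by rw [lt_div_iff₀ hp, one_mul]; exact hlt s hs
    exact div_pos (by linarith) (by positivity)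
  have Qpos : ∀ s, S ≤ s → 0 ≤ Q s := by
    intro s hs
    by_contra hc
    push Not at hc
    have hm := mono_Ici (S := s) (fun x hx => ((hasDerivAt_id x).const_mul (Q s)).sub
        (dG x (hs.trans hx))) fun x hx => by
      have h1 := aQ hs (hs.trans hx) hx
      simp only [Pi.neg_apply, neg_le_neg_iff] at h1
      have h2 := (fu x (hs.trans hx)).2.2
      have h3 := he1 x (hs.trans hx)
      have hp := (fu x (hs.trans hx)).1
      have h4 : u x ^ 2 * (1 + Real.exp (-x)) ^ 2 ≤ 1 := by
        have : (1 + Real.exp (-x)) ^ 2 ≤ 2 ^ 2 := pow_le_pow_left₀ (by positivity) (by linarith) 2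
        nlinarith [mul_le_mul h2 this (by positivity) (by positivity)]
      have h5 : Q x / (u x ^ 2 * (1 + Real.exp (-x)) ^ 2) ≤ Q x := by
        rw [div_le_iff₀ (by positivity)]
        nlinarith
      linarith
    have hy : s ≤ s + G s / -Q s := by
      have := div_pos (Gpos s hs) (neg_pos.2 hc)
      linarith
    have := hm Set.self_mem_Ici hy hy
    have h2 := Gpos _ (hs.trans hy)
    simp only [Pi.sub_apply, id] at this
    have h3 : Q s * (s + G s / -Q s) = Q s * s - G s := by have := hc.ne; field_simp; ring
    linarith
  have mG := mono_Ici dG fun s hs => div_nonneg (Qpos s hs) (by positivity)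
  have lG : Tendsto G atTop (𝓝 0) := by
    have := ((hu.div hv).sub_const 1).div (Real.tendsto_exp_neg_atTop_nhds_zero.const_add 1) (by norm_num)
    norm_num at this
    exact this
  have : G S ≤ 0 := by
    refine ge_of_tendsto lG ?_
    filter_upwards [eventually_ge_atTop S] with s hs
    exact mG Set.self_mem_Ici hs hs
  linarith [Gpos S le_rfl]

lemma HM.unique {u v : ℝ → ℝ} (hu : HM u) (hv : HM v) : v = u := by
  obtain ⟨S1, h1, fu⟩ := hu.facts
  obtain ⟨S2, -, fv⟩ := hv.facts
  have cu : Continuous u := continuous_iff_continuousAt.2 fun x => (hu.1 x).continuousAt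
  have cv : Continuous v := continuous_iff_continuousAt.2 fun x => (hv.1 x).continuousAt
  set S := max S1 S2 with hS
  replace fu := fun s (hs : S ≤ s) => fu s ((le_max_left _ _).trans hs)
  replace fv := fun s (hs : S ≤ s) => fv s ((le_max_right _ _).trans hs)
  replace h1 : 0 ≤ S := h1.trans (le_max_left _ _)
  by_cases hz : ∃ s, S ≤ s ∧ v s = u s
  · obtain ⟨a, ha, hva⟩ := hz
    set z : ℝ → ℝ := fun s => v s / u s - 1 with hzd
    set W : ℝ → ℝ := fun s => deriv v s * u s - v s * deriv u s with hW
    have dz : ∀ s, a ≤ s → HasDerivAt z (W s / u s ^ 2) s := fun s hs =>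
      ((hv.1 s).hasDerivAt.div (hu.1 s).hasDerivAt (fu s (ha.trans hs)).1.ne').sub_const 1
    have dW : ∀ s, HasDerivAt W (2 * u s * v s * (v s ^ 2 - u s ^ 2)) s := fun s => by
      refine (((hv.2.1 s).mul (hu.1 s).hasDerivAt).sub ((hv.1 s).hasDerivAt.mul (hu.2.1 s))).congr_deriv ?_
      ring
    have za : z a = 0 := by simp [hzd, hva, (fu a ha).1.ne']
    have m1 := mono_Ici (S := a) (fun s hs => (dz s hs).mul (dW s)) fun s hs => by
      have hp := (fu s (ha.trans hs)).1
      have hq := (fv s (ha.trans hs)).1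
      have e : W s / u s ^ 2 * W s + z s * (2 * u s * v s * (v s ^ 2 - u s ^ 2)) =
          (W s / u s) ^ 2 + 2 * v s * (v s + u s) * (v s - u s) ^ 2 := by
        simp only [hzd]; field_simp; ring
      rw [e]; positivity
    have m2 := mono_Ici (S := a) (fun s hs => (dz s hs).pow 2) fun s hs => by
      have := m1 Set.self_mem_Ici hs hs
      simp only [Pi.mul_apply, za, zero_mul] at this
      have e : (2 : ℕ) * z s ^ (2 - 1) * (W s / u s ^ 2) = 2 * (z s * W s) / u s ^ 2 := by
        norm_num; ring
      rw [e]
      positivity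
    have lz : Tendsto (z ^ 2) atTop (𝓝 0) := by
      have := ((hu.div hv).sub_const 1).pow 2
      norm_num at this
      exact this
    have z0 : ∀ s, a ≤ s → v s = u s := fun s hs => by
      have h3 : (z ^ 2) s ≤ 0 := by
        refine ge_of_tendsto lz ?_
        filter_upwards [eventually_ge_atTop s] with x hx
        exact m2 hs (hs.trans hx) hx
      have h4 : z s = 0 := pow_eq_zero_iff two_ne_zero |>.1 (le_antisymm h3 (sq_nonneg _))
      simp only [hzd, sub_eq_zero] at h4
      rwa [div_eq_one_iff_eq (fu s (ha.trans hs)).1.ne'] at h4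
    ext x
    rcases le_total a x with hx | hx
    · exact z0 x hx
    · have hd : deriv v (a + 1) = deriv u (a + 1) := by
        refine Filter.EventuallyEq.deriv_eq ?_
        filter_upwards [lt_mem_nhds (lt_add_one a)] with s hs using z0 s hs.le
      have := lin_ode (w := fun s => v s - u s) (r := fun s => deriv v s - deriv u s)
        (c := fun s => s + 2 * (v s ^ 2 + v s * u s + u s ^ 2)) (a := x) (x := a + 1)
        (fun s => (hv.1 s).hasDerivAt.sub (hu.1 s).hasDerivAt)
        (fun s => ((hv.2.1 s).sub (hu.2.1 s)).congr_deriv (by ring)) (by fun_prop)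
        (by linarith) (sub_eq_zero.2 (z0 _ (by linarith))) (sub_eq_zero.2 hd)
      exact sub_eq_zero.1 this
  · exfalso
    push Not at hz
    have hsg : ∀ f g : ℝ → ℝ, Continuous f → Continuous g → (∀ s, S ≤ s → f s ≠ g s) → f S < g S →
        ∀ s, S ≤ s → f s < g s := by
      intro f g hf hg hne h0 s hs
      by_contra hc
      have := intermediate_value_Icc hs (f := fun x => f x - g x) (by fun_prop)
      obtain ⟨y, hy, hy2⟩ := this (⟨by linarith, by linarith⟩ : (0 : ℝ) ∈ Set.Icc (f S - g S) (f s - g s))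
      exact hne y hy.1 (sub_eq_zero.1 hy2)
    rcases lt_or_gt_of_ne (hz S le_rfl) with h | h
    · exact hm_case hv hu h1 fv fu (hsg v u cv cu hz h)
    · exact hm_case hu hv h1 fu fv (hsg u v cu cv (fun s hs => (hz s hs).symm) h)

end BDJ

namespace BDJ

lemma sum_L {L a : ℕ → ℝ} (h : ∀ m, L (m + 2) - 2 * L (m + 1) + L m = a (m + 1))
    (ha : ∀ m, a (m + 1) ≤ 0) (hL : Tendsto L atTop (𝓝 0)) (n : ℕ)
    (hs : Summable fun m => ((m - n : ℕ) : ℝ) * a m) : ∑' m, ((m - n : ℕ) : ℝ) * a m = L n := by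
  set d : ℕ → ℝ := fun m => L (m + 1) - L m with hd
  have dd : ∀ m, d (m + 1) = d m + a (m + 1) := fun m => by simp only [hd]; linarith [h m]
  have da : Antitone d := antitone_nat_of_succ_le fun m => by linarith [ha m, dd m]
  have d0 : ∀ m, 0 ≤ d m := da.le_of_tendsto (by simpa using (hL.comp (tendsto_add_atTop_nat 1)).sub hL)
  have hk : ∀ m k : ℕ, k * d (m + k) ≤ L (m + k) - L m := by
    intro m k
    induction k with
    | zero => simp
    | succ k ih =>
      have h1 : d (m + (k + 1)) ≤ d (m + k) := da (by omega)
      have h2 : L (m + (k + 1)) - L (m + k) = d (m + k) := rfl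
      have := mul_le_mul_of_nonneg_left h1 (Nat.cast_nonneg (α := ℝ) (k + 1))
      push_cast at this ⊢
      linarith
  have hp : ∀ k, ∑ m ∈ Finset.range (n + 1 + k), ((m - n : ℕ) : ℝ) * a m =
      L n - L (n + k) + k * d (n + k) := by
    intro k
    induction k with
    | zero =>
      rw [Finset.sum_eq_zero]
      · simp
      · intro m hm
        have : m - n = 0 := by have := Finset.mem_range.1 hm; omega
        simp [this]
    | succ k ih =>
      have e : n + 1 + k - n = k + 1 := by omega
      rw [← add_assoc, Finset.sum_range_succ, ih, e, show n + (k + 1) = n + k + 1 by ring, dd,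
        show n + 1 + k = n + k + 1 by ring]
      have h2 : L (n + k + 1) - L (n + k) = d (n + k) := rfl
      push_cast
      linarith
  have l1 : Tendsto (fun k : ℕ => L (n + 2 * k)) atTop (𝓝 0) :=
    hL.comp (tendsto_atTop_mono (fun k => by simp only [id]; omega) tendsto_id)
  have l2 : Tendsto (fun k : ℕ => L (n + k)) atTop (𝓝 0) :=
    hL.comp (tendsto_atTop_mono (fun k => by simp only [id]; omega) tendsto_id)
  have l3 : Tendsto (fun k : ℕ => ((2 * k : ℕ) : ℝ) * d (n + 2 * k)) atTop (𝓝 0) := by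
    refine squeeze_zero (fun k => mul_nonneg (Nat.cast_nonneg _) (d0 _))
      (g := fun k => 2 * (L (n + 2 * k) - L (n + k))) (fun k => ?_) (by simpa using (l1.sub l2).const_mul 2)
    have := hk (n + k) k
    rw [add_assoc, ← two_mul] at this
    push_cast
    linarith
  have l4 : Tendsto (fun k : ℕ => ∑ m ∈ Finset.range (n + 1 + 2 * k), ((m - n : ℕ) : ℝ) * a m) atTop
      (𝓝 (L n)) := by
    simp only [hp]
    simpa using (l1.const_sub (L n)).add l3
  exact tendsto_nhds_unique (hs.hasSum.tendsto_sum_nat.comp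
    (tendsto_atTop_mono (fun k => by simp only [id]; omega) tendsto_id : Tendsto (fun k => n + 1 + 2 * k) atTop atTop)) l4

lemma floor_int {f : ℕ → ℝ} (h0 : f 0 = 0) (hi : Integrable fun y : ℝ => f ⌊y⌋₊) :
    HasSum f (∫ y : ℝ, f ⌊y⌋₊) := by
  have hU : (⋃ m : ℕ, Set.Ico (m : ℝ) (m + 1)) = Set.Ici 0 := by
    ext y
    simp only [Set.mem_iUnion, Set.mem_Ico, Set.mem_Ici]
    exact ⟨fun ⟨m, h, _⟩ => (Nat.cast_nonneg m).trans h,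
      fun h => ⟨⌊y⌋₊, Nat.floor_le h, Nat.lt_floor_add_one y⟩⟩
  have hfl : ∀ m : ℕ, ∀ y ∈ Set.Ico (m : ℝ) (m + 1), ⌊y⌋₊ = m := fun m y hy =>
    (Nat.floor_eq_iff ((Nat.cast_nonneg m).trans hy.1)).2 hy
  have := hasSum_integral_iUnion (f := fun y : ℝ => f ⌊y⌋₊) (μ := volume)
    (s := fun m : ℕ => Set.Ico (m : ℝ) (m + 1)) (fun m => measurableSet_Ico) (fun m k hmk => by
      refine Set.disjoint_left.2 fun y hy hy2 => hmk ?_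
      rw [← hfl m y hy, ← hfl k y hy2]) hi.integrableOn
  rw [hU, setIntegral_eq_integral_of_forall_compl_eq_zero (fun y hy => by
    rw [Nat.floor_of_nonpos (not_le.1 hy).le, h0])] at this
  have e : (fun m : ℕ => ∫ y in Set.Ico (m : ℝ) (m + 1), f ⌊y⌋₊) = f := by
    ext m
    rw [setIntegral_congr_fun measurableSet_Ico (g := fun _ => f m) (fun y hy => by simp only [hfl m y hy])]
    simp
  rwa [e] at this

noncomputable def al (t : ℝ) (m : ℕ) : ℝ := Real.log (1 - rho t m ^ 2)
noncomputable def Phi (t η : ℝ) (n : ℕ) (s : ℝ) : ℝ := ((nn t η s - n : ℕ) : ℝ) * al t (nn t η s) / η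

lemma log_bd {r : ℝ} (h1 : r < 1) : -r / (1 - r) ≤ Real.log (1 - r) ∧ Real.log (1 - r) ≤ -r := by
  have h2 : 0 < 1 - r := by linarith
  have := Real.one_sub_inv_le_log_of_pos h2
  have h3 := Real.log_le_sub_one_of_pos h2
  refine ⟨?_, by linarith⟩
  have e : -r / (1 - r) = 1 - (1 - r)⁻¹ := by field_simp; ring
  rw [e]; exact this

section
variable {t η K : ℝ} {n : ℕ}

lemma Phi_meas : Measurable (Phi t η n) := by
  have h : Measurable fun s => nn t η s := Nat.measurable_floor.comp (by fun_prop)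
  exact (Measurable.comp (g := fun m : ℕ => ((m - n : ℕ) : ℝ) * al t m / η) measurable_from_nat h)

lemma Phi_bound (hη : 0 < η) (hη1 : η ≤ 1 / 2) (hte : t * η ^ 3 = 1) (hK : 0 ≤ K)
    (hK2 : (K + 1) * η ^ 2 ≤ 2) (hK3 : (K + 6) * Real.exp 3 * Real.exp K * η ≤ 1 / 2)
    (hn : -K ≤ (n - 2 * t) * η) (s : ℝ) : ‖Phi t η n s‖ ≤ (Set.Ioi (-K)).indicator
      (fun s => 2 * ((K + 6) * Real.exp 3) ^ 2 * Real.exp (K + 1) * Real.exp (-s)) s := by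
  set m := nn t η s with hm
  set C := (K + 6) * Real.exp 3 with hC
  have hC0 : 0 < C := by positivity
  rcases le_or_gt m n with hmn | hmn
  · have : Phi t η n s = 0 := by simp [Phi, ← hm, Nat.sub_eq_zero_of_le hmn]
    rw [this, norm_zero]
    exact Set.indicator_nonneg (fun s _ => by positivity) s
  · have hpos : 0 ≤ 2 + s * η ^ 2 := by
      have h1 : 0 < 2 * t + s / η := Nat.pos_of_floor_pos (by rw [← nn, ← hm]; omega)
      have e : (2 * t + s / η) * η ^ 3 = 2 + s * η ^ 2 := by
        field_simp; linear_combination 2 * hte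
      rw [← e]; positivity
    obtain ⟨b1, b2⟩ := nn_bounds hη hte hpos
    rw [← hm] at b1 b2
    set X := ((m : ℝ) - 2 * t) * η with hX
    have hmn' : (n : ℝ) < m := by exact_mod_cast hmn
    have hXn : ((n : ℝ) - 2 * t) * η < X := mul_lt_mul_of_pos_right (by linarith) hη
    have hr := rho_bound hη hη1 hte hK hK2 m (by linarith)
    rw [← hX, ← hC] at hr
    have hr2 : C * η * Real.exp (-X) ≤ 1 / 2 := by
      refine le_trans ?_ hK3
      rw [mul_right_comm]
      gcongr
      linarith
    have hq : rho t m ^ 2 ≤ (C * η * Real.exp (-X)) ^ 2 := by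
      rw [← sq_abs]; exact pow_le_pow_left₀ (abs_nonneg _) hr 2
    have hq2 : rho t m ^ 2 ≤ 1 / 2 := by
      have := pow_le_pow_left₀ (by positivity) hr2 2
      linarith
    obtain ⟨l1, l2⟩ := log_bd (show rho t m ^ 2 < 1 by linarith)
    have l3 : |al t m| ≤ 2 * (C * η * Real.exp (-X)) ^ 2 := by
      have h5 : -(2 * rho t m ^ 2) ≤ -rho t m ^ 2 / (1 - rho t m ^ 2) := by
        rw [le_div_iff₀ (by linarith)]
        nlinarith [sq_nonneg (rho t m)]
      have h6 := sq_nonneg (rho t m)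
      exact abs_le.2 ⟨by unfold al; linarith, by unfold al; linarith [sq_nonneg (C * η * Real.exp (-X))]⟩
    rw [Set.indicator_of_mem (show s ∈ Set.Ioi (-K) by simp only [Set.mem_Ioi]; linarith)]
    have h7 : ((m - n : ℕ) : ℝ) ≤ Real.exp (X + K) / η := by
      rw [Nat.cast_sub hmn.le, le_div_iff₀ hη]
      have := Real.add_one_le_exp (X + K)
      have : ((m : ℝ) - n) * η = X - ((n : ℝ) - 2 * t) * η := by rw [hX]; ring
      linarith
    unfold Phi
    rw [← hm, norm_div, norm_mul, Real.norm_eq_abs, Real.norm_eq_abs, Real.norm_eq_abs, abs_of_pos hη,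
      Nat.abs_cast]
    calc ((m - n : ℕ) : ℝ) * |al t m| / η
        ≤ Real.exp (X + K) / η * (2 * (C * η * Real.exp (-X)) ^ 2) / η := by gcongr
      _ = 2 * C ^ 2 * Real.exp (K - X) := by
        have : Real.exp (X + K) * Real.exp (-X) ^ 2 = Real.exp (K - X) := by
          rw [← Real.exp_nat_mul, ← Real.exp_add]; congr 1; push_cast; ring
        rw [← this]
        field_simp
      _ ≤ 2 * C ^ 2 * Real.exp (K + 1) * Real.exp (-s) := by
        rw [mul_assoc (2 * C ^ 2), ← Real.exp_add]
        gcongr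
        linarith

lemma bd_int (C : ℝ) : Integrable ((Set.Ioi (-K)).indicator (fun s => C * Real.exp (-s))) := by
  rw [integrable_indicator_iff measurableSet_Ioi]
  exact (integrableOn_exp_neg_Ioi (-K)).const_mul C

lemma Phi_int (hη : 0 < η) (hη1 : η ≤ 1 / 2) (hte : t * η ^ 3 = 1) (hK : 0 ≤ K)
    (hK2 : (K + 1) * η ^ 2 ≤ 2) (hK3 : (K + 6) * Real.exp 3 * Real.exp K * η ≤ 1 / 2)
    (hn : -K ≤ (n - 2 * t) * η) : ∫ s, Phi t η n s = Real.log (D n t) - t ^ 2 := by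
  have ht := t_pos hη hte
  have hi : Integrable (Phi t η n) := Integrable.mono' (bd_int _) Phi_meas.aestronglyMeasurable
    (ae_of_all _ (Phi_bound hη hη1 hte hK hK2 hK3 hn))
  set F : ℕ → ℝ := fun m => ((m - n : ℕ) : ℝ) * al t m with hF
  have hFi : Integrable fun y : ℝ => F ⌊y⌋₊ := by
    refine (((hi.comp_mul_right' hη.ne').comp_sub_right (2 * t)).const_mul η).congr (ae_of_all _ fun y => ?_)
    have e : 2 * t + (y - 2 * t) * η / η = y := by field_simp; ring
    simp only [Phi, nn, e, hF]
    field_simp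
  have hsum := floor_int (by simp [hF]) hFi
  have e1 : ∫ s, Phi t η n s = ∫ y : ℝ, F ⌊y⌋₊ := by
    have h1 := integral_add_left_eq_self (μ := volume) (fun y : ℝ => F ⌊y⌋₊) (2 * t)
    have h2 := Measure.integral_comp_div (fun y : ℝ => F ⌊2 * t + y⌋₊) η
    rw [h1, abs_of_pos hη, smul_eq_mul] at h2
    have h3 : ∀ s, Phi t η n s = η⁻¹ * F ⌊2 * t + s / η⌋₊ := fun s => by
      simp only [Phi, nn, hF]; ring
    simp only [h3]
    rw [integral_const_mul, h2, ← mul_assoc, inv_mul_cancel₀ hη.ne', one_mul]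
  rw [e1, ← hsum.tsum_eq]
  refine sum_L (L := fun n => Real.log (D n t) - t ^ 2) (a := al t) (fun m => ?_) (fun m => ?_) ?_ n hsum.summable
  · have h := congrArg Real.log (D_rec ht m)
    have h1 := rho_sq_lt ht m
    rw [Real.log_mul (D_pos _ _).ne' (D_pos _ _).ne', Real.log_mul (pow_pos (D_pos _ _) 2).ne' (by linarith),
      Real.log_pow] at h
    push_cast at h
    unfold al
    linarith
  · have := (log_bd (rho_sq_lt ht m)).2
    unfold al
    linarith [sq_nonneg (rho t (m + 1))]
  · have := ((Real.continuousAt_log (Real.exp_pos _).ne').tendsto.comp (D_tendsto t)).sub_const (t ^ 2)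
    simpa using this

end

section
variable {ι : Type*} {l : Filter ι} {η t : ι → ℝ}

lemma rho_lim [l.IsCountablyGenerated] {u : ℝ → ℝ} (hu : HM u)
    (hη : ∀ i, 0 < η i) (hη1 : ∀ i, η i ≤ 1 / 2) (hte : ∀ i, t i * η i ^ 3 = 1)
    (hη0 : Tendsto η l (𝓝 0)) (x : ℝ) :
    Tendsto (fun i => rho (t i) (nn (t i) (η i) x) / η i) l (𝓝 (u x)) := by
  rw [tendsto_iff_ultrafilter]
  intro 𝒰 h𝒰
  obtain ⟨v, hv, h, -⟩ := exists_HM 𝒰 h𝒰 hη hη1 hte hη0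
  rw [← hu.unique hv]
  exact h x

lemma log_lim [l.IsCountablyGenerated] {u : ℝ → ℝ} (hu : HM u)
    (hη : ∀ i, 0 < η i) (hη1 : ∀ i, η i ≤ 1 / 2) (hte : ∀ i, t i * η i ^ 3 = 1)
    (hη0 : Tendsto η l (𝓝 0)) {x : ℝ} {n : ι → ℕ}
    (hx : Tendsto (fun i => (n i - 2 * t i) * η i) l (𝓝 x)) :
    Tendsto (fun i => Real.log (D (n i) (t i)) - t i ^ 2) l (𝓝 (-∫ s in Set.Ioi x, (s - x) * u s ^ 2)) := by
  set K := |x| + 1 with hK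
  have hK0 : 0 ≤ K := by positivity
  have hxK : -K < x := by have := neg_abs_le x; linarith
  have hev : ∀ᶠ i in l, (K + 1) * η i ^ 2 ≤ 2 ∧ (K + 6) * Real.exp 3 * Real.exp K * η i ≤ 1 / 2 ∧
      -K ≤ (n i - 2 * t i) * η i := by
    have h1 := hη0.const_mul ((K + 6) * Real.exp 3 * Real.exp K)
    rw [mul_zero] at h1
    filter_upwards [K_ev hη0 K, h1.eventually (gt_mem_nhds (by norm_num : (0 : ℝ) < 1 / 2)),
      hx.eventually (lt_mem_nhds hxK)] with i a b c using ⟨a, b.le, c.le⟩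
  have e : -∫ s in Set.Ioi x, (s - x) * u s ^ 2 = ∫ s, max (s - x) 0 * -u s ^ 2 := by
    rw [← integral_neg, ← integral_indicator measurableSet_Ioi]
    congr 1; ext s
    by_cases hs : x < s
    · rw [Set.indicator_of_mem (by exact hs), max_eq_left (by linarith)]; ring
    · rw [Set.indicator_of_notMem (by exact hs), max_eq_right (by linarith)]; ring
  rw [e]
  have hmain : Tendsto (fun i => ∫ s, Phi (t i) (η i) (n i) s) l (𝓝 (∫ s, max (s - x) 0 * -u s ^ 2)) := by
    refine tendsto_integral_filter_of_dominated_convergence _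
      (Eventually.of_forall fun i => Phi_meas.aestronglyMeasurable)
      (hev.mono fun i hi => ae_of_all _ (Phi_bound (hη i) (hη1 i) (hte i) hK0 hi.1 hi.2.1 hi.2.2))
      (bd_int _) (ae_of_all _ fun s => ?_)
    have hr := rho_lim hu hη hη1 hte hη0 s
    have h1 : Tendsto (fun i => max ((nn (t i) (η i) s - 2 * t i) * η i - (n i - 2 * t i) * η i) 0) l
        (𝓝 (max (s - x) 0)) := ((nn_tendsto hη hte hη0 s).sub hx).max tendsto_const_nhds
    have hr0 : Tendsto (fun i => rho (t i) (nn (t i) (η i) s) ^ 2) l (𝓝 0) := by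
      have := (hr.mul hη0).pow 2
      rw [mul_zero, zero_pow two_ne_zero] at this
      refine this.congr fun i => ?_
      rw [div_mul_cancel₀ _ (hη i).ne']
    have h2 : Tendsto (fun i => al (t i) (nn (t i) (η i) s) / η i ^ 2) l (𝓝 (-u s ^ 2)) := by
      have h3 := (hr.pow 2).neg
      have h4 := h3.div (hr0.const_sub 1) (by norm_num)
      rw [sub_zero, div_one] at h4
      have h5 := hr0.eventually (gt_mem_nhds one_pos)
      refine tendsto_of_tendsto_of_tendsto_of_le_of_le' h4 h3 ?_ ?_
      · filter_upwards [h5] with i hi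
        have := div_le_div_of_nonneg_right (log_bd hi).1 (sq_nonneg (η i))
        refine le_trans (le_of_eq ?_) this
        simp only [Pi.div_apply, div_pow, neg_div]
        rw [div_right_comm]
      · filter_upwards [h5] with i hi
        have := div_le_div_of_nonneg_right (log_bd hi).2 (sq_nonneg (η i))
        rwa [neg_div, ← div_pow] at this
    refine (h1.mul h2).congr fun i => ?_
    have hi := hη i
    have h6 : max ((nn (t i) (η i) s - 2 * t i) * η i - (n i - 2 * t i) * η i) 0 =
        ((nn (t i) (η i) s - n i : ℕ) : ℝ) * η i := by
      rcases le_total (n i) (nn (t i) (η i) s) with h | h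
      · have h' : (n i : ℝ) ≤ nn (t i) (η i) s := by exact_mod_cast h
        rw [Nat.cast_sub h, max_eq_left (by nlinarith)]; ring
      · have h' : (nn (t i) (η i) s : ℝ) ≤ n i := by exact_mod_cast h
        rw [Nat.sub_eq_zero_of_le h, max_eq_right (by nlinarith)]; simp
    rw [h6]
    unfold Phi
    field_simp
  refine hmain.congr' ?_
  filter_upwards [hev] with i hi
  exact Phi_int (hη i) (hη1 i) (hte i) hK0 hi.1 hi.2.1 hi.2.2

end
end BDJ

namespace BDJ

lemma hs_congr {f g : ℕ → ℝ} {a b : ℝ} (h : HasSum f a) (e : ∀ N, g N = f N) (e2 : b = a) :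
    HasSum g b := by rw [e2, funext e]; exact h

lemma pois_shift {r S : ℝ} {g : ℕ → ℝ} (h : HasSum (fun N : ℕ => g (N + 1) * (r ^ N / N.factorial)) S) :
    HasSum (fun N : ℕ => N * g N * (r ^ N / N.factorial)) (r * S) := by
  rw [← hasSum_nat_add_iff' 1]
  simp only [Finset.range_one, Finset.sum_singleton, Nat.cast_zero, zero_mul, sub_zero]
  refine hs_congr (h.mul_left r) (fun N => ?_) rfl
  rw [Nat.factorial_succ]
  push_cast
  field_simp
  ring

lemma pois_sum (r : ℝ) : HasSum (fun N : ℕ => r ^ N / N.factorial) (Real.exp r) := by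
  rw [Real.exp_eq_exp_ℝ]; exact NormedSpace.expSeries_div_hasSum_exp r

lemma pois_var (r : ℝ) :
    HasSum (fun N : ℕ => (N - r) ^ 2 * (r ^ N / N.factorial)) (r * Real.exp r) := by
  have h0 := pois_sum r
  have h1 := pois_shift (g := fun _ => 1) (by simpa using h0)
  have h2 := pois_shift (g := fun N => N) (S := (r + 1) * Real.exp r) (by
    refine hs_congr (h1.add h0) (fun N => ?_) (by ring)
    push_cast; ring)
  exact hs_congr ((h2.sub (h1.mul_left (2 * r))).add (h0.mul_left (r ^ 2))) (fun N => by ring) (by ring)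

lemma pois_up {r : ℝ} (hr : 0 < r) {M n : ℕ} (h : r < M) :
    q M n ≤ Real.exp (-r) * D n (√r) + r / (M - r) ^ 2 := by
  have hM : 0 < (M - r) ^ 2 := by have : 0 < M - r := by linarith
                                  positivity
  have h1 := ((D_summable n r).hasSum).add ((pois_var r).mul_left ((M - r) ^ 2)⁻¹)
  have h2 := (pois_sum r).mul_left (q M n)
  have h3 := hasSum_le (fun N => ?_) h2 h1
  · have e : D n (√r) = ∑' N : ℕ, q N n * (r ^ N / N.factorial) := by
      unfold D; rw [Real.sq_sqrt hr.le]
    rw [e, Real.exp_neg]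
    have := Real.exp_pos r
    have h4 := mul_le_mul_of_nonneg_left h3 (inv_pos.2 this).le
    rw [mul_add, mul_comm (q M n), inv_mul_cancel_left₀ this.ne'] at h4
    refine h4.trans (le_of_eq ?_)
    field_simp
  · rw [← mul_assoc, ← add_mul]
    refine mul_le_mul_of_nonneg_right ?_ (by positivity)
    rcases le_total N M with hN | hN
    · have := q_anti n hN
      have h5 : 0 ≤ ((M - r) ^ 2)⁻¹ * ((N : ℝ) - r) ^ 2 := by positivity
      simp only at this
      linarith
    · have hN' : (M : ℝ) ≤ N := by exact_mod_cast hN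
      have h5 : 1 ≤ ((M - r) ^ 2)⁻¹ * ((N : ℝ) - r) ^ 2 := by
        rw [inv_mul_eq_div, one_le_div hM]
        exact pow_le_pow_left₀ (by linarith) (by linarith) 2
      linarith [q_le_one M n, q_nonneg N n]

lemma pois_dn {r : ℝ} {M n : ℕ} (h : (M : ℝ) < r) :
    Real.exp (-r) * D n (√r) ≤ q M n + r / (M - r) ^ 2 := by
  have hr : 0 < r := (Nat.cast_nonneg M).trans_lt h
  have hM : 0 < (M - r) ^ 2 := by have : M - r ≠ 0 := by linarith
                                  positivity
  have h1 := (D_summable n r).hasSum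
  have h2 := ((pois_sum r).mul_left (q M n)).add ((pois_var r).mul_left ((M - r) ^ 2)⁻¹)
  have h3 := hasSum_le (fun N => ?_) h1 h2
  · have e : D n (√r) = ∑' N : ℕ, q N n * (r ^ N / N.factorial) := by
      unfold D; rw [Real.sq_sqrt hr.le]
    rw [e, Real.exp_neg]
    have := Real.exp_pos r
    have h4 := mul_le_mul_of_nonneg_left h3 (inv_pos.2 this).le
    rw [mul_add, mul_comm (q M n), inv_mul_cancel_left₀ this.ne'] at h4
    refine h4.trans (le_of_eq ?_)
    field_simp
  · rw [← mul_assoc, ← add_mul]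
    refine mul_le_mul_of_nonneg_right ?_ (by positivity)
    rcases le_total M N with hN | hN
    · have := q_anti n hN
      have h5 : 0 ≤ ((M - r) ^ 2)⁻¹ * ((N : ℝ) - r) ^ 2 := by positivity
      simp only at this
      linarith
    · have hN' : (N : ℝ) ≤ M := by exact_mod_cast hN
      have h5 : 1 ≤ ((M - r) ^ 2)⁻¹ * ((N : ℝ) - r) ^ 2 := by
        rw [inv_mul_eq_div, one_le_div hM]
        nlinarith
      linarith [q_le_one N n, q_nonneg M n]

noncomputable def av (x : ℝ) (M : ℕ) : ℝ := 2 * √M + x * (M : ℝ) ^ ((1 : ℝ) / 6)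

lemma natpow {c : ℝ} (hc : 0 < c) : Tendsto (fun M : ℕ => (M : ℝ) ^ (-c)) atTop (𝓝 0) :=
  (tendsto_rpow_neg_atTop hc).comp tendsto_natCast_atTop_atTop

lemma av_pos (x : ℝ) : ∀ᶠ M : ℕ in atTop, 0 ≤ av x M := by
  have h1 := (natpow (c := 1 / 3) (by norm_num)).const_mul x
  rw [mul_zero] at h1
  filter_upwards [h1.eventually (lt_mem_nhds (by norm_num : (-2 : ℝ) < 0)), eventually_gt_atTop 0] with M h hM
  have hM' : (0 : ℝ) < M := by exact_mod_cast hM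
  have e : (M : ℝ) ^ ((1 : ℝ) / 6) = √M * (M : ℝ) ^ (-((1 : ℝ) / 3)) := by
    rw [Real.sqrt_eq_rpow, ← Real.rpow_add hM']; norm_num
  have : av x M = √M * (2 + x * (M : ℝ) ^ (-((1 : ℝ) / 3))) := by unfold av; rw [e]; ring
  rw [this]
  exact mul_nonneg (Real.sqrt_nonneg _) (by linarith)

lemma pois_lim {u : ℝ → ℝ} (hu : HM u) (x : ℝ) {r : ℕ → ℝ} (hr : ∀ M, 64 ≤ r M)
    (h1 : Tendsto (fun M : ℕ => r M / M) atTop (𝓝 1))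
    (h2 : Tendsto (fun M : ℕ => (r M - M) * (M : ℝ) ^ (-((2 : ℝ) / 3))) atTop (𝓝 0)) :
    Tendsto (fun M => Real.exp (-r M) * D ⌊av x M⌋₊ (√(r M))) atTop
      (𝓝 (Real.exp (-∫ s in Set.Ioi x, (s - x) * u s ^ 2))) := by
  have hr0 : ∀ M, 0 < r M := fun M => by linarith [hr M]
  set η : ℕ → ℝ := fun M => (r M) ^ (-((1 : ℝ) / 6)) with hηd
  have hη : ∀ M, 0 < η M := fun M => Real.rpow_pos_of_pos (hr0 M) _
  have hη1 : ∀ M, η M ≤ 1 / 2 := fun M => by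
    have e : (1 / 2 : ℝ) = (64 : ℝ) ^ (-((1 : ℝ) / 6)) := by
      rw [show (64 : ℝ) = 2 ^ (6 : ℝ) by norm_num, ← Real.rpow_mul (by norm_num)]
      norm_num [Real.rpow_neg_one]
    rw [e]
    exact Real.rpow_le_rpow_of_nonpos (by norm_num) (hr M) (by norm_num)
  have hte : ∀ M, √(r M) * η M ^ 3 = 1 := fun M => by
    simp only [hηd]
    rw [Real.sqrt_eq_rpow, ← Real.rpow_natCast, ← Real.rpow_mul (hr0 M).le, ← Real.rpow_add (hr0 M)]
    norm_num
  have hs : Tendsto (fun M : ℕ => (M : ℝ) ^ ((1 : ℝ) / 6) * η M) atTop (𝓝 1) := by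
    have := h1.rpow_const (p := -((1 : ℝ) / 6)) (Or.inl one_ne_zero)
    rw [Real.one_rpow] at this
    refine this.congr fun M => ?_
    simp only [hηd]
    rw [Real.div_rpow (hr0 M).le (Nat.cast_nonneg _), Real.rpow_neg (Nat.cast_nonneg M), div_inv_eq_mul, mul_comm]
  have hη0 : Tendsto η atTop (𝓝 0) := by
    have := hs.mul (natpow (c := 1 / 6) (by norm_num))
    rw [mul_zero] at this
    refine this.congr' ?_
    filter_upwards [eventually_gt_atTop 0] with M hM
    have hM' : (0 : ℝ) < M := by exact_mod_cast hM
    rw [mul_right_comm, ← Real.rpow_add hM']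
    norm_num
  have hX : Tendsto (fun M => ((⌊av x M⌋₊ : ℝ) - 2 * √(r M)) * η M) atTop (𝓝 x) := by
    have a1 : Tendsto (fun M => ((⌊av x M⌋₊ : ℝ) - av x M) * η M) atTop (𝓝 0) := by
      refine squeeze_zero_norm' ?_ hη0
      filter_upwards [av_pos x] with M hM
      rw [norm_mul, Real.norm_of_nonneg (hη M).le]
      refine mul_le_of_le_one_left (hη M).le ?_
      rw [Real.norm_eq_abs, abs_le]
      constructor <;> linarith [Nat.floor_le hM, Nat.lt_floor_add_one (av x M)]
    have a2 := hs.const_mul x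
    have a3 : Tendsto (fun M : ℕ => (1 + √(r M / M))⁻¹) atTop (𝓝 (1 + √1)⁻¹) :=
      (((Real.continuous_sqrt.tendsto _).comp h1).const_add 1).inv₀ (by positivity)
    have a4 := ((h2.mul hs).mul a3).const_mul (-2)
    have := (a1.add a2).add a4
    simp only [zero_mul, mul_zero, mul_one, add_zero, zero_add] at this
    refine this.congr' ?_
    filter_upwards [eventually_gt_atTop 0] with M hM
    have hM' : (0 : ℝ) < M := by exact_mod_cast hM
    have e1 : (M : ℝ) ^ (-((2 : ℝ) / 3)) * (M : ℝ) ^ ((1 : ℝ) / 6) = (√M)⁻¹ := by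
      rw [Real.sqrt_eq_rpow, ← Real.rpow_add hM', ← Real.rpow_neg hM'.le]; norm_num
    have e2 : -2 * ((r M - M) * (M : ℝ) ^ (-((2 : ℝ) / 3)) * ((M : ℝ) ^ ((1 : ℝ) / 6) * η M) *
        (1 + √(r M / M))⁻¹) = 2 * (√M - √(r M)) * η M := by
      have : (r M - M) * (M : ℝ) ^ (-((2 : ℝ) / 3)) * ((M : ℝ) ^ ((1 : ℝ) / 6) * η M) =
          (r M - M) * η M * (√M)⁻¹ := by rw [← e1]; ring
      rw [this, Real.sqrt_div (hr0 M).le]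
      have h5 := Real.sqrt_pos.2 hM'
      have h6 := Real.sqrt_pos.2 (hr0 M)
      have h7 : (r M - M) = (√(r M) - √M) * (√M + √(r M)) := by
        have := Real.sq_sqrt hM'.le
        have := Real.sq_sqrt (hr0 M).le
        linarith
      rw [h7]
      field_simp
      ring
    rw [e2]
    unfold av
    ring
  have := (Real.continuous_exp.tendsto _).comp (log_lim hu hη hη1 hte hη0 hX)
  refine this.congr fun M => ?_
  simp only [Function.comp_apply]
  rw [Real.exp_sub, Real.exp_log (D_pos _ _), Real.sq_sqrt (hr0 M).le, Real.exp_neg, div_eq_inv_mul]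

lemma exists_r (σ : ℝ) (hσ : σ ^ 2 = 1) : ∃ r : ℕ → ℝ, (∀ M, 64 ≤ r M) ∧
    Tendsto (fun M : ℕ => r M / M) atTop (𝓝 1) ∧
    Tendsto (fun M : ℕ => (r M - M) * (M : ℝ) ^ (-((2 : ℝ) / 3))) atTop (𝓝 0) ∧
    Tendsto (fun M : ℕ => r M / (M - r M) ^ 2) atTop (𝓝 0) ∧
    ∀ᶠ M in atTop, r M = M + σ * (M : ℝ) ^ ((3 : ℝ) / 5) := by
  have hM0 : ∀ᶠ M : ℕ in atTop, (0 : ℝ) < M := by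
    filter_upwards [eventually_gt_atTop 0] with M hM using by exact_mod_cast hM
  have h1 : Tendsto (fun M : ℕ => 1 + σ * (M : ℝ) ^ (-((2 : ℝ) / 5))) atTop (𝓝 1) := by
    simpa using ((natpow (c := 2 / 5) (by norm_num)).const_mul σ).const_add 1
  have e1 : ∀ᶠ M : ℕ in atTop, (M : ℝ) + σ * (M : ℝ) ^ ((3 : ℝ) / 5) =
      M * (1 + σ * (M : ℝ) ^ (-((2 : ℝ) / 5))) := by
    filter_upwards [hM0] with M hM
    have : (M : ℝ) ^ ((3 : ℝ) / 5) = M * (M : ℝ) ^ (-((2 : ℝ) / 5)) := by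
      nth_rw 2 [← Real.rpow_one (M : ℝ)]
      rw [← Real.rpow_add hM]; norm_num
    rw [this]; ring
  have ht := (tendsto_natCast_atTop_atTop (R := ℝ)).atTop_mul_pos one_pos h1
  have hev : ∀ᶠ M : ℕ in atTop, max ((M : ℝ) + σ * (M : ℝ) ^ ((3 : ℝ) / 5)) 64 =
      M + σ * (M : ℝ) ^ ((3 : ℝ) / 5) := by
    filter_upwards [e1, ht.eventually_ge_atTop 64] with M h h'
    rw [max_eq_left (by rw [h]; exact h')]
  have g1 : Tendsto (fun M : ℕ => max ((M : ℝ) + σ * (M : ℝ) ^ ((3 : ℝ) / 5)) 64 / M) atTop (𝓝 1) := by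
    refine h1.congr' ?_
    filter_upwards [hev, e1, hM0] with M a b c
    rw [a, b, mul_div_cancel_left₀ _ c.ne']
  refine ⟨fun M => max ((M : ℝ) + σ * (M : ℝ) ^ ((3 : ℝ) / 5)) 64, fun M => le_max_right _ _, g1, ?_, ?_, hev⟩
  · have := (natpow (c := 1 / 15) (by norm_num)).const_mul σ
    rw [mul_zero] at this
    refine this.congr' ?_
    filter_upwards [hev, hM0] with M a c
    rw [a, add_sub_cancel_left, mul_assoc, ← Real.rpow_add c]
    norm_num
  · have := g1.mul (natpow (c := 1 / 5) (by norm_num))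
    rw [mul_zero] at this
    refine this.congr' ?_
    filter_upwards [hev, hM0] with M a c
    rw [a, sub_add_cancel_left, neg_sq, mul_pow, hσ, one_mul, ← Real.rpow_natCast, ← Real.rpow_mul c.le,
      div_mul_eq_mul_div, div_eq_div_iff c.ne' (Real.rpow_pos_of_pos c _).ne', mul_assoc, ← Real.rpow_add c]
    norm_num

lemma main_lim {u : ℝ → ℝ} (hu : HM u) (x : ℝ) : Tendsto (fun N : ℕ =>
    (Nat.card {σ : Equiv.Perm (Fin N) //
      (lisLen σ : ℝ) ≤ 2 * Real.sqrt N + x * (N : ℝ) ^ ((1 : ℝ) / 6)} : ℝ) / (Nat.factorial N : ℝ))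
    atTop (𝓝 (Real.exp (-∫ s in Set.Ioi x, (s - x) * u s ^ 2))) := by
  obtain ⟨r, r0, r1, r2, r3, r4⟩ := exists_r (-1) (by norm_num)
  obtain ⟨r', r0', r1', r2', r3', r4'⟩ := exists_r 1 (by norm_num)
  have l1 := (pois_lim hu x r0 r1 r2).add r3
  have l2 := (pois_lim hu x r0' r1' r2').sub r3'
  rw [add_zero] at l1
  rw [sub_zero] at l2
  have hq : Tendsto (fun M => q M ⌊av x M⌋₊) atTop
      (𝓝 (Real.exp (-∫ s in Set.Ioi x, (s - x) * u s ^ 2))) := by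
    refine tendsto_of_tendsto_of_tendsto_of_le_of_le' l2 l1 ?_ ?_
    · filter_upwards [r4', eventually_gt_atTop 0] with M h hM
      have hp := Real.rpow_pos_of_pos (show (0 : ℝ) < M by exact_mod_cast hM) ((3 : ℝ) / 5)
      linarith [pois_dn (n := ⌊av x M⌋₊) (show (M : ℝ) < r' M by linarith)]
    · filter_upwards [r4, eventually_gt_atTop 0] with M h hM
      have hp := Real.rpow_pos_of_pos (show (0 : ℝ) < M by exact_mod_cast hM) ((3 : ℝ) / 5)
      exact pois_up (by linarith [r0 M]) (show r M < M by linarith)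
  refine hq.congr' ?_
  filter_upwards [av_pos x] with M hM
  unfold q
  simp only [Nat.le_floor_iff hM]
  rfl

end BDJ

/-- Baik–Deift–Johansson: there is a unique (Hastings–McLeod) solution `u` of
Painlevé II with `u(s)/Ai(s) → 1` as `s → +∞`, and the centered and scaled length of
the longest increasing subsequence of a uniformly random permutation converges in
distribution to the Tracy–Widom law `exp(-∫_x^∞ (s-x)u(s)² ds)`. -/
theorem baik_deift_johansson :
    ∃ u : ℝ → ℝ,
      ((∀ s : ℝ, DifferentiableAt ℝ u s) ∧
        (∀ s : ℝ, HasDerivAt (deriv u) (s * u s + 2 * u s ^ 3) s) ∧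
        Tendsto (fun s : ℝ => (u s : ℂ) / Ai s) atTop (𝓝 1)) ∧
      (∀ v : ℝ → ℝ,
        ((∀ s : ℝ, DifferentiableAt ℝ v s) ∧
          (∀ s : ℝ, HasDerivAt (deriv v) (s * v s + 2 * v s ^ 3) s) ∧
          Tendsto (fun s : ℝ => (v s : ℂ) / Ai s) atTop (𝓝 1)) → v = u) ∧
      ∀ x : ℝ, Tendsto (fun N : ℕ =>
          (Nat.card {σ : Equiv.Perm (Fin N) //
              (lisLen σ : ℝ) ≤ 2 * Real.sqrt N + x * (N : ℝ) ^ ((1 : ℝ) / 6)} : ℝ) /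
            (Nat.factorial N : ℝ))
        atTop (𝓝 (Real.exp (-∫ s in Set.Ioi x, (s - x) * u s ^ 2))) := by
  obtain ⟨u, hu, -⟩ := BDJ.exists_HM (Ultrafilter.of atTop) (Ultrafilter.of_le atTop) BDJ.et_pos
    BDJ.et_half BDJ.tk_et BDJ.et_tendsto
  exact ⟨u, hu, fun v hv => BDJ.HM.unique hu hv, BDJ.main_lim hu⟩
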